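/- arXiv:1706.04967 — 9 statements merged into one kernel-verified Lean document; each statement's English description precedes it below -/
import Mathlib

section
/- Let S be a finite monoid and let G = {x ∈ S : IsUnit x} be its group of units. For a subsemigroup M of S, the following are equivalent: (i) M is a maximal subsemigroup of S and S \ M ⊆ G; (ii) there exists a maximal subsemigroup U of the unit group Sˣ such that the underlying set of M equals (S \ G) ∪ {↑u : u ∈ U}. -/
/-- The subsemigroup of a Dedekind-finite monoid consisting of all non-units together with the
units lying in a given subsemigroup of the group of units. -/
def Subsemigroup.nonunitsUnion {S : Type*} [Monoid S] [IsDedekindFiniteMonoid S]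
    (U : Subsemigroup Sˣ) : Subsemigroup S where
  carrier := {x | ∀ u : Sˣ, (u : S) = x → u ∈ U}
  mul_mem' := by
    intro a b ha hb w hw
    have hab : IsUnit (a * b) := ⟨w, hw⟩
    obtain ⟨⟨u, rfl⟩, ⟨v, rfl⟩⟩ := IsUnit.mul_iff.mp hab
    have hwuv : w = u * v := Units.ext hw
    exact hwuv ▸ U.mul_mem (ha u rfl) (hb v rfl)

theorem Subsemigroup.mem_nonunitsUnion {S : Type*} [Monoid S] [IsDedekindFiniteMonoid S]
    {U : Subsemigroup Sˣ} {x : S} :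
    x ∈ nonunitsUnion U ↔ ∀ u : Sˣ, (u : S) = x → u ∈ U :=
  Iff.rfl

theorem Subsemigroup.coe_nonunitsUnion {S : Type*} [Monoid S] [IsDedekindFiniteMonoid S]
    (U : Subsemigroup Sˣ) :
    (nonunitsUnion U : Set S) = {x : S | IsUnit x}ᶜ ∪ {x : S | ∃ u ∈ U, (u : S) = x} := by
  ext x
  by_cases hx : IsUnit x
  · obtain ⟨u, rfl⟩ := hx
    simp [mem_nonunitsUnion, Units.val_inj]
  · have hne : ∀ u : Sˣ, (u : S) ≠ x := fun u hu => hx ⟨u, hu⟩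
    simp [mem_nonunitsUnion, hx, hne]

/-- Subsemigroups of the group of units of a Dedekind-finite monoid correspond to the
subsemigroups of the monoid containing all non-units. -/
def Subsemigroup.unitsOrderIso (S : Type*) [Monoid S] [IsDedekindFiniteMonoid S] :
    Subsemigroup Sˣ ≃o Set.Ici (nonunitsUnion (⊥ : Subsemigroup Sˣ)) where
  toFun U := ⟨nonunitsUnion U, fun _ hx u hu => (notMem_bot (hx u hu)).elim⟩
  invFun M := M.1.comap (Units.coeHom S)
  left_inv U := by
    ext u
    simp [mem_nonunitsUnion, Units.val_inj]
  right_inv M := by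
    ext x
    by_cases hx : IsUnit x
    · obtain ⟨u, rfl⟩ := hx
      simp [mem_nonunitsUnion, Units.val_inj]
    · exact iff_of_true (fun u hu => (hx ⟨u, hu⟩).elim)
        (M.2 fun u hu => (hx ⟨u, hu⟩).elim)
  map_rel_iff' {U V} :=
    ⟨fun h u hu => h (fun _ hw => Units.ext hw ▸ hu) u rfl, fun h _ hx u hu => h (hx u hu)⟩

theorem Subsemigroup.isCoatom_nonunitsUnion_iff {S : Type*} [Monoid S] [IsDedekindFiniteMonoid S]
    {U : Subsemigroup Sˣ} : IsCoatom (nonunitsUnion U) ↔ IsCoatom U :=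
  Iff.trans ⟨fun h => h.Ici (unitsOrderIso S U).2, IsCoatom.of_isCoatom_coe_Ici⟩
    ((unitsOrderIso S).isCoatom_iff U)

theorem Subsemigroup.compl_subset_isUnit_iff {S : Type*} [Monoid S] [IsDedekindFiniteMonoid S]
    {M : Subsemigroup S} :
    (M : Set S)ᶜ ⊆ {x : S | IsUnit x} ↔ ∃ U : Subsemigroup Sˣ, nonunitsUnion U = M := by
  constructor
  · intro h
    have hM : nonunitsUnion ⊥ ≤ M := fun x hx => by
      by_contra hxM
      obtain ⟨u, hu⟩ := h hxM
      exact notMem_bot (hx u hu)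
    exact ⟨_, congrArg Subtype.val ((unitsOrderIso S).apply_symm_apply ⟨M, hM⟩)⟩
  · rintro ⟨U, rfl⟩ x hx
    by_contra hxu
    exact hx fun u hu => (hxu ⟨u, hu⟩).elim

theorem maximal_subsemigroup_arising_from_group_of_units
    {S : Type*} [Monoid S] [Fintype S] (M : Subsemigroup S) :
    (IsCoatom M ∧ (M : Set S)ᶜ ⊆ {x : S | IsUnit x}) ↔
      (∃ U : Subsemigroup Sˣ, IsCoatom U ∧
        (M : Set S) = {x : S | IsUnit x}ᶜ ∪ {x : S | ∃ u ∈ U, (u : S) = x}) := by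
  simp_rw [← Subsemigroup.coe_nonunitsUnion, SetLike.coe_set_eq,
    Subsemigroup.compl_subset_isUnit_iff]
  constructor
  · rintro ⟨hM, U, rfl⟩
    exact ⟨U, Subsemigroup.isCoatom_nonunitsUnion_iff.mp hM, rfl⟩
  · rintro ⟨U, hU, rfl⟩
    exact ⟨Subsemigroup.isCoatom_nonunitsUnion_iff.mpr hU, U, rfl⟩
end

section
/- Let S be a finite monoid with group of units G = {x ∈ S : IsUnit x}. (a) If 1 is the only unit of S and S is nontrivial, then S \ {1} is a maximal subsemigroup of S, and it is the unique maximal subsemigroup M of S with S \ M ⊆ G. (b) If S has a unit different from 1, then a subsemigroup M of S is a maximal subsemigroup of S with S \ M ⊆ G if and only if there exists a maximal subgroup U of the unit group Sˣ such that the underlying set of M equals (S \ G) ∪ {↑u : u ∈ U}. -/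
/-- The subsemigroup of a finite monoid consisting of all non-units together with the units
lying in a given subgroup. -/
def Subgroup.unionNonunits {S : Type*} [Monoid S] [Finite S] (U : Subgroup Sˣ) :
    Subsemigroup S where
  carrier := {x : S | IsUnit x}ᶜ ∪ {x : S | ∃ u ∈ U, (u : S) = x}
  mul_mem' := by
    rintro a b (ha | ⟨u, hu, rfl⟩) (hb | ⟨v, hv, rfl⟩)
    · exact Or.inl fun h => ha (IsUnit.mul_iff.1 h).1
    · exact Or.inl fun h => ha (IsUnit.mul_iff.1 h).1
    · exact Or.inl fun h => hb (IsUnit.mul_iff.1 h).2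
    · exact Or.inr ⟨u * v, U.mul_mem hu hv, by simp⟩

theorem Subgroup.unit_mem_unionNonunits {S : Type*} [Monoid S] [Finite S] {U : Subgroup Sˣ}
    {u : Sˣ} : (u : S) ∈ U.unionNonunits ↔ u ∈ U := by
  refine ⟨?_, fun h => Or.inr ⟨u, h, rfl⟩⟩
  rintro (h | ⟨v, hv, h⟩)
  · exact (h u.isUnit).elim
  · rwa [← Units.ext h]

/-- The subgroup of units lying in a subsemigroup of a finite monoid that contains `1`. -/
def Subsemigroup.unitSubgroup {S : Type*} [Monoid S] [Finite S] (M : Subsemigroup S)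
    (h1 : (1 : S) ∈ M) : Subgroup Sˣ where
  carrier := {u | (u : S) ∈ M}
  one_mem' := h1
  mul_mem' := fun ha hb => M.mul_mem ha hb
  inv_mem' := by
    intro x hx
    let N : Submonoid Sˣ :=
      { carrier := {u | (u : S) ∈ M}, one_mem' := h1, mul_mem' := fun ha hb => M.mul_mem ha hb }
    have hmem : x⁻¹ ∈ Submonoid.powers x :=
      (isOfFinOrder_of_finite x).mem_powers_iff_mem_zpowers.2
        (Subgroup.inv_mem _ (Subgroup.mem_zpowers x))
    exact (Submonoid.powers_le (P := N)).2 hx hmem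

theorem Subsemigroup.mem_unitSubgroup {S : Type*} [Monoid S] [Finite S] {M : Subsemigroup S}
    {h1 : (1 : S) ∈ M} {u : Sˣ} : u ∈ M.unitSubgroup h1 ↔ (u : S) ∈ M :=
  Iff.rfl

theorem Subsemigroup.unionNonunits_unitSubgroup {S : Type*} [Monoid S] [Finite S]
    {M : Subsemigroup S} (h1 : (1 : S) ∈ M) (hM : (M : Set S)ᶜ ⊆ {x : S | IsUnit x}) :
    (M.unitSubgroup h1).unionNonunits = M := by
  ext x
  by_cases hx : IsUnit x
  · obtain ⟨u, rfl⟩ := hx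
    rw [Subgroup.unit_mem_unionNonunits, mem_unitSubgroup]
  · exact iff_of_true (Or.inl hx) (by_contra fun h => hx (hM h))

theorem Subgroup.compl_unionNonunits_subset {S : Type*} [Monoid S] [Finite S] (U : Subgroup Sˣ) :
    (U.unionNonunits : Set S)ᶜ ⊆ {x : S | IsUnit x} :=
  fun _ hx => by_contra fun h => hx (Or.inl h)

theorem Subgroup.unionNonunits_le_iff {S : Type*} [Monoid S] [Finite S] {U V : Subgroup Sˣ} :
    U.unionNonunits ≤ V.unionNonunits ↔ U ≤ V := by
  refine ⟨fun h u hu => unit_mem_unionNonunits.1 (h (unit_mem_unionNonunits.2 hu)), ?_⟩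
  rintro h x (hx | ⟨u, hu, rfl⟩)
  · exact Or.inl hx
  · exact unit_mem_unionNonunits.2 (h hu)

theorem Subgroup.unionNonunits_eq_top_iff {S : Type*} [Monoid S] [Finite S] {U : Subgroup Sˣ} :
    U.unionNonunits = ⊤ ↔ U = ⊤ := by
  constructor
  · intro h
    exact eq_top_iff.2 fun u _ => unit_mem_unionNonunits.1 (h ▸ Subsemigroup.mem_top _)
  · rintro rfl
    refine eq_top_iff.2 fun x _ => ?_
    by_cases hx : IsUnit x
    · exact Or.inr ⟨hx.unit, mem_top _, rfl⟩
    · exact Or.inl hx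

theorem Subgroup.isCoatom_unionNonunits_iff {S : Type*} [Monoid S] [Finite S]
    {U : Subgroup Sˣ} : IsCoatom U.unionNonunits ↔ IsCoatom U := by
  have lt_iff {V W : Subgroup Sˣ} : V.unionNonunits < W.unionNonunits ↔ V < W := by
    simp only [lt_iff_le_not_ge, unionNonunits_le_iff]
  refine and_congr (not_congr unionNonunits_eq_top_iff) ⟨?_, ?_⟩
  · exact fun h V hV => unionNonunits_eq_top_iff.1 (h _ (lt_iff.2 hV))
  · intro h N hN
    have h1 : (1 : S) ∈ N := hN.le (Or.inr ⟨1, U.one_mem, rfl⟩)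
    have hN' := N.unionNonunits_unitSubgroup h1
      ((Set.compl_subset_compl.2 hN.le).trans U.compl_unionNonunits_subset)
    rw [← hN'] at hN ⊢
    exact unionNonunits_eq_top_iff.2 (h _ (lt_iff.1 hN))

theorem Subsemigroup.isCoatom_of_coe_eq_compl_singleton {S : Type*} [Mul S]
    {M : Subsemigroup S} {a : S} (hM : (M : Set S) = {a}ᶜ) : IsCoatom M := by
  have mem_iff (x : S) : x ∈ M ↔ x ≠ a := by
    rw [← SetLike.mem_coe, hM]; rfl
  refine ⟨fun h => (mem_iff a).1 (h ▸ mem_top a) rfl, fun N hN => ?_⟩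
  obtain ⟨y, hyN, hyM⟩ := SetLike.exists_of_lt hN
  obtain rfl : y = a := by_contra fun h => hyM ((mem_iff y).2 h)
  refine eq_top_iff.2 fun x _ => ?_
  by_cases hx : x = y
  · exact hx ▸ hyN
  · exact hN.le ((mem_iff x).2 hx)

theorem Subsemigroup.coe_eq_compl_one_of_isCoatom {S : Type*} [Monoid S]
    {M : Subsemigroup S} (hM : IsCoatom M) (h1 : (1 : S) ∉ M) : (M : Set S) = {(1 : S)}ᶜ := by
  let N : Subsemigroup S :=
    { carrier := insert 1 (M : Set S)
      mul_mem' := by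
        rintro a b (rfl | ha) (rfl | hb)
        · simp
        · simpa using Or.inr hb
        · simpa using Or.inr ha
        · exact Or.inr (M.mul_mem ha hb) }
  have hN : N = ⊤ := hM.2 N (SetLike.lt_iff_le_and_exists.2
    ⟨fun x hx => Or.inr hx, 1, Or.inl rfl, h1⟩)
  ext x
  have hx : x ∈ N := hN ▸ mem_top x
  exact ⟨fun h hx1 => h1 (hx1 ▸ h), hx.resolve_left⟩

theorem maximal_subsemigroups_arising_from_units_trivial_and_nontrivial
    {S : Type*} [Monoid S] [Fintype S] :
    ((∀ x : S, IsUnit x → x = 1) → Nontrivial S →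
      ((∃ M : Subsemigroup S, (M : Set S) = {(1 : S)}ᶜ ∧ IsCoatom M) ∧
        (∀ M : Subsemigroup S, IsCoatom M → (M : Set S)ᶜ ⊆ {x : S | IsUnit x} →
          (M : Set S) = {(1 : S)}ᶜ))) ∧
    ((∃ x : S, IsUnit x ∧ x ≠ 1) →
      ∀ M : Subsemigroup S,
        (IsCoatom M ∧ (M : Set S)ᶜ ⊆ {x : S | IsUnit x}) ↔
          (∃ U : Subgroup Sˣ, IsCoatom U ∧
            (M : Set S) = {x : S | IsUnit x}ᶜ ∪ {x : S | ∃ u ∈ U, (u : S) = x})) := by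
  refine ⟨fun hunit _ => ⟨?_, fun M hM hMu => ?_⟩, ?_⟩
  · let M : Subsemigroup S :=
      { carrier := {(1 : S)}ᶜ
        mul_mem' := fun {a b} ha _ hab =>
          ha (hunit a (IsUnit.of_mul_eq_one b hab)) }
    exact ⟨M, rfl, Subsemigroup.isCoatom_of_coe_eq_compl_singleton (a := 1) rfl⟩
  · refine Subsemigroup.coe_eq_compl_one_of_isCoatom hM fun h1 => hM.1 ?_
    refine eq_top_iff.2 fun x _ => by_contra fun hx => hx ?_
    rwa [hunit x (hMu hx)]
  · rintro ⟨_, ⟨x, rfl⟩, hx1⟩ M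
    constructor
    · rintro ⟨hM, hMu⟩
      have h1 : (1 : S) ∈ M := by
        by_contra h1
        have mem_of_ne {y : S} (hy : y ≠ 1) : y ∈ M := by
          rw [← SetLike.mem_coe, Subsemigroup.coe_eq_compl_one_of_isCoatom hM h1]
          exact hy
        have hinv : ((x⁻¹ : Sˣ) : S) ≠ 1 := by simpa using hx1
        exact h1 (x.mul_inv ▸ M.mul_mem (mem_of_ne hx1) (mem_of_ne hinv))
      have hMeq := Subsemigroup.unionNonunits_unitSubgroup h1 hMu
      refine ⟨M.unitSubgroup h1, Subgroup.isCoatom_unionNonunits_iff.1 (hMeq.symm ▸ hM), ?_⟩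
      exact congrArg SetLike.coe hMeq.symm
    · rintro ⟨U, hU, hMU⟩
      obtain rfl : M = U.unionNonunits := SetLike.coe_injective hMU
      exact ⟨Subgroup.isCoatom_unionNonunits_iff.2 hU, U.compl_unionNonunits_subset⟩
end

section
/- Let n ≥ 3 and consider the dihedral group DihedralGroup n of order 2n, with rotations r i and reflections sr i (i : ZMod n); it is generated by the rotation r 1 of order n and the reflection sr 0. A subgroup H of DihedralGroup n is a maximal subgroup (IsCoatom H) if and only if H = Subgroup.zpowers (r 1), or there exist a prime p dividing n and a natural number i with i ≤ p − 1 such that H = Subgroup.closure {r (p : ZMod n), sr (i : ZMod n)}. Consequently, the number of maximal subgroups of DihedralGroup n equals 1 + ∑_{p ∈ Nat.primeFactors n} p. -/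
namespace ZMod

variable {n p : ℕ}

theorem intCast_mem_zmultiples_natCast_iff (hpn : p ∣ n) (k : ℤ) :
    (k : ZMod n) ∈ AddSubgroup.zmultiples (p : ZMod n) ↔ (p : ℤ) ∣ k := by
  rw [AddSubgroup.mem_zmultiples_iff]
  constructor
  · rintro ⟨m, hm⟩
    have h : ((m * p : ℤ) : ZMod n) = (k : ZMod n) := by simpa using hm
    have hdvd := (ZMod.intCast_eq_intCast_iff_dvd_sub _ _ _).mp h
    exact (dvd_sub_left (dvd_mul_left _ _)).mp ((Int.natCast_dvd_natCast.mpr hpn).trans hdvd)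
  · rintro ⟨m, rfl⟩
    exact ⟨m, by simp [mul_comm]⟩

theorem isCoatom_zmultiples_natCast (hp : p.Prime) (hpn : p ∣ n) :
    IsCoatom (AddSubgroup.zmultiples (p : ZMod n)) := by
  constructor
  · intro h
    have h1 : ((1 : ℤ) : ZMod n) ∈ AddSubgroup.zmultiples (p : ZMod n) := h ▸ AddSubgroup.mem_top _
    rw [intCast_mem_zmultiples_natCast_iff hpn] at h1
    exact hp.one_lt.ne' (by exact_mod_cast Int.eq_one_of_dvd_one (by positivity) h1)
  · intro A hA
    obtain ⟨hle, x, hxA, hx⟩ := SetLike.lt_iff_le_and_exists.mp hA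
    obtain ⟨k, rfl⟩ := ZMod.intCast_surjective x
    rw [intCast_mem_zmultiples_natCast_iff hpn] at hx
    obtain ⟨a, b, hab⟩ := (Nat.prime_iff_prime_int.mp hp).coprime_iff_not_dvd.mpr hx
    have hpA : (p : ZMod n) ∈ A := hle (AddSubgroup.mem_zmultiples _)
    have h1 : (1 : ZMod n) ∈ A := by
      have h := A.add_mem (A.zsmul_mem hpA a) (A.zsmul_mem hxA b)
      have hab' := congrArg (Int.cast : ℤ → ZMod n) hab
      push_cast at hab'
      simpa [hab'] using h
    refine (AddSubgroup.eq_top_iff' A).mpr fun y => ?_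
    obtain ⟨m, rfl⟩ := ZMod.intCast_surjective y
    simpa using A.zsmul_mem h1 m

theorem exists_prime_le_zmultiples {A : AddSubgroup (ZMod n)} (hA : A ≠ ⊤) :
    ∃ p : ℕ, p.Prime ∧ p ∣ n ∧ A ≤ AddSubgroup.zmultiples (p : ZMod n) := by
  obtain ⟨g, hg⟩ := Int.subgroup_cyclic (A.comap (Int.castAddHom (ZMod n)))
  have hmem (k : ℤ) : (k : ZMod n) ∈ A ↔ g ∣ k := by
    rw [← Int.mem_zmultiples_iff, AddSubgroup.zmultiples_eq_closure, ← hg]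
    rfl
  have hg1 : g.natAbs ≠ 1 := fun h => hA <| (AddSubgroup.eq_top_iff' A).mpr fun y => by
    obtain ⟨m, rfl⟩ := ZMod.intCast_surjective y
    exact (hmem m).mpr ((Int.isUnit_iff_natAbs_eq.mpr h).dvd)
  obtain ⟨p, hp, hpg⟩ := Nat.exists_prime_and_dvd hg1
  have hpg' : (p : ℤ) ∣ g := Int.natCast_dvd.mpr hpg
  have hgn : g ∣ (n : ℤ) := (hmem n).mp (by simp)
  have hpn : p ∣ n := Int.natCast_dvd_natCast.mp (hpg'.trans hgn)
  refine ⟨p, hp, hpn, fun y hy => ?_⟩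
  obtain ⟨m, rfl⟩ := ZMod.intCast_surjective y
  exact (intCast_mem_zmultiples_natCast_iff hpn m).mpr (hpg'.trans ((hmem m).mp hy))

end ZMod

namespace DihedralGroup

variable {n : ℕ}

/-- The additive subgroup of those `j` for which the rotation `r j` lies in `H`. -/
def rotations (H : Subgroup (DihedralGroup n)) : AddSubgroup (ZMod n) where
  carrier := {j | r j ∈ H}
  zero_mem' := H.one_mem
  add_mem' := fun ha hb => H.mul_mem ha hb
  neg_mem' := fun ha => H.inv_mem ha

@[simp]
theorem mem_rotations {H : Subgroup (DihedralGroup n)} {j : ZMod n} :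
    j ∈ rotations H ↔ r j ∈ H := Iff.rfl

theorem sr_mem_iff_sub_mem_rotations {H : Subgroup (DihedralGroup n)} {i : ZMod n}
    (hi : sr i ∈ H) (j : ZMod n) : sr j ∈ H ↔ j - i ∈ rotations H := by
  rw [mem_rotations, ← sr_mul_sr, H.mul_mem_cancel_left hi]

theorem le_of_rotations_le {H K : Subgroup (DihedralGroup n)} {i : ZMod n}
    (hH : sr i ∈ H) (hK : sr i ∈ K) (h : rotations H ≤ rotations K) : H ≤ K := by
  rintro (j | j) hj
  · exact h hj
  · rw [sr_mem_iff_sub_mem_rotations hK]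
    exact h ((sr_mem_iff_sub_mem_rotations hH j).mp hj)

theorem eq_of_rotations_eq {H K : Subgroup (DihedralGroup n)} {i : ZMod n}
    (hH : sr i ∈ H) (hK : sr i ∈ K) (h : rotations H = rotations K) : H = K :=
  le_antisymm (le_of_rotations_le hH hK h.le) (le_of_rotations_le hK hH h.ge)

theorem rotations_top : rotations (⊤ : Subgroup (DihedralGroup n)) = ⊤ := rfl

theorem sr_mem_closure (a i : ZMod n) : sr i ∈ Subgroup.closure {r a, sr i} :=
  Subgroup.subset_closure (by simp)

/-- The subgroup of all `r j` with `j ∈ A` and all `sr j` with `j - i ∈ A`. -/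
def ofRotations (A : AddSubgroup (ZMod n)) (i : ZMod n) : Subgroup (DihedralGroup n) where
  carrier := {x | match x with
    | r j => j ∈ A
    | sr j => j - i ∈ A}
  one_mem' := A.zero_mem
  mul_mem' := by
    rintro (a | a) (b | b) ha hb
    · exact A.add_mem ha hb
    · have h := A.sub_mem hb ha
      rwa [sub_right_comm] at h
    · have h := A.add_mem ha hb
      rwa [sub_add_eq_add_sub] at h
    · have h := A.sub_mem hb ha
      rwa [sub_sub_sub_cancel_right] at h
  inv_mem' := by
    rintro (a | a) ha
    · exact A.neg_mem ha
    · exact ha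

theorem rotations_closure (a i : ZMod n) :
    rotations (Subgroup.closure {r a, sr i}) = AddSubgroup.zmultiples a := by
  apply le_antisymm
  · have h : Subgroup.closure {r a, sr i} ≤ ofRotations (AddSubgroup.zmultiples a) i := by
      rw [Subgroup.closure_le]
      rintro _ (rfl | rfl)
      · exact AddSubgroup.mem_zmultiples a
      · change i - i ∈ AddSubgroup.zmultiples a
        simp
    exact fun j hj => h hj
  · rw [AddSubgroup.zmultiples_le]
    exact Subgroup.subset_closure (by simp)

theorem sr_mem_closure_iff (a i j : ZMod n) :
    sr j ∈ Subgroup.closure {r a, sr i} ↔ j - i ∈ AddSubgroup.zmultiples a := by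
  rw [sr_mem_iff_sub_mem_rotations (sr_mem_closure a i), rotations_closure]

theorem r_mem_zpowers_r_one (j : ZMod n) : r j ∈ Subgroup.zpowers (r 1 : DihedralGroup n) := by
  obtain ⟨k, rfl⟩ := ZMod.intCast_surjective j
  exact ⟨k, r_one_zpow k⟩

theorem sr_notMem_zpowers_r_one (j : ZMod n) :
    sr j ∉ Subgroup.zpowers (r 1 : DihedralGroup n) := by
  rintro ⟨k, hk⟩
  simp at hk

theorem isCoatom_zpowers_r_one : IsCoatom (Subgroup.zpowers (r 1 : DihedralGroup n)) := by
  refine ⟨fun h => sr_notMem_zpowers_r_one (0 : ZMod n) (h ▸ Subgroup.mem_top _), fun K hK => ?_⟩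
  obtain ⟨hle, x, hxK, hx⟩ := SetLike.lt_iff_le_and_exists.mp hK
  obtain j | j := x
  · exact absurd (r_mem_zpowers_r_one j) hx
  · exact eq_of_rotations_eq hxK (Subgroup.mem_top _)
      (eq_top_iff.mpr fun k _ => hle (r_mem_zpowers_r_one k))

theorem isCoatom_closure {p : ℕ} (hp : p.Prime) (hpn : p ∣ n) (i : ZMod n) :
    IsCoatom (Subgroup.closure {r (p : ZMod n), sr i}) := by
  have hA := ZMod.isCoatom_zmultiples_natCast hp hpn
  refine ⟨fun h => hA.1 (by rw [← rotations_closure _ i, h, rotations_top]), fun K hK => ?_⟩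
  have hiK : sr i ∈ K := hK.le (sr_mem_closure _ i)
  have hle : AddSubgroup.zmultiples (p : ZMod n) ≤ rotations K := by
    rw [← rotations_closure _ i]
    exact fun j hj => hK.le hj
  rcases hA.le_iff.mp hle with h | h
  · exact eq_of_rotations_eq hiK (Subgroup.mem_top _) h
  · exact absurd (eq_of_rotations_eq (sr_mem_closure _ i) hiK
      ((rotations_closure _ i).trans h.symm)) hK.ne

theorem isCoatom_iff [NeZero n] (H : Subgroup (DihedralGroup n)) :
    IsCoatom H ↔
      (H = Subgroup.zpowers (r 1) ∨
        ∃ p i : ℕ, p.Prime ∧ p ∣ n ∧ i ≤ p - 1 ∧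
          H = Subgroup.closure {r (p : ZMod n), sr (i : ZMod n)}) := by
  constructor
  · intro hH
    by_cases hsr : ∃ i, sr i ∈ H
    · right
      obtain ⟨i, hi⟩ := hsr
      have hA : rotations H ≠ ⊤ := fun h =>
        hH.1 (eq_of_rotations_eq hi (Subgroup.mem_top _) h)
      obtain ⟨p, hp, hpn, hle⟩ := ZMod.exists_prime_le_zmultiples hA
      have hlt : i.val % p < p := Nat.mod_lt _ hp.pos
      refine ⟨p, i.val % p, hp, hpn, by lia, ?_⟩
      have hi' : sr i ∈ Subgroup.closure {r (p : ZMod n), sr ((i.val % p : ℕ) : ZMod n)} := by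
        rw [sr_mem_closure_iff]
        have h := (ZMod.intCast_mem_zmultiples_natCast_iff hpn
          ((i.val : ℤ) - ((i.val % p : ℕ) : ℤ))).mpr (by
            rw [Int.natCast_mod]
            exact Int.dvd_self_sub_emod)
        rwa [Int.cast_sub, Int.cast_natCast, Int.cast_natCast, ZMod.natCast_zmod_val] at h
      have hHle := le_of_rotations_le hi hi' (by rwa [rotations_closure])
      exact ((hH.le_iff.mp hHle).resolve_left (isCoatom_closure hp hpn _).1).symm
    · left
      have hHle : H ≤ Subgroup.zpowers (r 1) := by
        rintro (j | j) hj
        · exact r_mem_zpowers_r_one j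
        · exact absurd ⟨j, hj⟩ hsr
      exact ((hH.le_iff.mp hHle).resolve_left isCoatom_zpowers_r_one.1).symm
  · rintro (rfl | ⟨p, i, hp, hpn, -, rfl⟩)
    · exact isCoatom_zpowers_r_one
    · exact isCoatom_closure hp hpn _

theorem closure_injOn :
    Set.InjOn (fun x : (_ : ℕ) × ℕ =>
        Subgroup.closure {r (x.1 : ZMod n), sr (x.2 : ZMod n)})
      (n.primeFactors.sigma Finset.range : Finset ((_ : ℕ) × ℕ)) := by
  rintro ⟨p, i⟩ hx ⟨q, j⟩ hy h
  simp only [Finset.coe_sigma, Set.mem_sigma_iff, Finset.mem_coe, Nat.mem_primeFactors,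
    Finset.mem_range] at hx hy
  obtain ⟨⟨hp, hpn, -⟩, hi⟩ := hx
  obtain ⟨⟨hq, hqn, -⟩, hj⟩ := hy
  dsimp only at h
  have hrot := congrArg rotations h
  rw [rotations_closure, rotations_closure] at hrot
  have hqp : (p : ZMod n) ∈ AddSubgroup.zmultiples (q : ZMod n) :=
    hrot ▸ AddSubgroup.mem_zmultiples _
  rw [← Int.cast_natCast p, ZMod.intCast_mem_zmultiples_natCast_iff hqn] at hqp
  obtain rfl := (Nat.prime_dvd_prime_iff_eq hq hp).mp (Int.natCast_dvd_natCast.mp hqp)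
  have hsr : sr (i : ZMod n) ∈ Subgroup.closure {r (q : ZMod n), sr (j : ZMod n)} :=
    h ▸ sr_mem_closure _ _
  rw [sr_mem_closure_iff, ← Int.cast_natCast i, ← Int.cast_natCast j, ← Int.cast_sub,
    ZMod.intCast_mem_zmultiples_natCast_iff hqn] at hsr
  have hij : j ≡ i [MOD q] := (Nat.modEq_iff_dvd).mpr hsr
  obtain rfl := hij.eq_of_lt_of_lt hj hi
  rfl

theorem ncard_setOf_isCoatom [NeZero n] :
    Set.ncard {H : Subgroup (DihedralGroup n) | IsCoatom H} =
      1 + ∑ p ∈ Nat.primeFactors n, p := by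
  have hset : {H : Subgroup (DihedralGroup n) | IsCoatom H} =
      insert (Subgroup.zpowers (r 1)) ((fun x : (_ : ℕ) × ℕ =>
        Subgroup.closure {r (x.1 : ZMod n), sr (x.2 : ZMod n)}) ''
          (n.primeFactors.sigma Finset.range : Finset ((_ : ℕ) × ℕ))) := by
    ext H
    rw [Set.mem_ofPred_eq, isCoatom_iff, Set.mem_insert_iff]
    refine or_congr_right ⟨?_, ?_⟩
    · rintro ⟨p, i, hp, hpn, hi, rfl⟩
      have hip : i < p := by have := hp.pos; lia
      exact ⟨⟨p, i⟩, by simp [hp, hpn, hip, NeZero.ne n], rfl⟩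
    · rintro ⟨⟨p, i⟩, hx, rfl⟩
      simp only [Finset.coe_sigma, Set.mem_sigma_iff, Finset.mem_coe, Nat.mem_primeFactors,
        Finset.mem_range] at hx
      exact ⟨p, i, hx.1.1, hx.1.2.1, by lia, rfl⟩
  have hnotMem : Subgroup.zpowers (r 1 : DihedralGroup n) ∉ ((fun x : (_ : ℕ) × ℕ =>
      Subgroup.closure {r (x.1 : ZMod n), sr (x.2 : ZMod n)}) ''
        (n.primeFactors.sigma Finset.range : Finset ((_ : ℕ) × ℕ))) := by
    rintro ⟨⟨p, i⟩, -, h⟩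
    exact sr_notMem_zpowers_r_one (i : ZMod n) (h ▸ sr_mem_closure _ _)
  rw [hset, Set.ncard_insert_of_notMem hnotMem ((Finset.finite_toSet _).image _),
    closure_injOn.ncard_image, Set.ncard_coe_finset, Finset.card_sigma, add_comm]
  simp

end DihedralGroup

theorem maximal_subgroups_of_dihedral_group (n : ℕ) (hn : 3 ≤ n) :
    (∀ H : Subgroup (DihedralGroup n), IsCoatom H ↔
      (H = Subgroup.zpowers (DihedralGroup.r 1) ∨
        ∃ p i : ℕ, p.Prime ∧ p ∣ n ∧ i ≤ p - 1 ∧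
          H = Subgroup.closure
            {DihedralGroup.r (p : ZMod n), DihedralGroup.sr (i : ZMod n)})) ∧
    Set.ncard {H : Subgroup (DihedralGroup n) | IsCoatom H} =
      1 + ∑ p ∈ Nat.primeFactors n, p := by
  have : NeZero n := ⟨by lia⟩
  exact ⟨DihedralGroup.isCoatom_iff, DihedralGroup.ncard_setOf_isCoatom⟩
end

section
/- Let S be a finite monoid, let e ∈ S be an idempotent (e * e = e), and let T be a submonoid of S containing e and containing every unit of S. Define the H-class of e in S as H_e = {x ∈ S : (∃ u, x * u = e) ∧ (∃ v, e * v = x) ∧ (∃ u', u' * x = e) ∧ (∃ v', v' * e = x)}, and define the setwise stabilizer Stab = {g ∈ S : IsUnit g ∧ {x * g : x ∈ H_e} = H_e}. Then the set E = {e * g : g ∈ Stab} is a subgroup of the H-class of e in T; explicitly: E ⊆ T, E ⊆ H_e, e ∈ E, E is closed under multiplication, and for every x ∈ E there exists y ∈ E with x * y = e and y * x = e. -/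
/-- If right multiplication by `g` and by `h` both preserve `A`, so does that by `g * h`. -/
theorem image_mul_right_mul_eq {S : Type*} [Semigroup S] {A : Set S} {g h : S}
    (hg : (· * g) '' A = A) (hh : (· * h) '' A = A) : (· * (g * h)) '' A = A := by
  conv_rhs => rw [← hh, ← hg, Set.image_image]
  simp only [mul_assoc]

/-- If right multiplication by a unit preserves `A`, so does that by its inverse. -/
theorem image_mul_right_units_inv_eq {S : Type*} [Monoid S] {A : Set S} {g : Sˣ}
    (hg : (· * (g : S)) '' A = A) : (· * ((g⁻¹ : Sˣ) : S)) '' A = A := by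
  conv_lhs => rw [← hg, Set.image_image]
  simp

theorem stab_subgroup_of_H_class
    {S : Type*} [Monoid S] [Fintype S] (e : S) (he : e * e = e)
    (T : Submonoid S) (heT : e ∈ T) (hUT : ∀ x : S, IsUnit x → x ∈ T) :
    let He : Set S := {x | (∃ u, x * u = e) ∧ (∃ v, e * v = x) ∧
      (∃ u', u' * x = e) ∧ (∃ v', v' * e = x)}
    let Stab : Set S := {g | IsUnit g ∧ {y | ∃ x ∈ He, x * g = y} = He}
    let E : Set S := {y | ∃ g ∈ Stab, e * g = y}
    E ⊆ (T : Set S) ∧ E ⊆ He ∧ e ∈ E ∧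
      (∀ x ∈ E, ∀ y ∈ E, x * y ∈ E) ∧
      (∀ x ∈ E, ∃ y ∈ E, x * y = e ∧ y * x = e) := by
  intro He Stab E
  have e_mem : e ∈ He := ⟨⟨e, he⟩, ⟨e, he⟩, ⟨e, he⟩, ⟨e, he⟩⟩
  have stab_one : (1 : S) ∈ Stab := ⟨isUnit_one, by simp⟩
  have stab_mul : ∀ g ∈ Stab, ∀ h ∈ Stab, g * h ∈ Stab := fun g hg h hh =>
    ⟨hg.1.mul hh.1, image_mul_right_mul_eq hg.2 hh.2⟩
  have stab_inv : ∀ g : Sˣ, (g : S) ∈ Stab → ((g⁻¹ : Sˣ) : S) ∈ Stab := fun g hg =>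
    ⟨g⁻¹.isUnit, image_mul_right_units_inv_eq hg.2⟩
  have mul_mem_He : ∀ g ∈ Stab, e * g ∈ He := fun g hg => hg.2.subset ⟨e, e_mem, rfl⟩
  have absorb : ∀ g ∈ Stab, e * g * e = e * g := by
    intro g hg
    obtain ⟨-, -, -, v, hv⟩ := mul_mem_He g hg
    rw [← hv, mul_assoc, he]
  refine ⟨?_, ?_, ⟨1, stab_one, mul_one e⟩, ?_, ?_⟩
  · rintro _ ⟨g, hg, rfl⟩
    exact T.mul_mem heT (hUT g hg.1)
  · rintro _ ⟨g, hg, rfl⟩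
    exact mul_mem_He g hg
  · rintro _ ⟨g, hg, rfl⟩ _ ⟨h, hh, rfl⟩
    exact ⟨g * h, stab_mul g hg h hh, by rw [← mul_assoc (e * g), absorb g hg, mul_assoc]⟩
  · rintro _ ⟨_, hg, rfl⟩
    obtain ⟨g, rfl⟩ := hg.1
    refine ⟨e * (g⁻¹ : Sˣ), ⟨_, stab_inv g hg, rfl⟩, ?_, ?_⟩
    · rw [← mul_assoc, absorb _ hg, Units.mul_inv_cancel_right]
    · rw [← mul_assoc, absorb _ (stab_inv g hg), Units.inv_mul_cancel_right]
end

section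
/- Let n ≥ 2 and let T = Function.End (Fin n) be the monoid of all functions Fin n → Fin n under composition. A subsemigroup M of T is a maximal subsemigroup of T if and only if its underlying set is either (i) {f : Fin n → Fin n | ¬ Function.Bijective f} ∪ {⇑σ : σ ∈ U} for some maximal subgroup U of the symmetric group Equiv.Perm (Fin n), or (ii) {f : Fin n → Fin n | (Set.range f).ncard ≠ n − 1}. -/
namespace FullTransformationMonoid

open Function

variable {α : Type*}

section Generation

variable [DecidableEq α]

/-- The transformation that sends `a` to `b` and fixes every other point. -/
def collapse (a b : α) : α → α := update id a b

/-- A non-bijective transformation of a finite set factors through a collapse, with a left factor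
whose rank is larger by one. -/
theorem exists_eq_comp_collapse [Finite α] {g : α → α} (hg : ¬Bijective g) :
    ∃ (a b : α) (g' : α → α), a ≠ b ∧ g = g' ∘ collapse a b ∧
      (Set.range g').ncard = (Set.range g).ncard + 1 := by
  have hinj : ¬Injective g := fun h => hg (Finite.injective_iff_bijective.mp h)
  have hsurj : ¬Surjective g := fun h => hg (Finite.surjective_iff_bijective.mp h)
  obtain ⟨a, b, hgab, hab⟩ := not_injective_iff.mp hinj
  obtain ⟨c, hc⟩ := not_forall.mp hsurj
  refine ⟨a, b, update g a c, hab, ?_, ?_⟩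
  · funext x
    change g x = update g a c (update id a b x)
    rcases eq_or_ne x a with rfl | hx
    · simp [update_of_ne hab.symm, hgab]
    · simp [update_of_ne hx]
  · have hrange : Set.range (update g a c) = insert c (Set.range g) := by
      ext y
      constructor
      · rintro ⟨x, rfl⟩
        rcases eq_or_ne x a with rfl | hx
        · simp
        · simp [update_of_ne hx]
      · rintro (rfl | ⟨x, rfl⟩)
        · exact ⟨a, update_self ..⟩
        · rcases eq_or_ne x a with rfl | hx
          · exact ⟨b, by rw [update_of_ne hab.symm, hgab]⟩
          · exact ⟨x, update_of_ne hx ..⟩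
    exact (congrArg Set.ncard hrange).trans (Set.ncard_insert_of_notMem hc)

theorem exists_perm_map_pair {a b i j : α} (hab : a ≠ b) (hij : i ≠ j) :
    ∃ π : Equiv.Perm α, π a = i ∧ π b = j := by
  have h : i ≠ Equiv.swap a i b := fun h =>
    hab ((Equiv.swap a i).injective (by rw [Equiv.swap_apply_left, ← h]))
  refine ⟨Equiv.swap (Equiv.swap a i b) j * Equiv.swap a i, ?_, ?_⟩
  · simp [Equiv.swap_apply_of_ne_of_ne h hij]
  · simp

theorem collapse_conj (π : Equiv.Perm α) (a b : α) :
    collapse (π a) (π b) = π ∘ collapse a b ∘ ⇑π⁻¹ := by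
  funext x
  change update id (π a) (π b) x = π (update id a b (π⁻¹ x))
  rcases eq_or_ne x (π a) with rfl | hx
  · simp
  · have hx' : π⁻¹ x ≠ a := fun h => hx (by simp [← h])
    rw [update_of_ne hx, update_of_ne hx']
    simp

end Generation

theorem bijective_iff_ncard_range [Finite α] {f : α → α} :
    Bijective f ↔ (Set.range f).ncard = Nat.card α := by
  rw [← Finite.surjective_iff_bijective, ← Set.range_eq_univ, Set.eq_univ_iff_ncard]

theorem comp_mem {M : Subsemigroup (Function.End α)} {f g : α → α}
    (hf : (f : Function.End α) ∈ M) (hg : (g : Function.End α) ∈ M) :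
    (f ∘ g : Function.End α) ∈ M :=
  M.mul_mem hf hg

/-- The permutations together with one transformation of corank one generate all
transformations. -/
theorem eq_top_of_perm_mem_of_corank_one_mem [Finite α] {M : Subsemigroup (Function.End α)}
    (hperm : ∀ f : α → α, Bijective f → (f : Function.End α) ∈ M) {f : α → α}
    (hf : (f : Function.End α) ∈ M)
    (hrank : (Set.range f).ncard + 1 = Nat.card α) : M = ⊤ := by
  classical
  have hcollapse : ∀ i j : α, i ≠ j → (collapse i j : Function.End α) ∈ M := by
    have hfb : ¬Bijective f := by rw [bijective_iff_ncard_range]; omega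
    obtain ⟨a, b, g, hab, hfg, hg⟩ := exists_eq_comp_collapse hfb
    have hgb : Bijective g := by rw [bijective_iff_ncard_range]; omega
    have hmem : (collapse a b : Function.End α) ∈ M := by
      have heq : collapse a b = (Equiv.ofBijective g hgb).symm ∘ f := by
        rw [hfg]
        funext x
        exact ((Equiv.ofBijective g hgb).symm_apply_apply (collapse a b x)).symm
      rw [heq]
      exact comp_mem (hperm _ (Equiv.bijective _)) hf
    intro i j hij
    obtain ⟨π, rfl, rfl⟩ := exists_perm_map_pair hab hij
    rw [collapse_conj]
    exact comp_mem (hperm _ π.bijective) (comp_mem hmem (hperm _ (π⁻¹).bijective))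
  have hall : ∀ (k : ℕ) (g : α → α), (Set.range g).ncard + k = Nat.card α →
      (g : Function.End α) ∈ M := by
    intro k
    induction k with
    | zero => exact fun g hg => hperm g (bijective_iff_ncard_range.mpr hg)
    | succ k ih =>
      intro g hg
      have hgb : ¬Bijective g := by rw [bijective_iff_ncard_range]; omega
      obtain ⟨a, b, g', hab, rfl, hg'⟩ := exists_eq_comp_collapse hgb
      exact comp_mem (ih g' (by omega)) (hcollapse a b hab)
  refine (Subsemigroup.eq_top_iff' M).mpr fun g => hall (Nat.card α - (Set.range g).ncard) g ?_
  exact Nat.add_sub_cancel' (Set.ncard_le_card _)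

/-- The subsemigroup of all non-bijective transformations and the permutations in `U`. -/
def nonBijectiveSup [Finite α] (U : Subgroup (Equiv.Perm α)) :
    Subsemigroup (Function.End α) where
  carrier := {f | ¬Bijective f} ∪ {f | ∃ σ ∈ U, ⇑σ = f}
  mul_mem' := by
    intro f g hf hg
    by_cases h : Bijective (f * g)
    · have hfb : Bijective f := Finite.surjective_iff_bijective.mp h.surjective.of_comp
      have hgb : Bijective g := Finite.injective_iff_bijective.mp h.injective.of_comp
      obtain ⟨σ, hσ, rfl⟩ := hf.resolve_left (not_not_intro hfb)
      obtain ⟨τ, hτ, rfl⟩ := hg.resolve_left (not_not_intro hgb)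
      exact Or.inr ⟨σ * τ, U.mul_mem hσ hτ, rfl⟩
    · exact Or.inl h

theorem coe_mem_nonBijectiveSup [Finite α] {U : Subgroup (Equiv.Perm α)} {σ : Equiv.Perm α} :
    (⇑σ : Function.End α) ∈ nonBijectiveSup U ↔ σ ∈ U := by
  refine ⟨fun h => ?_, fun h => Or.inr ⟨σ, h, rfl⟩⟩
  obtain ⟨τ, hτ, h⟩ := h.resolve_left (not_not_intro σ.bijective)
  rwa [← DFunLike.coe_injective h]

/-- The subsemigroup of all transformations whose corank is not one. -/
def corankNeOne (α : Type*) [Finite α] : Subsemigroup (Function.End α) where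
  carrier := {f | (Set.range f).ncard ≠ Nat.card α - 1}
  mul_mem' := by
    intro (f : α → α) (g : α → α) (hf : (Set.range f).ncard ≠ _) (hg : (Set.range g).ncard ≠ _)
      (h : (Set.range (f ∘ g)).ncard = _)
    have hf_le : (Set.range f).ncard ≤ Nat.card α := Set.ncard_le_card _
    have hg_le : (Set.range g).ncard ≤ Nat.card α := Set.ncard_le_card _
    have hfg_le_f : (Set.range (f ∘ g)).ncard ≤ (Set.range f).ncard :=
      Set.ncard_le_ncard (Set.range_comp_subset_range g f)
    have hfg_le_g : (Set.range (f ∘ g)).ncard ≤ (Set.range g).ncard := by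
      rw [Set.range_comp]
      exact Set.ncard_image_le
    have hfb : Bijective f := bijective_iff_ncard_range.mpr (by omega)
    have hgb : Bijective g := bijective_iff_ncard_range.mpr (by omega)
    have := bijective_iff_ncard_range.mp (hfb.comp hgb)
    omega

theorem exists_corank_one [Finite α] [Nontrivial α] :
    ∃ f : α → α, (Set.range f).ncard + 1 = Nat.card α := by
  classical
  obtain ⟨a, b, hab⟩ := exists_pair_ne α
  refine ⟨collapse a b, ?_⟩
  have hrange : Set.range (collapse a b) = {a}ᶜ := by
    ext y
    constructor
    · rintro ⟨x, rfl⟩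
      rcases eq_or_ne x a with rfl | hx
      · simpa [collapse] using hab.symm
      · simpa [collapse, update_of_ne hx] using hx
    · exact fun hy => ⟨y, update_of_ne hy ..⟩
  rw [hrange, ← Set.ncard_singleton a, add_comm]
  exact Set.ncard_add_ncard_compl _

/-- The permutations in a subsemigroup containing at least one permutation form a subgroup. -/
theorem coe_mem_of_mem_closure [Finite α] {M : Subsemigroup (Function.End α)}
    {τ : Equiv.Perm α} (hτ : (⇑τ : Function.End α) ∈ M) {σ : Equiv.Perm α}
    (hσ : σ ∈ Subgroup.closure {π : Equiv.Perm α | (⇑π : Function.End α) ∈ M}) :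
    (⇑σ : Function.End α) ∈ M := by
  have hpow : ∀ k : ℕ, (⇑(τ ^ (k + 1)) : Function.End α) ∈ M := by
    intro k
    induction k with
    | zero => simpa using hτ
    | succ k ih => rw [pow_succ]; exact comp_mem (f := ⇑(τ ^ (k + 1))) (g := τ) ih hτ
  rw [← Subgroup.mem_toSubmonoid, Subgroup.closure_toSubmonoid_of_finite] at hσ
  induction hσ using Submonoid.closure_induction with
  | mem π hπ => exact hπ
  | one =>
    have h := hpow (orderOf τ - 1)
    rwa [Nat.sub_add_cancel (orderOf_pos τ), pow_orderOf_eq_one] at h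
  | mul π ρ _ _ hπ hρ => exact comp_mem (f := π) (g := ρ) hπ hρ

theorem isCoatom_corankNeOne [Finite α] [Nontrivial α] : IsCoatom (corankNeOne α) := by
  have hcard := Finite.one_lt_card (α := α)
  constructor
  · intro h
    obtain ⟨f, hf⟩ := exists_corank_one (α := α)
    have hmem : (f : Function.End α) ∈ corankNeOne α := by
      rw [h]
      exact Subsemigroup.mem_top (M := Function.End α) _
    exact hmem (by omega)
  · intro N hN
    obtain ⟨f, hfN, hf⟩ := SetLike.exists_of_lt hN
    have hf' : (Set.range f).ncard = Nat.card α - 1 := not_not.mp hf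
    refine eq_top_of_perm_mem_of_corank_one_mem (fun g hg => hN.le ?_) hfN (by omega)
    change (Set.range g).ncard ≠ _
    rw [bijective_iff_ncard_range.mp hg]
    omega

theorem isCoatom_nonBijectiveSup [Finite α] {U : Subgroup (Equiv.Perm α)} (hU : IsCoatom U) :
    IsCoatom (nonBijectiveSup U) := by
  constructor
  · intro h
    refine hU.1 ((Subgroup.eq_top_iff' U).mpr fun σ => coe_mem_nonBijectiveSup.mp ?_)
    rw [h]
    exact Subsemigroup.mem_top (M := Function.End α) _
  · intro N hN
    obtain ⟨f, hfN, hf⟩ := SetLike.exists_of_lt hN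
    have hfb : Bijective f := not_not.mp fun h => hf (Or.inl h)
    obtain ⟨σ, rfl⟩ : ∃ σ : Equiv.Perm α, ⇑σ = f := ⟨Equiv.ofBijective f hfb, rfl⟩
    have hle : U ≤ Subgroup.closure {π : Equiv.Perm α | (⇑π : Function.End α) ∈ N} :=
      fun π hπ => Subgroup.subset_closure (hN.le (coe_mem_nonBijectiveSup.mpr hπ))
    have htop := hU.2 _ (SetLike.lt_iff_le_and_exists.mpr
      ⟨hle, σ, Subgroup.subset_closure hfN, fun h => hf (coe_mem_nonBijectiveSup.mpr h)⟩)
    refine (Subsemigroup.eq_top_iff' N).mpr fun g => ?_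
    by_cases hg : Bijective g
    · exact coe_mem_of_mem_closure hfN (σ := Equiv.ofBijective g hg)
        (htop ▸ Subgroup.mem_top _)
    · exact hN.le (Or.inl hg)

theorem isCoatom_iff [Finite α] [Nontrivial α] {M : Subsemigroup (Function.End α)} :
    IsCoatom M ↔
      (∃ U : Subgroup (Equiv.Perm α), IsCoatom U ∧ M = nonBijectiveSup U) ∨
        M = corankNeOne α := by
  constructor
  · intro hM
    by_cases hperm : ∀ σ : Equiv.Perm α, (⇑σ : Function.End α) ∈ M
    · right
      refine ((hM.le_iff_eq isCoatom_corankNeOne.1).mp fun f hf hrank => hM.1 ?_).symm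
      have hcard := Finite.one_lt_card (α := α)
      exact eq_top_of_perm_mem_of_corank_one_mem
        (fun g hg => hperm (Equiv.ofBijective g hg)) hf (by omega)
    · left
      let S : Set (Equiv.Perm α) := {π | (⇑π : Function.End α) ∈ M}
      have hS : Subgroup.closure S ≠ ⊤ := by
        intro h
        rcases S.eq_empty_or_nonempty with hS | ⟨τ, hτ⟩
        · rw [hS, Subgroup.closure_empty] at h
          exact bot_ne_top h
        · exact hperm fun σ => coe_mem_of_mem_closure hτ (h ▸ Subgroup.mem_top σ)
      obtain ⟨U, hU, hSU⟩ := (eq_top_or_exists_le_coatom (Subgroup.closure S)).resolve_left hS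
      refine ⟨U, hU, ((hM.le_iff_eq (isCoatom_nonBijectiveSup hU).1).mp fun f hf => ?_).symm⟩
      by_cases hfb : Bijective f
      · exact Or.inr ⟨Equiv.ofBijective f hfb, hSU (Subgroup.subset_closure hf), rfl⟩
      · exact Or.inl hfb
  · rintro (⟨U, hU, rfl⟩ | rfl)
    · exact isCoatom_nonBijectiveSup hU
    · exact isCoatom_corankNeOne

end FullTransformationMonoid

theorem maximal_subsemigroups_of_full_transformation_monoid
    (n : ℕ) (hn : 2 ≤ n) (M : Subsemigroup (Function.End (Fin n))) :
    IsCoatom M ↔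
      ((∃ U : Subgroup (Equiv.Perm (Fin n)), IsCoatom U ∧
          (M : Set (Function.End (Fin n))) =
            {f | ¬Function.Bijective f} ∪ {f | ∃ σ ∈ U, ⇑σ = f}) ∨
        (M : Set (Function.End (Fin n))) =
          {f | (Set.range f).ncard ≠ n - 1}) := by
  have : Nontrivial (Fin n) := Fin.nontrivial_iff_two_le.mpr hn
  have hcorank : (FullTransformationMonoid.corankNeOne (Fin n) : Set (Function.End (Fin n))) =
      {f | (Set.range f).ncard ≠ n - 1} := by
    ext f
    change (Set.range f).ncard ≠ Nat.card (Fin n) - 1 ↔ (Set.range f).ncard ≠ n - 1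
    rw [Nat.card_fin]
  rw [FullTransformationMonoid.isCoatom_iff, ← hcorank, SetLike.coe_set_eq]
  simp only [SetLike.ext'_iff]
  rfl
end

section
/- For n ≥ 2, the number of maximal subsemigroups of the full transformation monoid Function.End (Fin n) equals one more than the number of maximal subgroups of the symmetric group: Set.ncard {M : Subsemigroup (Function.End (Fin n)) | IsCoatom M} = Set.ncard {U : Subgroup (Equiv.Perm (Fin n)) | IsCoatom U} + 1. -/
namespace FullTransformation

open Equiv Function

variable {α : Type*}

/-- Permutations regarded as elements of the full transformation monoid. -/
def permToEnd : Perm α →* Function.End α where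
  toFun σ := ⇑σ
  map_one' := rfl
  map_mul' _ _ := rfl

lemma permToEnd_injective : Injective (permToEnd (α := α)) :=
  fun _ _ h => Equiv.coe_fn_injective h

lemma exists_permToEnd_eq {f : Function.End α} (hf : Bijective f) : ∃ σ, permToEnd σ = f :=
  ⟨Equiv.ofBijective f hf, rfl⟩

lemma permToEnd_bijective (σ : Perm α) : Bijective (permToEnd σ) := σ.bijective

/-- The transformation sending `c` to `d` and fixing every other point. -/
def collapse [DecidableEq α] (c d : α) : α → α := Function.update id c d

lemma collapse_apply [DecidableEq α] (c d x : α) :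
    collapse c d x = if x = c then d else x := by
  simp [collapse, Function.update_apply]

lemma eq_collapse_comp_update [DecidableEq α] {f : α → α} {a b c : α}
    (hfab : f a = f b) (hc : ∀ x, f x ≠ c) :
    f = collapse c (f a) ∘ Function.update f b c := by
  funext x
  rw [comp_apply]
  by_cases hx : x = b
  · simp [collapse_apply, hx, hfab]
  · simp [collapse_apply, hx, hc x]

lemma collapse_eq_conj [DecidableEq α] (σ : Perm α) (c d : α) :
    collapse (σ c) (σ d) = σ ∘ collapse c d ∘ σ.symm := by
  funext x
  simp only [comp_apply]
  by_cases hx : x = σ c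
  · simp [collapse_apply, hx]
  · simp [collapse_apply, hx, Equiv.symm_apply_eq]

lemma exists_perm_apply_eq_apply_eq [DecidableEq α] {a b c d : α} (hab : a ≠ b) (hcd : c ≠ d) :
    ∃ σ : Perm α, σ a = c ∧ σ b = d := by
  have h : swap a c b ≠ c := by
    exact fun h => hab ((swap a c).injective (h.trans (swap_apply_left a c).symm)).symm
  exact ⟨(swap a c).trans (swap (swap a c b) d),
    by simp [swap_apply_of_ne_of_ne h.symm hcd], by simp⟩

/-- A transformation that is not bijective identifies two points and misses a point. -/
lemma exists_collision_and_omission [Finite α] {f : α → α} (hf : ¬ Bijective f) :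
    ∃ a b c, a ≠ b ∧ f a = f b ∧ ∀ x, f x ≠ c := by
  have hinj : ¬ Injective f := fun h => hf (Finite.injective_iff_bijective.1 h)
  have hsurj : ¬ Surjective f := fun h => hf (Finite.surjective_iff_bijective.1 h)
  obtain ⟨a, b, hfab, hab⟩ := not_injective_iff.1 hinj
  simp only [Surjective, not_forall, not_exists] at hsurj
  obtain ⟨c, hc⟩ := hsurj
  exact ⟨a, b, c, hab, hfab, hc⟩

section Rank

variable [Fintype α] [DecidableEq α]

/-- The number of points in the image of a transformation. -/
def rank (f : α → α) : ℕ := (Finset.univ.image f).card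

lemma rank_comp_le_left (f g : α → α) : rank (f ∘ g) ≤ rank f := by
  refine Finset.card_le_card fun y hy => ?_
  obtain ⟨x, -, rfl⟩ := Finset.mem_image.1 hy
  exact Finset.mem_image_of_mem _ (Finset.mem_univ (g x))

lemma rank_comp_le_right (f g : α → α) : rank (f ∘ g) ≤ rank g := by
  have : Finset.univ.image (f ∘ g) = (Finset.univ.image g).image f := by
    rw [Finset.image_image]
  rw [rank, this]
  exact Finset.card_image_le

lemma rank_le_card (f : α → α) : rank f ≤ Fintype.card α := Finset.card_le_univ _

lemma rank_eq_card_iff {f : α → α} : rank f = Fintype.card α ↔ Bijective f := by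
  rw [← Finite.injective_iff_bijective, ← Finset.card_univ, rank, Finset.card_image_iff]
  simp

lemma rank_update {f : α → α} {a b c : α} (hab : a ≠ b) (hfab : f a = f b)
    (hc : ∀ x, f x ≠ c) : rank (Function.update f b c) = rank f + 1 := by
  have himage : Finset.univ.image (Function.update f b c) = insert c (Finset.univ.image f) := by
    ext y
    simp only [Finset.mem_image, Finset.mem_univ, true_and, Finset.mem_insert]
    constructor
    · rintro ⟨x, rfl⟩
      by_cases hx : x = b
      · simp [hx]
      · exact Or.inr ⟨x, by simp [hx]⟩
    · rintro (rfl | ⟨x, rfl⟩)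
      · exact ⟨b, by simp⟩
      · by_cases hx : x = b
        · exact ⟨a, by simp [hab, hx, hfab]⟩
        · exact ⟨x, by simp [hx]⟩
  rw [rank, himage, Finset.card_insert_of_notMem (by simpa using hc)]
  rfl

lemma rank_collapse_add_one {c d : α} (hcd : c ≠ d) :
    rank (collapse c d) + 1 = Fintype.card α := by
  rw [← rank_update (a := d) (b := c) (c := c) hcd.symm (by simp [collapse_apply])
    (fun x => by rw [collapse_apply]; split_ifs <;> simp_all [eq_comm])]
  have : Function.update (collapse c d) c c = id := by simp [collapse]
  rw [this]
  exact rank_eq_card_iff.2 bijective_id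

lemma eq_top_of_collapse_mem {K : Subsemigroup (Function.End α)}
    (hperm : ∀ σ, permToEnd σ ∈ K) (hcollapse : ∀ c d, c ≠ d → (collapse c d : Function.End α) ∈ K) : K = ⊤ := by
  have key : ∀ k (f : α → α), rank f + k = Fintype.card α → (f : Function.End α) ∈ K := by
    intro k
    induction k with
    | zero =>
      intro f hf
      obtain ⟨σ, rfl⟩ := exists_permToEnd_eq (rank_eq_card_iff.1 hf)
      exact hperm σ
    | succ k ih =>
      intro f hf
      obtain ⟨a, b, c, hab, hfab, hc⟩ :=
        exists_collision_and_omission (f := f) (fun h => by have := rank_eq_card_iff.2 h; omega)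
      have hrank := rank_update hab hfab hc
      have hmem := K.mul_mem (hcollapse _ _ (hc a).symm)
        (ih (Function.update f b c) (by omega))
      exact (eq_collapse_comp_update hfab hc).symm ▸ hmem
  exact eq_top_iff.2 fun f _ =>
    key (Fintype.card α - rank f) f (Nat.add_sub_cancel' (rank_le_card f))

/-- The symmetric group together with one map of corank one generates all transformations. -/
lemma eq_top_of_corank_one_mem {K : Subsemigroup (Function.End α)}
    (hperm : ∀ σ, permToEnd σ ∈ K) {g : Function.End α} (hg : g ∈ K)
    (hrank : rank g + 1 = Fintype.card α) : K = ⊤ := by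
  obtain ⟨a, b, c, hab, hgab, hc⟩ :=
    exists_collision_and_omission (f := g) (fun h => by have := rank_eq_card_iff.2 h; omega)
  obtain ⟨τ, hτ⟩ := exists_permToEnd_eq (f := Function.update g b c)
    (rank_eq_card_iff.1 ((rank_update hab hgab hc).trans hrank))
  have hmul : g * permToEnd τ⁻¹ = collapse c (g a) := by
    funext x
    have hx : Function.update g b c (τ.symm x) = x :=
      (congrFun hτ (τ.symm x)).symm.trans (τ.apply_symm_apply x)
    have h := congrFun (eq_collapse_comp_update hgab hc) (τ.symm x)
    rw [comp_apply, hx] at h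
    exact h
  have hmem : (collapse c (g a) : Function.End α) ∈ K := hmul ▸ K.mul_mem hg (hperm _)
  refine eq_top_of_collapse_mem hperm fun c' d' hne => ?_
  obtain ⟨σ, rfl, rfl⟩ := exists_perm_apply_eq_apply_eq (hc a).symm hne
  exact (collapse_eq_conj σ c (g a)).symm ▸
    K.mul_mem (hperm σ) (K.mul_mem hmem (hperm σ⁻¹))

variable (α) in
/-- The transformations whose rank is not `|α| - 1`. -/
def withoutCorankOne : Subsemigroup (Function.End α) where
  carrier := {f | rank f + 1 ≠ Fintype.card α}
  mul_mem' {f g} hf hg h := by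
    change rank f + 1 ≠ _ at hf
    change rank g + 1 ≠ _ at hg
    change rank (f * g) + 1 = _ at h
    have hfc := rank_le_card f
    have hgc := rank_le_card g
    have hl : rank (f * g) ≤ rank f := rank_comp_le_left f g
    have hr : rank (f * g) ≤ rank g := rank_comp_le_right f g
    have hbij : Bijective (f * g) :=
      (rank_eq_card_iff.1 (by omega : rank f = _)).comp
        (rank_eq_card_iff.1 (by omega : rank g = _))
    have := rank_eq_card_iff.2 hbij
    omega

lemma mem_withoutCorankOne {f : Function.End α} :
    f ∈ withoutCorankOne α ↔ rank f + 1 ≠ Fintype.card α := Iff.rfl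

lemma permToEnd_mem_withoutCorankOne (σ : Perm α) : permToEnd σ ∈ withoutCorankOne α := by
  rw [mem_withoutCorankOne, rank_eq_card_iff.2 (permToEnd_bijective σ)]
  omega

lemma withoutCorankOne_ne_top [Nontrivial α] : withoutCorankOne α ≠ ⊤ := by
  obtain ⟨c, d, hcd⟩ := exists_pair_ne α
  intro h
  have : (collapse c d : Function.End α) ∈ withoutCorankOne α := h.ge trivial
  exact this (rank_collapse_add_one hcd)

lemma isCoatom_withoutCorankOne [Nontrivial α] : IsCoatom (withoutCorankOne α) := by
  refine ⟨withoutCorankOne_ne_top, fun K hK => ?_⟩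
  obtain ⟨f, hfK, hf⟩ := SetLike.exists_of_lt hK
  exact eq_top_of_corank_one_mem (fun σ => hK.le (permToEnd_mem_withoutCorankOne σ)) hfK
    (not_not.1 hf)

end Rank

section Finite

variable [Finite α]

/-- The singular transformations together with the permutations in a subgroup `U`. -/
def singularWith (U : Subgroup (Perm α)) : Subsemigroup (Function.End α) where
  carrier := {f | ∀ σ, permToEnd σ = f → σ ∈ U}
  mul_mem' {f g} hf hg σ hσ := by
    have hbij : Bijective (f ∘ g) := by
      have := permToEnd_bijective σ
      rwa [hσ] at this
    obtain ⟨τ, rfl⟩ := exists_permToEnd_eq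
      (Finite.surjective_iff_bijective.1 (Surjective.of_comp hbij.surjective))
    obtain ⟨ρ, rfl⟩ := exists_permToEnd_eq
      (Finite.injective_iff_bijective.1 (Injective.of_comp hbij.injective))
    rw [← map_mul] at hσ
    rw [permToEnd_injective hσ]
    exact U.mul_mem (hf τ rfl) (hg ρ rfl)

lemma permToEnd_mem_singularWith {U : Subgroup (Perm α)} {σ : Perm α} :
    permToEnd σ ∈ singularWith U ↔ σ ∈ U :=
  ⟨fun h => h σ rfl, fun h _ hτ => permToEnd_injective hτ ▸ h⟩

lemma singularWith_le_iff {U V : Subgroup (Perm α)} :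
    singularWith U ≤ singularWith V ↔ U ≤ V :=
  ⟨fun h _ hσ => permToEnd_mem_singularWith.1 (h (permToEnd_mem_singularWith.2 hσ)),
    fun h _ hf σ hσ => h (hf σ hσ)⟩

lemma singularWith_injective : Injective (singularWith (α := α)) := fun _ _ h =>
  le_antisymm (singularWith_le_iff.1 h.le) (singularWith_le_iff.1 h.ge)

lemma singularWith_eq_top_iff {U : Subgroup (Perm α)} : singularWith U = ⊤ ↔ U = ⊤ := by
  refine ⟨fun h => eq_top_iff.2 fun σ _ => ?_, fun h => eq_top_iff.2 fun f _ σ _ => ?_⟩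
  · exact permToEnd_mem_singularWith.1 (h ▸ Subsemigroup.mem_top _)
  · exact h ▸ Subgroup.mem_top σ

/-- The identity together with the permutations lying in a subsemigroup of transformations. -/
def permPart (K : Subsemigroup (Function.End α)) : Subgroup (Perm α) :=
  let S : Submonoid (Perm α) :=
    { carrier := {σ | σ = 1 ∨ permToEnd σ ∈ K}
      one_mem' := Or.inl rfl
      mul_mem' := by
        rintro σ τ (rfl | hσ) (rfl | hτ)
        · exact Or.inl rfl
        · exact Or.inr (by simpa using hτ)
        · exact Or.inr (by simpa using hσ)
        · exact Or.inr (by rw [map_mul]; exact K.mul_mem hσ hτ) }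
  { S with
    inv_mem' := fun {σ} hσ => by
      have : σ⁻¹ = σ ^ (orderOf σ - 1) := by
        rw [inv_eq_iff_mul_eq_one, ← pow_succ', Nat.sub_add_cancel (orderOf_pos σ),
          pow_orderOf_eq_one]
      rw [this]
      exact S.pow_mem hσ _ }

lemma mem_permPart {K : Subsemigroup (Function.End α)} {σ : Perm α} :
    σ ∈ permPart K ↔ σ = 1 ∨ permToEnd σ ∈ K := Iff.rfl

lemma le_singularWith_permPart (K : Subsemigroup (Function.End α)) :
    K ≤ singularWith (permPart K) := by
  rintro _ hf σ rfl
  exact Or.inr hf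

lemma permToEnd_mem_of_permPart_eq_top [Nontrivial α] {K : Subsemigroup (Function.End α)}
    (hK : permPart K = ⊤) (σ : Perm α) : permToEnd σ ∈ K := by
  classical
  have hne : ∀ τ : Perm α, τ ≠ 1 → permToEnd τ ∈ K := fun τ hτ =>
    (mem_permPart.1 (hK ▸ Subgroup.mem_top τ : τ ∈ permPart K)).resolve_left hτ
  by_cases hσ : σ = 1
  · obtain ⟨a, b, hab⟩ := exists_pair_ne α
    have hswap := hne (swap a b) (by simpa [swap_eq_one_iff] using hab)
    rw [hσ, ← swap_mul_self a b, map_mul]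
    exact K.mul_mem hswap hswap
  · exact hne σ hσ

lemma isCoatom_singularWith_iff [Nontrivial α] {U : Subgroup (Perm α)} :
    IsCoatom (singularWith U) ↔ IsCoatom U := by
  constructor
  · rintro ⟨hne, hmax⟩
    refine ⟨fun h => hne (singularWith_eq_top_iff.2 h), fun V hV => ?_⟩
    refine singularWith_eq_top_iff.1 (hmax _ ?_)
    simpa [lt_iff_le_not_ge, singularWith_le_iff] using hV
  · rintro ⟨hne, hmax⟩
    refine ⟨fun h => hne (singularWith_eq_top_iff.1 h), fun K hK => ?_⟩
    have hlt : U < permPart K := by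
      have := hK.trans_le (le_singularWith_permPart K)
      simpa [lt_iff_le_not_ge, singularWith_le_iff] using this
    have hperm := permToEnd_mem_of_permPart_eq_top (hmax _ hlt)
    refine eq_top_iff.2 fun f _ => ?_
    by_cases hf : Bijective f
    · obtain ⟨σ, rfl⟩ := exists_permToEnd_eq hf
      exact hperm σ
    · exact hK.le fun σ hσ => absurd (hσ ▸ permToEnd_bijective σ) hf

end Finite

section Classification

variable [Fintype α] [DecidableEq α] [Nontrivial α]

lemma eq_withoutCorankOne_or_eq_singularWith {M : Subsemigroup (Function.End α)}
    (hM : IsCoatom M) :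
    M = withoutCorankOne α ∨ ∃ U : Subgroup (Perm α), IsCoatom U ∧ singularWith U = M := by
  by_cases hU : permPart M = ⊤
  · left
    have hperm := permToEnd_mem_of_permPart_eq_top hU
    have hle : M ≤ withoutCorankOne α := fun f hf hrank =>
      hM.1 (eq_top_of_corank_one_mem hperm hf hrank)
    exact ((hM.le_iff_eq withoutCorankOne_ne_top).1 hle).symm
  · right
    have heq : singularWith (permPart M) = M :=
      (hM.le_iff_eq (mt singularWith_eq_top_iff.1 hU)).1 (le_singularWith_permPart M)
    exact ⟨permPart M, isCoatom_singularWith_iff.1 (heq.symm ▸ hM), heq⟩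

variable (α) in
lemma setOf_isCoatom_eq_insert :
    {M : Subsemigroup (Function.End α) | IsCoatom M} =
      insert (withoutCorankOne α) (singularWith '' {U : Subgroup (Perm α) | IsCoatom U}) := by
  ext M
  constructor
  · exact eq_withoutCorankOne_or_eq_singularWith
  · rintro (rfl | ⟨U, hU, rfl⟩)
    · exact isCoatom_withoutCorankOne
    · exact isCoatom_singularWith_iff.2 hU

variable (α) in
lemma ncard_setOf_isCoatom :
    Set.ncard {M : Subsemigroup (Function.End α) | IsCoatom M} =
      Set.ncard {U : Subgroup (Perm α) | IsCoatom U} + 1 := by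
  have hnotMem :
      withoutCorankOne α ∉ singularWith '' {U : Subgroup (Perm α) | IsCoatom U} := by
    rintro ⟨U, hU, h⟩
    exact hU.1 (eq_top_iff.2 fun σ _ =>
      permToEnd_mem_singularWith.1 (h ▸ permToEnd_mem_withoutCorankOne σ))
  rw [setOf_isCoatom_eq_insert, Set.ncard_insert_of_notMem hnotMem (Set.toFinite _),
    Set.ncard_image_of_injective _ singularWith_injective]

end Classification

end FullTransformation

theorem count_maximal_subsemigroups_of_full_transformation_monoid
    (n : ℕ) (hn : 2 ≤ n) :
    Set.ncard {M : Subsemigroup (Function.End (Fin n)) | IsCoatom M} =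
      Set.ncard {U : Subgroup (Equiv.Perm (Fin n)) | IsCoatom U} + 1 := by
  have : Nontrivial (Fin n) := Fin.nontrivial_iff_two_le.2 hn
  exact FullTransformation.ncard_setOf_isCoatom (Fin n)
end

section
/- Let n ≥ 2 and let O be the monoid (under composition) of all monotone functions f : Fin n → Fin n; write the elements of Fin n as 1,…,n in increasing order, and for f ∈ O let rank f = (Set.range f).ncard. Identify the path graph of order 2n−1 with the graph on {1,…,2n−1} in which two vertices are adjacent exactly when they are consecutive. Then a subsemigroup M of O is a maximal subsemigroup of O if and only if its underlying set is one of the following: (a) O \ {id}; (b) {f ∈ O : rank f ≠ n−1} ∪ {f ∈ O : rank f = n−1, and either the unique point missing from the range of f equals (v+1)/2 for some odd v ∈ A, or the unique point i with f(i) = f(i+1) equals v/2 for some even v ∈ A}, where A is a maximal independent subset of the path graph of order 2n−1 that contains both an odd number and an even number; (c) O \ {f ∈ O : rank f = n−1 and the range of f is {1,…,n} \ {i}}, for some i ∈ {1,…,n}; (d) O \ {f ∈ O : rank f = n−1 and f(i) = f(i+1)}, for some i with 2 ≤ i ≤ n−2. -/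
/-- The monoid of order-preserving transformations of `Fin n`,
as a submonoid of `Function.End (Fin n)` (composition). -/
def OrderMon (n : ℕ) : Submonoid (Function.End (Fin n)) where
  carrier := {f | Monotone f}
  one_mem' := monotone_id
  mul_mem' := fun hf hg => hf.comp hg

namespace OrderMon

variable {k : ℕ}

/-- The order-preserving map of rank `k + 1` that identifies `i` with `i + 1` and misses `m`. -/
def corank (i : Fin (k + 1)) (m : Fin (k + 2)) : OrderMon (k + 2) :=
  ⟨fun x => m.succAbove (i.predAbove x),
    (Fin.strictMono_succAbove m).monotone.comp (Fin.predAbove_right_monotone i)⟩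

/-- Adjacency of the kernel vertex `i` and the image vertex `m` in the path graph. -/
def Near (i : Fin (k + 1)) (m : Fin (k + 2)) : Prop :=
  m = i.castSucc ∨ m = i.succ

theorem corank_apply (i : Fin (k + 1)) (m x : Fin (k + 2)) :
    (corank i m).1 x = m.succAbove (i.predAbove x) := rfl

theorem mul_apply (f g : OrderMon (k + 2)) (x : Fin (k + 2)) :
    (f * g).1 x = f.1 (g.1 x) := rfl

theorem predAbove_surjective (i : Fin (k + 1)) : Function.Surjective i.predAbove := fun y =>
  ⟨i.castSucc.succAbove y, by simp⟩

theorem predAbove_succ_succAbove (i y : Fin (k + 1)) :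
    i.predAbove (i.succ.succAbove y) = y := by
  apply Fin.succAbove_right_injective (p := i.succ)
  exact Fin.succ_succAbove_predAbove (Fin.succAbove_ne _ _)

theorem range_corank (i : Fin (k + 1)) (m : Fin (k + 2)) :
    Set.range (corank i m).1 = {m}ᶜ := by
  rw [← Fin.range_succAbove m]
  exact (predAbove_surjective i).range_comp m.succAbove

theorem predAbove_eq_iff (i : Fin (k + 1)) {x y : Fin (k + 2)} (h : x < y) :
    i.predAbove x = i.predAbove y ↔ x = i.castSucc ∧ y = i.succ := by
  have hval : ∀ z : Fin (k + 2), (i.predAbove z).1 = if i.1 < z.1 then z.1 - 1 else z.1 := by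
    intro z
    split_ifs with hz
    · rw [Fin.predAbove_of_castSucc_lt i z (Fin.lt_def.2 hz), Fin.val_pred]
    · rw [Fin.predAbove_of_le_castSucc i z (Fin.le_def.2 (not_lt.1 hz)), Fin.coe_castPred]
  rw [Fin.ext_iff, Fin.ext_iff, Fin.ext_iff, hval, hval, Fin.val_castSucc, Fin.val_succ]
  rw [Fin.lt_def] at h
  split_ifs <;> omega

theorem corank_eq_iff (i : Fin (k + 1)) (m : Fin (k + 2)) {x y : Fin (k + 2)} (h : x < y) :
    (corank i m).1 x = (corank i m).1 y ↔ x = i.castSucc ∧ y = i.succ := by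
  rw [corank_apply, corank_apply, Fin.succAbove_right_inj, predAbove_eq_iff i h]

theorem corank_eq_succ_iff (i j : Fin (k + 1)) (m : Fin (k + 2)) :
    (corank i m).1 j.castSucc = (corank i m).1 j.succ ↔ j = i := by
  rw [corank_eq_iff i m (Fin.castSucc_lt_succ)]
  simp

theorem corank_inj {i i' : Fin (k + 1)} {m m' : Fin (k + 2)} :
    corank i m = corank i' m' ↔ i = i' ∧ m = m' := by
  refine ⟨fun h => ⟨?_, ?_⟩, fun h => by rw [h.1, h.2]⟩
  · rw [← corank_eq_succ_iff i' i m', ← h, corank_eq_succ_iff]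
  · have := congrArg (fun f : OrderMon (k + 2) => Set.range f.1) h
    simpa [range_corank] using this

theorem corank_mul_corank {i i' : Fin (k + 1)} {m m' : Fin (k + 2)} (h : Near i' m) :
    corank i' m' * corank i m = corank i m' := by
  refine Subtype.ext (funext fun x => ?_)
  rw [mul_apply, corank_apply, corank_apply, corank_apply]
  rcases h with rfl | rfl <;> simp [predAbove_succ_succAbove]

theorem eq_of_corank_mul_corank_eq {i i' i'' : Fin (k + 1)} {m m' m'' : Fin (k + 2)}
    (h : corank i' m' * corank i m = corank i'' m'') : Near i' m ∧ i'' = i ∧ m'' = m' := by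
  have hi : i'' = i := by
    symm
    rw [← corank_eq_succ_iff i'' i m'', ← h, mul_apply, mul_apply,
      (corank_eq_succ_iff i i m).2 rfl]
  have hN : Near i' m := by
    by_contra hN
    rw [Near, not_or] at hN
    have hx : i'.castSucc ∈ Set.range (corank i m).1 := by
      rw [range_corank]; exact fun h => hN.1 h.symm
    have hy : i'.succ ∈ Set.range (corank i m).1 := by
      rw [range_corank]; exact fun h => hN.2 h.symm
    obtain ⟨x, hx⟩ := hx
    obtain ⟨y, hy⟩ := hy
    have hlt : x < y := by
      refine (corank i m).2.reflect_lt ?_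
      rw [hx, hy]; exact Fin.castSucc_lt_succ
    have heq : (corank i'' m'').1 x = (corank i'' m'').1 y := by
      rw [← h, mul_apply, mul_apply, hx, hy, corank_eq_succ_iff]
    rw [corank_eq_iff _ _ hlt, hi, ← corank_eq_iff i m hlt, hx, hy] at heq
    exact Fin.castSucc_lt_succ.ne heq
  refine ⟨hN, hi, ?_⟩
  rw [corank_mul_corank hN, corank_inj] at h
  exact h.2.symm

/-- The rank of an order-preserving transformation. -/
noncomputable def rank (f : OrderMon (k + 2)) : ℕ := (Set.range f.1).ncard

theorem rank_le (f : OrderMon (k + 2)) : rank f ≤ k + 2 := by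
  simpa [rank] using Set.ncard_le_ncard (Set.subset_univ (Set.range f.1))

theorem rank_one : rank (1 : OrderMon (k + 2)) = k + 2 := by
  have : Set.range (1 : OrderMon (k + 2)).1 = Set.univ := Set.range_id
  rw [rank, this]
  simp

theorem rank_corank (i : Fin (k + 1)) (m : Fin (k + 2)) : rank (corank i m) = k + 1 := by
  rw [rank, range_corank, Set.ncard_compl]
  simp

theorem rank_mul_le_left (f g : OrderMon (k + 2)) : rank (f * g) ≤ rank f :=
  Set.ncard_le_ncard (Set.range_comp_subset_range g.1 f.1)

theorem rank_mul_le_right (f g : OrderMon (k + 2)) : rank (f * g) ≤ rank g := by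
  have : Set.range (f * g).1 = f.1 '' Set.range g.1 := Set.range_comp f.1 g.1
  rw [rank, this]
  exact Set.ncard_image_le

theorem eq_one_of_rank_eq {f : OrderMon (k + 2)} (h : rank f = k + 2) : f = 1 := by
  have hs : Set.range f.1 = Set.univ := by
    apply Set.eq_of_subset_of_ncard_le (Set.subset_univ _)
    simpa [rank] using h.ge
  have hinj : Function.Injective f.1 :=
    Finite.injective_iff_surjective.2 (Set.range_eq_univ.1 hs)
  have hmono : StrictMono f.1 := f.2.strictMono_of_injective hinj
  refine Subtype.ext (funext fun x => ?_)
  exact congrFun (hmono.range_inj strictMono_id |>.1 (by rw [hs, Set.range_id])) x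

/-- A monotone sequence can be extended by a new value at a suitable new position. -/
theorem exists_monotone_extension {g : Fin (k + 1) → Fin (k + 2)} (hg : Monotone g)
    {p : Fin (k + 2)} (hp : p ∉ Set.range g) :
    ∃ (m : Fin (k + 2)) (f : Fin (k + 2) → Fin (k + 2)),
      Monotone f ∧ f m = p ∧ ∀ y, f (m.succAbove y) = g y := by
  have hex : ∃ a : ℕ, ∀ y, g y < p → y.1 < a := ⟨k + 1, fun y _ => y.2⟩
  classical
  have hle : Nat.find hex ≤ k + 1 := Nat.find_min' hex fun y _ => y.2
  have hm : ∀ y, g y < p ↔ y.1 < Nat.find hex := by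
    refine fun y => ⟨Nat.find_spec hex y, fun hy => ?_⟩
    have := Nat.find_min hex hy
    push Not at this
    obtain ⟨z, hz, hyz⟩ := this
    exact (hg (Fin.le_def.2 hyz)).trans_lt hz
  have hm' : ∀ y, Nat.find hex ≤ y.1 → p < g y := fun y hy =>
    lt_of_le_of_ne (not_lt.1 fun h => by have := (hm y).1 h; omega) fun h => hp ⟨y, h.symm⟩
  generalize Nat.find hex = a at hle hm hm'
  set m : Fin (k + 2) := ⟨a, by omega⟩ with hmdef
  refine ⟨m, m.insertNth p g, ?_, Fin.insertNth_apply_same ..,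
    fun y => Fin.insertNth_apply_succAbove ..⟩
  intro x y hxy
  induction x using Fin.succAboveCases m with
  | x =>
    induction y using Fin.succAboveCases m with
    | x => exact le_rfl
    | p y =>
      rw [Fin.insertNth_apply_same, Fin.insertNth_apply_succAbove]
      refine (hm' y ?_).le
      by_contra hlt
      rw [Fin.succAbove_of_castSucc_lt _ _ (by simpa [hmdef, Fin.lt_def] using hlt)] at hxy
      simp [hmdef, Fin.le_def] at hxy
      omega
  | p x =>
    induction y using Fin.succAboveCases m with
    | x =>
      rw [Fin.insertNth_apply_same, Fin.insertNth_apply_succAbove]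
      refine ((hm x).2 ?_).le
      by_contra hlt
      rw [Fin.succAbove_of_le_castSucc _ _ (by simpa [hmdef, Fin.le_def] using hlt)] at hxy
      simp [hmdef, Fin.le_def] at hxy
      omega
    | p y =>
      rw [Fin.insertNth_apply_succAbove, Fin.insertNth_apply_succAbove]
      exact hg ((Fin.strictMono_succAbove m).le_iff_le.1 hxy)

theorem exists_eq_mul_corank {f : OrderMon (k + 2)} (h : rank f < k + 2) :
    ∃ (f' : OrderMon (k + 2)) (i : Fin (k + 1)) (m : Fin (k + 2)),
      f = f' * corank i m ∧ rank f' = rank f + 1 := by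
  obtain ⟨i, hi⟩ : ∃ i : Fin (k + 1), f.1 i.castSucc = f.1 i.succ := by
    by_contra! hne
    have hmono : StrictMono f.1 := Fin.strictMono_iff_lt_succ.2 fun i =>
      (f.2 Fin.castSucc_lt_succ.le).lt_of_ne (hne i)
    have := Set.ncard_range_of_injective hmono.injective
    rw [rank, this] at h
    simp at h
  obtain ⟨p, hp⟩ : ∃ p, p ∉ Set.range f.1 := by
    by_contra! hall
    rw [rank, Set.eq_univ_of_forall hall] at h
    simp at h
  have hfac : ∀ x, f.1 (i.succ.succAbove (i.predAbove x)) = f.1 x := by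
    intro x
    by_cases hx : x = i.succ
    · subst hx
      simp [hi]
    · rw [Fin.succ_succAbove_predAbove hx]
  have hrange : Set.range (fun y => f.1 (i.succ.succAbove y)) = Set.range f.1 := by
    ext z
    constructor
    · rintro ⟨y, rfl⟩; exact ⟨_, rfl⟩
    · rintro ⟨x, rfl⟩; exact ⟨_, hfac x⟩
  obtain ⟨m, f', hmono, hfm, hf'⟩ := exists_monotone_extension (k := k)
    (g := fun y => f.1 (i.succ.succAbove y))
    (f.2.comp (Fin.strictMono_succAbove i.succ).monotone) (hrange ▸ hp)
  refine ⟨⟨f', hmono⟩, i, m, Subtype.ext (funext fun x => ?_), ?_⟩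
  · rw [mul_apply, corank_apply]
    exact ((hf' _).trans (hfac x)).symm
  · have : Set.range f' = insert p (Set.range f.1) := by
      rw [← hrange]
      ext z
      constructor
      · rintro ⟨x, rfl⟩
        induction x using Fin.succAboveCases m with
        | x => exact Or.inl hfm
        | p y => exact Or.inr ⟨y, (hf' y).symm⟩
      · rintro (rfl | ⟨y, rfl⟩)
        exacts [⟨m, hfm⟩, ⟨_, hf' y⟩]
    rw [rank, rank, ← Set.ncard_insert_of_notMem hp]
    exact congrArg Set.ncard this

theorem rank_eq_iff {f : OrderMon (k + 2)} : rank f = k + 1 ↔ ∃ i m, f = corank i m := by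
  constructor
  · intro h
    obtain ⟨f', i, m, hf, hr⟩ := exists_eq_mul_corank (f := f) (by omega)
    rw [eq_one_of_rank_eq (f := f') (by omega), one_mul] at hf
    exact ⟨i, m, hf⟩
  · rintro ⟨i, m, rfl⟩
    exact rank_corank i m

theorem eq_one_or_eq_corank {f : OrderMon (k + 2)} (h : k + 1 ≤ rank f) :
    f = 1 ∨ ∃ i m, f = corank i m := by
  rcases (rank_le f).eq_or_lt with h' | h'
  · exact Or.inl (eq_one_of_rank_eq h')
  · exact Or.inr (rank_eq_iff.1 (by omega))

theorem eq_top_of_corank_mem {N : Subsemigroup (OrderMon (k + 2))} (h1 : 1 ∈ N)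
    (h : ∀ i m, corank i m ∈ N) : N = ⊤ := by
  suffices ∀ d, ∀ f : OrderMon (k + 2), rank f + d = k + 2 → f ∈ N from
    eq_top_iff.2 fun f _ => this (k + 2 - rank f) f (by have := rank_le f; omega)
  intro d
  induction d with
  | zero => exact fun f hf => eq_one_of_rank_eq (f := f) (by omega) ▸ h1
  | succ d ih =>
    intro f hf
    obtain ⟨f', i, m, rfl, hr⟩ := exists_eq_mul_corank (f := f) (by omega)
    exact mul_mem (ih f' (by omega)) (h i m)

/-- The non-identity elements form a subsemigroup. -/
def nonOne (k : ℕ) : Subsemigroup (OrderMon (k + 2)) where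
  carrier := {1}ᶜ
  mul_mem' := by
    intro f g hf _ h
    have h' : f * g = 1 := h
    have := rank_mul_le_left f g
    rw [h', rank_one] at this
    exact hf (eq_one_of_rank_eq (le_antisymm (rank_le f) this))

/-- A pair consisting of a set of kernel vertices and a set of image vertices, with no adjacency
between them. -/
def Indep (S : Set (Fin (k + 1)) × Set (Fin (k + 2))) : Prop :=
  ∀ i ∈ S.1, ∀ m ∈ S.2, ¬ Near i m

/-- Neither all the kernel vertices nor all the image vertices are chosen. -/
def Proper (S : Set (Fin (k + 1)) × Set (Fin (k + 2))) : Prop :=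
  (∃ i, i ∉ S.1) ∧ ∃ m, m ∉ S.2

/-- The subsemigroup of those elements whose kernel or image vertex, if they have rank `k + 1`,
belongs to the given independent set. -/
def ofIndep (S : Set (Fin (k + 1)) × Set (Fin (k + 2))) (hS : Indep S) :
    Subsemigroup (OrderMon (k + 2)) where
  carrier := {f | ∀ i m, f = corank i m → i ∈ S.1 ∨ m ∈ S.2}
  mul_mem' := by
    intro f g hf hg i m h
    have hle := rank_mul_le_left f g
    have hle' := rank_mul_le_right f g
    rw [h, rank_corank] at hle hle'
    rcases eq_one_or_eq_corank hle with rfl | ⟨i', m', rfl⟩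
    · exact hg i m (by rwa [one_mul] at h)
    rcases eq_one_or_eq_corank hle' with rfl | ⟨j, l, rfl⟩
    · exact hf i m (by rwa [mul_one] at h)
    obtain ⟨hN, rfl, rfl⟩ := eq_of_corank_mul_corank_eq h
    rcases hg _ _ rfl with h' | h'
    · exact Or.inl h'
    rcases hf _ _ rfl with h'' | h''
    · exact absurd hN (hS _ h'' _ h')
    · exact Or.inr h''

variable {S S' : Set (Fin (k + 1)) × Set (Fin (k + 2))}

theorem corank_mem_ofIndep {hS : Indep S} {i : Fin (k + 1)} {m : Fin (k + 2)} :
    corank i m ∈ ofIndep S hS ↔ i ∈ S.1 ∨ m ∈ S.2 := by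
  refine ⟨fun h => h i m rfl, fun h i' m' h' => ?_⟩
  obtain ⟨rfl, rfl⟩ := corank_inj.1 h'
  exact h

theorem one_ne_corank (i : Fin (k + 1)) (m : Fin (k + 2)) : 1 ≠ corank i m := by
  intro h
  have := rank_one (k := k)
  rw [h, rank_corank] at this
  omega

theorem one_mem_ofIndep (hS : Indep S) : 1 ∈ ofIndep S hS :=
  fun i m h => absurd h (one_ne_corank i m)

theorem ofIndep_ne_top (hS : Indep S) (hp : Proper S) : ofIndep S hS ≠ ⊤ := by
  obtain ⟨⟨i, hi⟩, m, hm⟩ := hp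
  intro h
  have : corank i m ∈ ofIndep S hS := h ▸ Subsemigroup.mem_top _
  exact (corank_mem_ofIndep.1 this).elim hi hm

theorem ofIndep_mono (hS : Indep S) (hS' : Indep S') (h : S ≤ S') :
    ofIndep S hS ≤ ofIndep S' hS' :=
  fun _ hf i m he => (hf i m he).imp (fun hi => h.1 hi) (fun hm => h.2 hm)

theorem le_of_ofIndep_le {hS : Indep S} {hS' : Indep S'} (hp : Proper S')
    (h : ofIndep S hS ≤ ofIndep S' hS') : S ≤ S' := by
  obtain ⟨⟨i, hi⟩, m, hm⟩ := hp
  constructor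
  · intro j hj
    have hmem : corank j m ∈ ofIndep S' hS' := h (corank_mem_ofIndep.2 (Or.inl hj))
    exact (corank_mem_ofIndep.1 hmem).resolve_right hm
  · intro l hl
    have hmem : corank i l ∈ ofIndep S' hS' := h (corank_mem_ofIndep.2 (Or.inr hl))
    exact (corank_mem_ofIndep.1 hmem).resolve_left hi

theorem exists_le_ofIndep {N : Subsemigroup (OrderMon (k + 2))} (hN : N ≠ ⊤) (h1 : 1 ∈ N) :
    ∃ S, ∃ hS : Indep S, Proper S ∧ N ≤ ofIndep S hS := by
  obtain ⟨i₀, m₀, h₀⟩ : ∃ i m, corank i m ∉ N := by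
    by_contra! h
    exact hN (eq_top_of_corank_mem h1 h)
  refine ⟨({i | i ≠ i₀ ∧ ∀ m, corank i₀ m ∈ N → ¬ Near i m}, {m | corank i₀ m ∈ N}),
    fun i hi m hm => hi.2 m hm, ⟨⟨i₀, fun h => h.1 rfl⟩, m₀, h₀⟩, ?_⟩
  rintro _ hf i m rfl
  by_contra! hcon
  obtain ⟨hi, hm⟩ := hcon
  simp only [Set.mem_ofPred_eq, not_and, not_forall, not_not] at hi hm
  have hne : i ≠ i₀ := by
    rintro rfl
    exact hm hf
  obtain ⟨m', hm', hN'⟩ := hi hne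
  exact hm (corank_mul_corank hN' ▸ mul_mem hf hm')

theorem isCoatom_iff (N : Subsemigroup (OrderMon (k + 2))) :
    IsCoatom N ↔ N = nonOne k ∨
      ∃ S, ∃ hS : Maximal (fun S => Indep S ∧ Proper S) S, N = ofIndep S hS.prop.1 := by
  have hne : nonOne k ≠ ⊤ := fun h =>
    (h ▸ Subsemigroup.mem_top _ : (1 : OrderMon (k + 2)) ∈ nonOne k) rfl
  constructor
  · intro hN
    by_cases h1 : 1 ∈ N
    · obtain ⟨S, hS, hp, hle⟩ := exists_le_ofIndep hN.1 h1
      obtain rfl := (hN.le_iff_eq (ofIndep_ne_top hS hp)).1 hle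
      refine Or.inr ⟨S, ⟨⟨hS, hp⟩, fun S' hS' h => ?_⟩, rfl⟩
      exact le_of_ofIndep_le hp ((hN.le_iff_eq (ofIndep_ne_top hS'.1 hS'.2)).1
        (ofIndep_mono hS hS'.1 h)).le
    · refine Or.inl ((hN.le_iff_eq hne).1 fun f hf h => ?_).symm
      obtain rfl : f = 1 := h
      exact h1 hf
  · rintro (rfl | ⟨S, hS, rfl⟩)
    · refine ⟨hne, fun N hlt => eq_top_iff.2 fun f _ => ?_⟩
      obtain ⟨g, hg, hg'⟩ := SetLike.exists_of_lt hlt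
      obtain rfl : g = 1 := not_not.1 hg'
      by_cases hf : f = 1
      · exact hf ▸ hg
      · exact hlt.le hf
    · refine ⟨ofIndep_ne_top _ hS.prop.2, fun N hlt => ?_⟩
      by_contra hN
      obtain ⟨S', hS', hp, hle⟩ := exists_le_ofIndep hN (hlt.le (one_mem_ofIndep _))
      have h := hS.le_of_ge ⟨hS', hp⟩ (le_of_ofIndep_le hp (hlt.le.trans hle))
      exact hlt.not_ge (hle.trans (ofIndep_mono _ _ h))

/-- The kernel and image vertices in a set of vertices of the path graph of order `2 * k + 3`. -/
def split (k : ℕ) (A : Set ℕ) : Set (Fin (k + 1)) × Set (Fin (k + 2)) :=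
  ({i | 2 * (i.1 + 1) ∈ A}, {m | 2 * m.1 + 1 ∈ A})

/-- The vertices of the path graph of order `2 * k + 3` given by sets of kernel and image
vertices. -/
def merge (S : Set (Fin (k + 1)) × Set (Fin (k + 2))) : Set ℕ :=
  {v | (∃ i ∈ S.1, v = 2 * (i.1 + 1)) ∨ ∃ m ∈ S.2, v = 2 * m.1 + 1}

/-- Independent subsets of the path graph of order `2 * n - 1`. -/
def PathIndep (n : ℕ) (B : Set ℕ) : Prop :=
  B ⊆ Set.Icc 1 (2 * n - 1) ∧ ∀ a ∈ B, a + 1 ∉ B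

theorem near_iff {i : Fin (k + 1)} {m : Fin (k + 2)} : Near i m ↔ m.1 = i.1 ∨ m.1 = i.1 + 1 := by
  simp [Near, Fin.ext_iff]

theorem split_merge : split k (merge S) = S := by
  refine Prod.ext (Set.ext fun i => ?_) (Set.ext fun m => ?_)
  · constructor
    · rintro (⟨j, hj, h⟩ | ⟨j, hj, h⟩)
      · exact (Fin.ext (by omega) : j = i) ▸ hj
      · omega
    · exact fun hi => Or.inl ⟨i, hi, rfl⟩
  · constructor
    · rintro (⟨j, hj, h⟩ | ⟨j, hj, h⟩)
      · omega
      · exact (Fin.ext (by omega) : j = m) ▸ hj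
    · exact fun hm => Or.inr ⟨m, hm, rfl⟩

theorem subset_merge_of_split_le {B : Set ℕ} (hB : PathIndep (k + 2) B) (h : split k B ≤ S) :
    B ⊆ merge S := by
  intro v hv
  have hv' := hB.1 hv
  rw [Set.mem_Icc] at hv'
  rcases Nat.even_or_odd' v with ⟨c, rfl | rfl⟩
  · have hc : 2 * (c - 1 + 1) ∈ B := (show c - 1 + 1 = c by omega).symm ▸ hv
    exact Or.inl ⟨⟨c - 1, by omega⟩, h.1 hc, by simp only; omega⟩
  · exact Or.inr ⟨⟨c, by omega⟩, h.2 hv, rfl⟩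

theorem split_mono {A B : Set ℕ} (h : A ⊆ B) : split k A ≤ split k B :=
  ⟨fun _ hi => h hi, fun _ hm => h hm⟩

theorem PathIndep.indep_split {A : Set ℕ} {n : ℕ} (hA : PathIndep n A) : Indep (split k A) := by
  intro i hi m hm h
  have hi : 2 * (i.1 + 1) ∈ A := hi
  have hm : 2 * m.1 + 1 ∈ A := hm
  rcases near_iff.1 h with h | h
  · exact hA.2 _ hm (by rw [h]; exact hi)
  · exact hA.2 _ hi (by rw [h] at hm; exact hm)

theorem Indep.pathIndep_merge (hS : Indep S) : PathIndep (k + 2) (merge S) := by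
  constructor
  · rintro v (⟨i, hi, rfl⟩ | ⟨m, hm, rfl⟩) <;> rw [Set.mem_Icc] <;> omega
  · rintro v (⟨i, hi, rfl⟩ | ⟨m, hm, rfl⟩) (⟨j, hj, h⟩ | ⟨l, hl, h⟩)
    · omega
    · exact hS i hi l hl (near_iff.2 (by omega))
    · exact hS j hj m hm (near_iff.2 (by omega))
    · omega

theorem Indep.proper (hS : Indep S) (h₁ : S.1.Nonempty) (h₂ : S.2.Nonempty) : Proper S := by
  obtain ⟨i, hi⟩ := h₁
  obtain ⟨m, hm⟩ := h₂
  refine ⟨⟨⟨m.1 - 1, by omega⟩, fun h => hS _ h m hm (near_iff.2 ?_)⟩,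
    ⟨i.castSucc, fun h => hS i hi _ h (Or.inl rfl)⟩⟩
  simp only
  omega

theorem maximal_split {A : Set ℕ} (hA : Maximal (PathIndep (k + 2)) A)
    (hodd : ∃ v ∈ A, Odd v) (heven : ∃ v ∈ A, Even v) :
    Maximal (fun S => Indep S ∧ Proper S) (split k A) := by
  have hS : Indep (split k A) := hA.prop.indep_split
  refine ⟨⟨hS, hS.proper ?_ ?_⟩, fun S' hS' h => ?_⟩
  · obtain ⟨v, hv, c, rfl⟩ := heven
    have := hA.prop.1 hv
    rw [Set.mem_Icc] at this
    exact ⟨⟨c - 1, by omega⟩, show 2 * (c - 1 + 1) ∈ A by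
      rwa [show 2 * (c - 1 + 1) = c + c by omega]⟩
  · obtain ⟨v, hv, c, rfl⟩ := hodd
    have := hA.prop.1 hv
    rw [Set.mem_Icc] at this
    exact ⟨⟨c, by omega⟩, hv⟩
  · have := hA.le_of_ge hS'.1.pathIndep_merge (subset_merge_of_split_le hA.prop h)
    exact split_merge (S := S') ▸ split_mono this

theorem maximal_compl_image (m : Fin (k + 2)) :
    Maximal (fun S : Set (Fin (k + 1)) × Set (Fin (k + 2)) => Indep S ∧ Proper S) (∅, {m}ᶜ) := by
  refine ⟨⟨fun i hi => absurd hi (Set.notMem_empty i), ⟨⟨0, Set.notMem_empty 0⟩, m,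
    fun h => h rfl⟩⟩, ?_⟩
  rintro ⟨P, Q⟩ ⟨hS, -, l, hl⟩ ⟨-, h⟩
  have hQ : ∀ x, x ∉ Q → x = m := fun x hx => not_not.1 fun hne => hx (h hne)
  have hm : m ∉ Q := hQ l hl ▸ hl
  refine ⟨fun i hi => ?_, fun x hx hxm => hm (hxm ▸ hx)⟩
  have h₁ := hQ _ fun hx => hS i hi _ hx (Or.inl rfl)
  have h₂ := hQ _ fun hx => hS i hi _ hx (Or.inr rfl)
  exact absurd (h₁.trans h₂.symm) Fin.castSucc_lt_succ.ne

theorem maximal_compl_kernel (i : Fin (k + 1)) (h₀ : 0 < i.1) (h₁ : i.1 < k) :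
    Maximal (fun S : Set (Fin (k + 1)) × Set (Fin (k + 2)) => Indep S ∧ Proper S) ({i}ᶜ, ∅) := by
  refine ⟨⟨fun _ _ m hm => absurd hm (Set.notMem_empty m), ⟨⟨i, fun h => h rfl⟩, 0,
    Set.notMem_empty 0⟩⟩, ?_⟩
  rintro ⟨P, Q⟩ ⟨hS, ⟨j, hj⟩, -⟩ ⟨h, -⟩
  have hP : ∀ x, x ∉ P → x = i := fun x hx => not_not.1 fun hne => hx (h hne)
  have hi : i ∉ P := hP j hj ▸ hj
  refine ⟨fun x hx hxi => hi (hxi ▸ hx), fun m hm => ?_⟩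
  have hnear : ∀ x, Near x m → x.1 = i.1 := fun x hx =>
    congrArg Fin.val (hP x fun hxP => hS x hxP m hm hx)
  rcases Nat.eq_zero_or_pos m.1 with hm0 | hm0
  · have := hnear 0 (near_iff.2 (by simp [hm0]))
    simp at this
    omega
  · have h₂ : m.1 - 1 = i.1 := hnear ⟨m.1 - 1, by omega⟩ (near_iff.2 (Or.inr (by simp only; omega)))
    have h₃ : m.1 = i.1 := hnear ⟨m.1, by omega⟩ (near_iff.2 (Or.inl rfl))
    omega

theorem maximal_indep_proper_iff :
    Maximal (fun S => Indep S ∧ Proper S) S ↔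
      (∃ A, Maximal (PathIndep (k + 2)) A ∧ (∃ v ∈ A, Odd v) ∧ (∃ v ∈ A, Even v) ∧
        S = split k A) ∨
      (∃ m, S = (∅, {m}ᶜ)) ∨
      ∃ i, 0 < i.1 ∧ i.1 < k ∧ S = ({i}ᶜ, ∅) := by
  constructor
  · intro hS
    obtain ⟨P, Q⟩ := S
    obtain ⟨hind, ⟨i, hi⟩, m, hm⟩ := hS.prop
    rcases P.eq_empty_or_nonempty with rfl | hP
    · exact Or.inr (Or.inl ⟨m, hS.eq_of_le (maximal_compl_image m).prop
        ⟨le_rfl, fun x hx hxm => hm (hxm ▸ hx)⟩⟩)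
    rcases Q.eq_empty_or_nonempty with rfl | hQ
    · have hext : ∀ l, ¬ ∀ j, Near j l → j = i := by
        intro l hl
        have hle : (P, {l}) ≤ (P, (∅ : Set (Fin (k + 2)))) := by
          refine hS.le_of_ge ⟨?_, ⟨i, hi⟩, l + 1, by simp⟩ ⟨le_rfl, Set.empty_subset _⟩
          rintro j hj _ rfl hjl
          exact hi (hl j hjl ▸ hj)
        exact hle.2 rfl
      have hnear₀ := hext 0
      have hnear₁ := hext (Fin.last _)
      refine Or.inr (Or.inr ⟨i, Nat.pos_of_ne_zero fun h => hnear₀ fun j hj => ?_,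
        lt_of_le_of_ne (by omega) fun h => hnear₁ fun j hj => ?_, ?_⟩)
      · have := near_iff.1 hj
        simp only [Fin.val_zero] at this
        exact Fin.ext (by omega)
      · have := near_iff.1 hj
        simp only [Fin.val_last] at this
        exact Fin.ext (by omega)
      · exact hS.eq_of_le ⟨fun _ _ m hm => absurd hm (Set.notMem_empty m),
          ⟨i, fun h => h rfl⟩, m, hm⟩ ⟨fun x hx hxi => hi (hxi ▸ hx), le_rfl⟩
    · refine Or.inl ⟨merge (P, Q), ⟨hind.pathIndep_merge, fun B hB hle => ?_⟩, ?_, ?_,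
        split_merge.symm⟩
      · have hPQ : (P, Q) ≤ split k B := (split_merge (S := (P, Q))).ge.trans (split_mono hle)
        have hB' : Indep (split k B) := hB.indep_split
        exact subset_merge_of_split_le hB (hS.le_of_ge
          ⟨hB', hB'.proper (hP.mono hPQ.1) (hQ.mono hPQ.2)⟩ hPQ)
      · obtain ⟨m, hm⟩ := hQ
        exact ⟨_, Or.inr ⟨m, hm, rfl⟩, m, rfl⟩
      · obtain ⟨i, hi⟩ := hP
        exact ⟨_, Or.inl ⟨i, hi, rfl⟩, i + 1, by ring⟩
  · rintro (⟨A, hA, hodd, heven, rfl⟩ | ⟨m, rfl⟩ | ⟨i, h₀, h₁, rfl⟩)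
    · exact maximal_split hA hodd heven
    · exact maximal_compl_image m
    · exact maximal_compl_kernel i h₀ h₁

theorem coe_ofIndep_eq {hS : Indep S} {T : Set (OrderMon (k + 2))}
    (h₁ : ∀ f, rank f ≠ k + 1 → f ∈ T)
    (h₂ : ∀ i m, corank i m ∈ T ↔ i ∈ S.1 ∨ m ∈ S.2) :
    (ofIndep S hS : Set (OrderMon (k + 2))) = T := by
  ext f
  by_cases hf : rank f = k + 1
  · obtain ⟨i, m, rfl⟩ := rank_eq_iff.1 hf
    rw [h₂]
    exact corank_mem_ofIndep
  · exact iff_of_true (fun i m h => absurd (rank_eq_iff.2 ⟨i, m, h⟩) hf) (h₁ f hf)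

theorem coe_ofIndep_split {A : Set ℕ} (hA : PathIndep (k + 2) A) :
    (ofIndep (split k A) hA.indep_split : Set (OrderMon (k + 2))) =
      {f | (Set.range f.1).ncard ≠ k + 1} ∪
      {f | (Set.range f.1).ncard = k + 1 ∧
        ((∃ v ∈ A, Odd v ∧ ∀ x : Fin (k + 2), x ∉ Set.range f.1 → x.1 + 1 = (v + 1) / 2) ∨
         (∃ v ∈ A, Even v ∧ ∀ j : Fin (k + 2), ∀ hj : j.1 + 1 < k + 2,
            f.1 j = f.1 ⟨j.1 + 1, hj⟩ → j.1 + 1 = v / 2))} := by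
  refine coe_ofIndep_eq (fun f hf => Or.inl hf) fun i m => ?_
  constructor
  · rintro (h | ⟨-, ⟨v, hv, ⟨c, rfl⟩, h⟩ | ⟨v, hv, ⟨c, rfl⟩, h⟩⟩)
    · exact absurd (rank_corank i m) h
    · right
      have := h m (by simp [range_corank])
      obtain rfl : m.1 = c := by omega
      exact hv
    · left
      have := h i.castSucc (by rw [Fin.val_castSucc]; omega) ((corank_eq_succ_iff i i m).2 rfl)
      rw [Fin.val_castSucc] at this
      change 2 * (i.1 + 1) ∈ A
      rwa [show 2 * (i.1 + 1) = c + c by omega]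
  · rintro (h | h)
    · refine Or.inr ⟨rank_corank i m, Or.inr ⟨_, h, ⟨i.1 + 1, by ring⟩, fun j hj hij => ?_⟩⟩
      have := (corank_eq_succ_iff i ⟨j.1, by omega⟩ m).1 hij
      rw [← this]
      simp
    · refine Or.inr ⟨rank_corank i m, Or.inl ⟨_, h, ⟨m.1, rfl⟩, fun x hx => ?_⟩⟩
      rw [range_corank] at hx
      obtain rfl : x = m := not_not.1 hx
      omega

theorem coe_ofIndep_compl_image (m : Fin (k + 2)) :
    (ofIndep (∅, {m}ᶜ) (maximal_compl_image m).prop.1 : Set (OrderMon (k + 2))) =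
      {f | ¬((Set.range f.1).ncard = k + 1 ∧ Set.range f.1 = {m}ᶜ)} := by
  refine coe_ofIndep_eq (fun f hf h => hf h.1) fun i l => ?_
  have := rank_corank i l
  rw [rank] at this
  simp only [Set.mem_ofPred_eq, this, true_and]
  simp [range_corank]

theorem coe_ofIndep_compl_kernel (i : Fin (k + 1)) (h₀ : 0 < i.1) (h₁ : i.1 < k) :
    (ofIndep ({i}ᶜ, ∅) (maximal_compl_kernel i h₀ h₁).prop.1 : Set (OrderMon (k + 2))) =
      {f | ¬((Set.range f.1).ncard = k + 1 ∧ f.1 i.castSucc = f.1 i.succ)} := by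
  refine coe_ofIndep_eq (fun f hf h => hf h.1) fun j l => ?_
  have := rank_corank j l
  rw [rank] at this
  simp [this, corank_eq_succ_iff, eq_comm]

end OrderMon

theorem maximal_subsemigroups_of_order_preserving_transformation_monoid
    (n : ℕ) (hn : 2 ≤ n) (M : Subsemigroup (OrderMon n)) :
    IsCoatom M ↔
      -- (a) O \ {id}
      ((M : Set (OrderMon n)) = {(1 : OrderMon n)}ᶜ ∨
      -- (b) determined by a maximal independent subset of the path graph on
      -- {1, …, 2n − 1} (consecutive numbers adjacent) containing both an odd
      -- and an even number
      (∃ A : Set ℕ,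
        Maximal (fun B : Set ℕ =>
          B ⊆ Set.Icc 1 (2 * n - 1) ∧ ∀ a ∈ B, a + 1 ∉ B) A ∧
        (∃ v ∈ A, Odd v) ∧ (∃ v ∈ A, Even v) ∧
        (M : Set (OrderMon n)) =
          {f | (Set.range f.1).ncard ≠ n - 1} ∪
          {f | (Set.range f.1).ncard = n - 1 ∧
            ((∃ v ∈ A, Odd v ∧
                ∀ x : Fin n, x ∉ Set.range f.1 → x.1 + 1 = (v + 1) / 2) ∨
             (∃ v ∈ A, Even v ∧
                ∀ j : Fin n, ∀ hj : j.1 + 1 < n,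
                  f.1 j = f.1 ⟨j.1 + 1, hj⟩ → j.1 + 1 = v / 2))}) ∨
      -- (c) remove the L-class of functions whose range misses exactly i
      (∃ i : Fin n,
        (M : Set (OrderMon n)) =
          {f | ¬((Set.range f.1).ncard = n - 1 ∧ Set.range f.1 = {i}ᶜ)}) ∨
      -- (d) remove the R-class of functions identifying i and i + 1
      -- (1-based, 2 ≤ i ≤ n − 2)
      (∃ i : ℕ, ∃ h1 : 2 ≤ i, ∃ h2 : i ≤ n - 2,
        (M : Set (OrderMon n)) =
          {f | ¬((Set.range f.1).ncard = n - 1 ∧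
            f.1 (⟨i - 1, by omega⟩ : Fin n) = f.1 (⟨i, by omega⟩ : Fin n))})) := by
  obtain ⟨k, rfl⟩ : ∃ k, n = k + 2 := ⟨n - 2, by omega⟩
  rw [OrderMon.isCoatom_iff]
  refine or_congr SetLike.coe_set_eq.symm ?_
  constructor
  · rintro ⟨S, hS, rfl⟩
    rcases OrderMon.maximal_indep_proper_iff.1 hS with
      ⟨A, hA, hodd, heven, rfl⟩ | ⟨m, rfl⟩ | ⟨i, h₀, h₁, rfl⟩
    · exact Or.inl ⟨A, hA, hodd, heven, OrderMon.coe_ofIndep_split hA.prop⟩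
    · exact Or.inr (Or.inl ⟨m, OrderMon.coe_ofIndep_compl_image m⟩)
    · exact Or.inr (Or.inr ⟨i.1 + 1, by omega, by omega,
        OrderMon.coe_ofIndep_compl_kernel i h₀ h₁⟩)
  · rintro (⟨A, hA, hodd, heven, hM⟩ | ⟨m, hM⟩ | ⟨i, h₁, h₂, hM⟩)
    · exact ⟨_, OrderMon.maximal_split hA hodd heven,
        SetLike.coe_injective (hM.trans (OrderMon.coe_ofIndep_split hA.prop).symm)⟩
    · exact ⟨_, OrderMon.maximal_compl_image m,
        SetLike.coe_injective (hM.trans (OrderMon.coe_ofIndep_compl_image m).symm)⟩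
    · obtain ⟨j, rfl⟩ : ∃ j, i = j + 1 := ⟨i - 1, by omega⟩
      have h₃ : 0 < j := by omega
      have h₄ : j < k := by omega
      exact ⟨_, OrderMon.maximal_compl_kernel ⟨j, by omega⟩ h₃ h₄, SetLike.coe_injective
        (hM.trans (OrderMon.coe_ofIndep_compl_kernel ⟨j, by omega⟩ h₃ h₄).symm)⟩
end

section
/- Let A : ℕ → ℕ be any function with A 1 = 1, A 2 = 2, A 3 = 2, and A k = A (k−2) + A (k−3) for all k ≥ 4. For every n ≥ 3, the number of maximal subsemigroups of the monoid of all monotone functions f : Fin n → Fin n under composition equals A (2n−1) + 2n − 4. -/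
namespace Fin

variable {m : ℕ}

theorem val_predAbove (i : Fin m) (x : Fin (m + 1)) :
    (predAbove i x : ℕ) = if (i : ℕ) < x then (x : ℕ) - 1 else x := by
  simp only [predAbove, Fin.lt_def, val_castSucc]
  split_ifs <;> simp

theorem val_succAbove (j : Fin (m + 1)) (x : Fin m) :
    (succAbove j x : ℕ) = if (x : ℕ) < j then (x : ℕ) else x + 1 := by
  simp only [succAbove, Fin.lt_def, val_castSucc]
  split_ifs <;> simp

theorem predAbove_castSucc_eq_succ_iff (i k : Fin m) :
    predAbove i k.castSucc = predAbove i k.succ ↔ k = i := by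
  simp only [Fin.ext_iff, val_predAbove, val_castSucc, val_succ]
  split_ifs <;> omega

theorem predAbove_succAbove_eq_iff (k : Fin m) (j : Fin (m + 1)) :
    (∀ x, predAbove k (succAbove j x) = x) ↔ (j : ℕ) = k ∨ (j : ℕ) = k + 1 := by
  simp only [Fin.ext_iff, val_predAbove, val_succAbove]
  constructor
  · intro h
    by_contra! hne
    rcases lt_or_gt_of_ne hne.1 with hlt | hgt
    · have := h ⟨j, by omega⟩
      grind
    · have := h ⟨k + 1, by omega⟩
      grind
  · grind

theorem comp_succAbove_predAbove {α : Type*} {f : Fin (m + 1) → α} {k : Fin m}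
    (h : f k.castSucc = f k.succ) (x : Fin (m + 1)) :
    f (k.castSucc.succAbove (predAbove k x)) = f x := by
  by_cases hx : x = k.castSucc
  · subst hx
    simp [h]
  · rw [succAbove_predAbove hx]

theorem exists_apply_castSucc_eq_succ {f : Fin (m + 1) → Fin (m + 1)} (hf : Monotone f)
    (h : f ≠ id) : ∃ k : Fin m, f k.castSucc = f k.succ := by
  by_contra! hne
  have hs : StrictMono f := Fin.strictMono_iff_lt_succ.2 fun k =>
    lt_of_le_of_ne (hf (Fin.castSucc_lt_succ).le) (hne k)
  refine h ((StrictMono.range_inj hs strictMono_id).1 ?_)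
  rw [Set.range_id, (Finite.surjective_of_injective hs.injective).range_eq]

theorem exists_eq_succAbove {g : Fin m → Fin (m + 1)} (hg : StrictMono g) :
    ∃ j, g = succAbove j := by
  have hns : ¬ Function.Surjective g := fun hs => by
    have := Fintype.card_le_of_surjective g hs
    simp at this
  obtain ⟨j, hj⟩ := not_forall.1 hns
  refine ⟨j, (StrictMono.range_inj hg (strictMono_succAbove j)).1 ?_⟩
  rw [range_succAbove]
  refine Set.eq_of_subset_of_ncard_le (fun x hx hxj => ?_) ?_
  · obtain rfl : x = j := hxj
    exact hj hx
  · rw [Set.ncard_compl, Set.ncard_singleton, ← Set.image_univ,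
      Set.ncard_image_of_injective _ hg.injective]
    simp

/-- A monotone non-identity endofunction is the composite of one whose range has one more point and
a function collapsing two adjacent points. -/
theorem exists_monotone_comp {f : Fin (m + 1) → Fin (m + 1)} (hf : Monotone f) (h : f ≠ id) :
    ∃ (g : Fin (m + 1) → Fin (m + 1)) (i : Fin m) (j : Fin (m + 1)), Monotone g ∧
      (∀ x, g (succAbove j (predAbove i x)) = f x) ∧ Set.range f ⊂ Set.range g := by
  obtain ⟨i, hi⟩ := exists_apply_castSucc_eq_succ hf h
  obtain ⟨p, hp⟩ : ∃ p, p ∉ Set.range f := by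
    by_contra! hs
    have := (Finite.injective_iff_surjective.2 hs) hi
    exact (Fin.castSucc_lt_succ).ne this
  set f' : Fin m → Fin (m + 1) := f ∘ i.castSucc.succAbove with hf'
  have hmono : Monotone f' := hf.comp (strictMono_succAbove _).monotone
  have hp' : ∀ x, f' x ≠ p := fun x hx => hp ⟨_, hx⟩
  obtain ⟨j, hj⟩ : ∃ j : Fin (m + 1), ∀ x : Fin m, x.castSucc < j ↔ f' x < p := by
    by_cases hall : ∀ x, f' x < p
    · exact ⟨last m, fun x => by simp [hall]⟩
    · rw [not_forall] at hall
      obtain ⟨x, hx, hmin⟩ := WellFounded.has_min (wellFounded_lt (α := Fin m))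
        {x | ¬ f' x < p} hall
      refine ⟨x.castSucc, fun y => ⟨fun hy => ?_, fun hy => ?_⟩⟩
      · by_contra hc
        exact hmin y hc (by simpa using hy)
      · by_contra hc
        exact hx ((hmono (by simpa using hc)).trans_lt hy)
  refine ⟨j.insertNth p f', i, j, ?_, fun x => ?_, ?_, fun hsub => hp (hsub ⟨j, by simp⟩)⟩
  · intro a b hab
    induction a using j.succAboveCases with
    | x =>
      induction b using j.succAboveCases with
      | x => simp
      | p b =>
        have hb : ¬ b.castSucc < j := fun hb => by
          rw [succAbove_of_castSucc_lt _ _ hb] at hab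
          exact absurd hab (not_le.2 hb)
        simpa using (hj b).not.1 hb
    | p a =>
      induction b using j.succAboveCases with
      | x =>
        have ha : a.castSucc < j := by
          by_contra ha
          rw [succAbove_of_le_castSucc _ _ (not_lt.1 ha)] at hab
          exact ha ((Fin.castSucc_lt_succ).trans_le hab)
        simpa using ((hj a).1 ha).le
      | p b => simpa using hmono ((strictMono_succAbove j).le_iff_le.1 hab)
  · simp [hf', comp_succAbove_predAbove hi]
  · rintro _ ⟨x, rfl⟩
    exact ⟨j.succAbove (predAbove i x), by simp [hf', comp_succAbove_predAbove hi]⟩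

end Fin

/-- Maximal independent sets of the path with vertices `0, …, N - 1`. -/
def pathMIS (N : ℕ) : Finset (Finset ℕ) :=
  {Z ∈ (Finset.range N).powerset | (∀ v ∈ Z, v + 1 ∉ Z) ∧
    ∀ v ∈ Finset.range N, v ∉ Z → v + 1 ∈ Z ∨ ∃ w ∈ Z, w + 1 = v}

theorem mem_pathMIS {N : ℕ} {Z : Finset ℕ} : Z ∈ pathMIS N ↔ (∀ v ∈ Z, v < N) ∧
    (∀ v ∈ Z, v + 1 ∉ Z) ∧ ∀ v < N, v ∉ Z → v + 1 ∈ Z ∨ ∃ w ∈ Z, w + 1 = v := by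
  simp [pathMIS, Finset.subset_iff]

theorem pathMIS_add_three (N : ℕ) : pathMIS (N + 3) =
    (pathMIS (N + 1)).image (insert (N + 2)) ∪ (pathMIS N).image (insert (N + 1)) := by
  ext Z
  simp only [Finset.mem_union, Finset.mem_image, mem_pathMIS]
  constructor
  · rintro ⟨hlt, hind, hdom⟩
    by_cases hlast : N + 2 ∈ Z
    · refine Or.inl ⟨Z.erase (N + 2), ⟨?_, ?_, ?_⟩, Finset.insert_erase hlast⟩
      all_goals simp only [Finset.mem_erase]
      all_goals grind
    · have hN : N + 1 ∈ Z := by grind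
      refine Or.inr ⟨Z.erase (N + 1), ⟨?_, ?_, ?_⟩, Finset.insert_erase hN⟩
      all_goals simp only [Finset.mem_erase]
      all_goals grind
  · rintro (⟨Z, ⟨hlt, hind, hdom⟩, rfl⟩ | ⟨Z, ⟨hlt, hind, hdom⟩, rfl⟩)
    · refine ⟨?_, ?_, ?_⟩
      all_goals simp only [Finset.mem_insert]
      all_goals grind
    · refine ⟨?_, ?_, ?_⟩
      all_goals simp only [Finset.mem_insert]
      all_goals grind

theorem card_pathMIS_add_three (N : ℕ) :
    (pathMIS (N + 3)).card = (pathMIS (N + 1)).card + (pathMIS N).card := by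
  rw [pathMIS_add_three, Finset.card_union_of_disjoint, Finset.card_image_of_injOn,
    Finset.card_image_of_injOn]
  · intro Y hY Z hZ h
    have hY' := (mem_pathMIS.1 hY).1 (N + 1)
    have hZ' := (mem_pathMIS.1 hZ).1 (N + 1)
    rw [← Finset.erase_insert (a := N + 1) (s := Y) (by grind), h, Finset.erase_insert (by grind)]
  · intro Y hY Z hZ h
    have hY' := (mem_pathMIS.1 hY).1 (N + 2)
    have hZ' := (mem_pathMIS.1 hZ).1 (N + 2)
    rw [← Finset.erase_insert (a := N + 2) (s := Y) (by grind), h, Finset.erase_insert (by grind)]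
  · simp only [Finset.disjoint_left, Finset.mem_image, mem_pathMIS]
    rintro _ ⟨Y, -, rfl⟩ ⟨Z, ⟨hZ, -⟩, h⟩
    have : N + 2 ∈ insert (N + 1) Z := h ▸ Finset.mem_insert_self _ _
    grind

theorem card_pathMIS (A : ℕ → ℕ) (hA1 : A 1 = 1) (hA2 : A 2 = 2) (hA3 : A 3 = 2)
    (hArec : ∀ k, 4 ≤ k → A k = A (k - 2) + A (k - 3)) (N : ℕ) (hN : 1 ≤ N) :
    (pathMIS N).card = A N := by
  induction N using Nat.strong_induction_on with
  | _ N ih =>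
    match N, hN with
    | 1, _ => rw [hA1]; decide
    | 2, _ => rw [hA2]; decide
    | 3, _ => rw [hA3]; decide
    | k + 4, _ =>
      rw [card_pathMIS_add_three (k + 1), ih (k + 1) (by omega) (by omega),
        ih (k + 2) (by omega) (by omega), hArec (k + 4) (by omega)]
      rfl

/-- Independent sets of the path `0, …, 2 * m` that contain neither all odd nor all even
vertices. -/
def IsAdmissible (m : ℕ) (Z : Finset ℕ) : Prop :=
  (∀ v ∈ Z, v < 2 * m + 1) ∧ (∀ v ∈ Z, v + 1 ∉ Z) ∧ (∃ k < m, 2 * k + 1 ∉ Z) ∧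
    ∃ j ≤ m, 2 * j ∉ Z

/-- The even vertices of the path `0, …, 2 * m`. -/
def evenVertices (m : ℕ) : Finset ℕ := (Finset.range (m + 1)).image (2 * ·)

/-- The odd vertices of the path `0, …, 2 * m`. -/
def oddVertices (m : ℕ) : Finset ℕ := (Finset.range m).image (2 * · + 1)

theorem mem_evenVertices {m v : ℕ} : v ∈ evenVertices m ↔ v < 2 * m + 1 ∧ v % 2 = 0 := by
  simp only [evenVertices, Finset.mem_image, Finset.mem_range]
  exact ⟨by rintro ⟨j, hj, rfl⟩; omega, fun h => ⟨v / 2, by omega, by omega⟩⟩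

theorem mem_oddVertices {m v : ℕ} : v ∈ oddVertices m ↔ v < 2 * m + 1 ∧ v % 2 = 1 := by
  simp only [oddVertices, Finset.mem_image, Finset.mem_range]
  exact ⟨by rintro ⟨j, hj, rfl⟩; omega, fun h => ⟨v / 2, by omega, by omega⟩⟩

theorem evenVertices_mem_pathMIS (m : ℕ) : evenVertices m ∈ pathMIS (2 * m + 1) := by
  simp only [mem_pathMIS, mem_evenVertices]
  grind

theorem oddVertices_mem_pathMIS {m : ℕ} (hm : 1 ≤ m) : oddVertices m ∈ pathMIS (2 * m + 1) := by
  simp only [mem_pathMIS, mem_oddVertices]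
  refine ⟨by grind, by grind, fun v hv hv' => ?_⟩
  by_cases h0 : v = 2 * m
  · exact Or.inr ⟨2 * m - 1, by omega, by omega⟩
  · left; omega

theorem eq_of_mem_pathMIS_of_subset {N : ℕ} {Y Z : Finset ℕ} (hY : Y ∈ pathMIS N)
    (hsub : Y ⊆ Z) (hlt : ∀ v ∈ Z, v < N) (hind : ∀ v ∈ Z, v + 1 ∉ Z) : Y = Z := by
  rw [mem_pathMIS] at hY
  refine hsub.antisymm fun v hv => ?_
  by_contra hvY
  rcases hY.2.2 v (hlt v hv) hvY with h | ⟨w, hw, rfl⟩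
  · exact hind v hv (hsub h)
  · exact hind w (hsub hw) hv

theorem isAdmissible_iff {m : ℕ} {Z : Finset ℕ} : IsAdmissible m Z ↔
    (∀ v ∈ Z, v < 2 * m + 1) ∧ (∀ v ∈ Z, v + 1 ∉ Z) ∧ ¬ oddVertices m ⊆ Z ∧
      ¬ evenVertices m ⊆ Z := by
  simp [IsAdmissible, oddVertices, evenVertices, Finset.subset_iff]

theorem maximal_isAdmissible_of_mem_pathMIS {m : ℕ} (hm : 1 ≤ m) {Z : Finset ℕ}
    (hZ : Z ∈ pathMIS (2 * m + 1)) (hodd : Z ≠ oddVertices m) (heven : Z ≠ evenVertices m) :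
    Maximal (IsAdmissible m) Z := by
  have hZ' := mem_pathMIS.1 hZ
  refine ⟨isAdmissible_iff.2 ⟨hZ'.1, hZ'.2.1, fun h => hodd ?_, fun h => heven ?_⟩,
    fun Y hY hle => (eq_of_mem_pathMIS_of_subset hZ hle hY.1 hY.2.1).ge⟩
  · exact (eq_of_mem_pathMIS_of_subset (oddVertices_mem_pathMIS hm) h hZ'.1 hZ'.2.1).symm
  · exact (eq_of_mem_pathMIS_of_subset (evenVertices_mem_pathMIS m) h hZ'.1 hZ'.2.1).symm

theorem maximal_isAdmissible_erase_even {m : ℕ} (hm : 1 ≤ m) {v : ℕ} (hv : v ∈ evenVertices m) :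
    Maximal (IsAdmissible m) ((evenVertices m).erase v) := by
  refine ⟨isAdmissible_iff.2 ⟨?_, ?_, fun h => ?_, fun h => by simpa using h hv⟩,
    fun Y hY hle w hw => ?_⟩
  · simp only [Finset.mem_erase, mem_evenVertices]; grind
  · simp only [Finset.mem_erase, mem_evenVertices]; grind
  · have := h ((mem_oddVertices (v := 1)).2 (by omega))
    simp [mem_evenVertices] at this
  · rw [isAdmissible_iff] at hY
    obtain ⟨h1, h2, -, h4⟩ := hY
    have hvY : v ∉ Y := fun h => h4 fun u hu => by
      by_cases huv : u = v
      · exact huv ▸ h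
      · exact hle (Finset.mem_erase.2 ⟨huv, hu⟩)
    have hle' : ∀ u, u < 2 * m + 1 → u % 2 = 0 → u ≠ v → u ∈ Y := fun u hu hu' hne =>
      hle (Finset.mem_erase.2 ⟨hne, mem_evenVertices.2 ⟨hu, hu'⟩⟩)
    have hwlt := h1 w hw
    rw [Finset.mem_erase, mem_evenVertices]
    refine ⟨fun h => hvY (h ▸ hw), hwlt, ?_⟩
    by_contra hodd
    by_cases hwv : w + 1 = v
    · have := h2 (w - 1) (hle' _ (by omega) (by omega) (by omega))
      exact this (by rwa [show w - 1 + 1 = w by omega])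
    · exact h2 w hw (hle' _ (by omega) (by omega) hwv)

theorem maximal_isAdmissible_erase_odd {m : ℕ} {v : ℕ} (hv : v ∈ oddVertices m)
    (hv1 : 1 < v) (hv2 : v < 2 * m - 1) :
    Maximal (IsAdmissible m) ((oddVertices m).erase v) := by
  refine ⟨isAdmissible_iff.2 ⟨?_, ?_, fun h => by simpa using h hv, fun h => ?_⟩,
    fun Y hY hle w hw => ?_⟩
  · simp only [Finset.mem_erase, mem_oddVertices]; grind
  · simp only [Finset.mem_erase, mem_oddVertices]; grind
  · have := h ((mem_evenVertices (v := 0)).2 (by omega))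
    simp [mem_oddVertices] at this
  · rw [isAdmissible_iff] at hY
    obtain ⟨h1, h2, h3, -⟩ := hY
    have hvY : v ∉ Y := fun h => h3 fun u hu => by
      by_cases huv : u = v
      · exact huv ▸ h
      · exact hle (Finset.mem_erase.2 ⟨huv, hu⟩)
    have hle' : ∀ u, u < 2 * m + 1 → u % 2 = 1 → u ≠ v → u ∈ Y := fun u hu hu' hne =>
      hle (Finset.mem_erase.2 ⟨hne, mem_oddVertices.2 ⟨hu, hu'⟩⟩)
    have hwlt := h1 w hw
    rw [Finset.mem_erase, mem_oddVertices]
    refine ⟨fun h => hvY (h ▸ hw), hwlt, ?_⟩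
    by_contra heven
    by_cases hwv : w + 1 = v ∨ w = 2 * m
    · have := h2 (w - 1) (hle' _ (by omega) (by omega) (by omega))
      exact this (by rwa [show w - 1 + 1 = w by omega])
    · exact h2 w hw (hle' _ (by omega) (by omega) (by omega))

theorem not_maximal_isAdmissible_erase_odd {m : ℕ} (hm : 2 ≤ m) {v w : ℕ}
    (h : v = 1 ∧ w = 0 ∨ v = 2 * m - 1 ∧ w = 2 * m) :
    ¬ Maximal (IsAdmissible m) ((oddVertices m).erase v) := by
  intro hmax
  have hw : w ∈ (oddVertices m).erase v := hmax.2 (y := insert w ((oddVertices m).erase v))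
    (isAdmissible_iff.2 ⟨?_, ?_, fun h' => ?_, fun h' => ?_⟩) (Finset.subset_insert _ _)
    (Finset.mem_insert_self _ _)
  · simp only [Finset.mem_erase, mem_oddVertices] at hw; omega
  · simp only [Finset.mem_insert, Finset.mem_erase, mem_oddVertices]; grind
  · simp only [Finset.mem_insert, Finset.mem_erase, mem_oddVertices]; grind
  · have := h' ((mem_oddVertices (v := v)).2 (by omega))
    simp only [Finset.mem_insert, Finset.mem_erase] at this; omega
  · have := h' ((mem_evenVertices (v := 2)).2 (by omega))
    simp only [Finset.mem_insert, Finset.mem_erase, mem_oddVertices] at this; omega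

/-- The maximal admissible sets are the maximal independent sets other than the two colour classes,
together with most of the colour classes with one vertex removed. -/
theorem maximal_isAdmissible_iff {m : ℕ} (hm : 2 ≤ m) {Z : Finset ℕ} :
    Maximal (IsAdmissible m) Z ↔
      Z ∈ ((pathMIS (2 * m + 1)).erase (evenVertices m)).erase (oddVertices m) ∪
        ((evenVertices m).image (evenVertices m).erase ∪
        ((oddVertices m).filter fun v => 1 < v ∧ v < 2 * m - 1).image (oddVertices m).erase) := by
  simp only [Finset.mem_union, Finset.mem_erase, Finset.mem_image, Finset.mem_filter]
  constructor
  · intro hmax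
    obtain ⟨hlt, hind, hodd, heven⟩ := isAdmissible_iff.1 hmax.prop
    by_cases hZ : Z ∈ pathMIS (2 * m + 1)
    · exact Or.inl ⟨fun h => hodd h.ge, fun h => heven h.ge, hZ⟩
    right
    obtain ⟨v, hv, hvZ, hnb⟩ : ∃ v < 2 * m + 1, v ∉ Z ∧ ¬ (v + 1 ∈ Z ∨ ∃ w ∈ Z, w + 1 = v) := by
      by_contra! hc
      exact hZ (mem_pathMIS.2 ⟨hlt, hind, fun v hv hvZ => by
        by_contra! h; exact absurd (hc v hv hvZ) (by grind)⟩)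
    have hlt' : ∀ u ∈ insert v Z, u < 2 * m + 1 := by grind
    have hind' : ∀ u ∈ insert v Z, u + 1 ∉ insert v Z := by grind
    have hnot : ¬ IsAdmissible m (insert v Z) := fun h =>
      hvZ (hmax.2 h (Finset.subset_insert _ _) (Finset.mem_insert_self _ _))
    have hsub : oddVertices m ⊆ insert v Z ∨ evenVertices m ⊆ insert v Z := by
      by_contra! hc
      exact hnot (isAdmissible_iff.2 ⟨hlt', hind', hc⟩)
    rcases hsub with h | h
    · have heq := eq_of_mem_pathMIS_of_subset (oddVertices_mem_pathMIS (by omega)) h hlt' hind'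
      have hZ' : (oddVertices m).erase v = Z := by rw [heq, Finset.erase_insert hvZ]
      have hvm : v ∈ oddVertices m := heq ▸ Finset.mem_insert_self _ _
      have hv' := mem_oddVertices.1 hvm
      rw [← hZ'] at hmax
      refine Or.inr ⟨v, ⟨hvm, ?_, ?_⟩, hZ'⟩
      · by_contra hc
        exact not_maximal_isAdmissible_erase_odd hm (Or.inl ⟨by omega, rfl⟩) hmax
      · by_contra hc
        exact not_maximal_isAdmissible_erase_odd hm (Or.inr ⟨by omega, rfl⟩) hmax
    · have heq := eq_of_mem_pathMIS_of_subset (evenVertices_mem_pathMIS m) h hlt' hind'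
      exact Or.inl ⟨v, heq ▸ Finset.mem_insert_self _ _, by rw [heq, Finset.erase_insert hvZ]⟩
  · rintro (⟨hodd, heven, hZ⟩ | ⟨v, hv, rfl⟩ | ⟨v, ⟨hv, hv1, hv2⟩, rfl⟩)
    · exact maximal_isAdmissible_of_mem_pathMIS (by omega) hZ hodd heven
    · exact maximal_isAdmissible_erase_even (by omega) hv
    · exact maximal_isAdmissible_erase_odd hv hv1 hv2

theorem ncard_maximal_isAdmissible {m : ℕ} (hm : 2 ≤ m) :
    {Z | Maximal (IsAdmissible m) Z}.ncard + 3 = (pathMIS (2 * m + 1)).card + 2 * m := by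
  have hne : oddVertices m ≠ evenVertices m := fun h => by
    have := mem_evenVertices (m := m) (v := 0)
    rw [← h, mem_oddVertices] at this
    omega
  have hinj : ∀ s : Finset ℕ, Set.InjOn s.erase s := fun s => Finset.erase_injOn s
  have hfilter : ((oddVertices m).filter fun v => 1 < v ∧ v < 2 * m - 1) =
      ((oddVertices m).erase 1).erase (2 * m - 1) := by
    ext v
    simp only [Finset.mem_filter, Finset.mem_erase, mem_oddVertices]
    omega
  have hset : {Z | Maximal (IsAdmissible m) Z} =
      (((pathMIS (2 * m + 1)).erase (evenVertices m)).erase (oddVertices m) ∪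
        ((evenVertices m).image (evenVertices m).erase ∪
        ((oddVertices m).filter fun v => 1 < v ∧ v < 2 * m - 1).image (oddVertices m).erase) :
        Finset (Finset ℕ)) := by
    ext Z
    exact maximal_isAdmissible_iff hm
  have hmem : 2 ≤ (pathMIS (2 * m + 1)).card := by
    have hsub : {oddVertices m, evenVertices m} ⊆ pathMIS (2 * m + 1) :=
      Finset.insert_subset (oddVertices_mem_pathMIS (by omega))
        (Finset.singleton_subset_iff.2 (evenVertices_mem_pathMIS m))
    exact (Finset.card_pair hne).ge.trans (Finset.card_le_card hsub)
  have heven : (evenVertices m).card = m + 1 := by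
    rw [evenVertices, Finset.card_image_of_injective _ (fun a b h => by simpa using h),
      Finset.card_range]
  have hodd : (oddVertices m).card = m := by
    rw [oddVertices, Finset.card_image_of_injective _ (fun a b h => by simpa using h),
      Finset.card_range]
  rw [hset, Set.ncard_coe_finset, Finset.card_union_of_disjoint, Finset.card_union_of_disjoint,
    Finset.card_image_of_injOn (hinj _),
    Finset.card_image_of_injOn ((hinj _).mono (Finset.filter_subset _ _)), hfilter,
    Finset.card_erase_of_mem, Finset.card_erase_of_mem, Finset.card_erase_of_mem,
    Finset.card_erase_of_mem, heven, hodd]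
  · omega
  · exact mem_oddVertices.2 (by omega)
  · exact Finset.mem_erase.2 ⟨by omega, mem_oddVertices.2 (by omega)⟩
  · exact evenVertices_mem_pathMIS m
  · exact Finset.mem_erase.2 ⟨hne, oddVertices_mem_pathMIS (by omega)⟩
  · simp only [Finset.disjoint_left, Finset.mem_image, Finset.mem_filter]
    rintro _ ⟨v, hv, rfl⟩ ⟨w, -, h⟩
    have h0 := Finset.ext_iff.1 h 0
    have h2 := Finset.ext_iff.1 h 2
    simp only [Finset.mem_erase, mem_oddVertices, mem_evenVertices] at h0 h2
    grind
  · have key : ∀ s ∈ pathMIS (2 * m + 1), ∀ v ∈ s, s.erase v ∉ pathMIS (2 * m + 1) :=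
      fun s hs v hv h => Finset.erase_ne_self.2 hv (eq_of_mem_pathMIS_of_subset h
        (Finset.erase_subset _ _) (mem_pathMIS.1 hs).1 (mem_pathMIS.1 hs).2.1)
    simp only [Finset.disjoint_left, Finset.mem_union, Finset.mem_image, Finset.mem_filter,
      Finset.mem_erase]
    rintro _ ⟨-, -, hZ⟩ (⟨v, hv, rfl⟩ | ⟨v, ⟨hv, -⟩, rfl⟩)
    · exact key _ (evenVertices_mem_pathMIS m) v hv hZ
    · exact key _ (oddVertices_mem_pathMIS (by omega)) v hv hZ

namespace OrderMon

variable {m : ℕ}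

theorem ext {n : ℕ} {f g : OrderMon n} (h : ∀ x, f.1 x = g.1 x) : f = g :=
  Subtype.ext (funext h)

/-- The monotone function collapsing `i` and `i + 1` whose range omits exactly `j`. -/
def collapse (i : Fin m) (j : Fin (m + 1)) : OrderMon (m + 1) :=
  ⟨fun x => j.succAbove (i.predAbove x),
    (Fin.strictMono_succAbove j).monotone.comp (Fin.predAbove_right_monotone i)⟩

theorem collapse_apply (i : Fin m) (j x : Fin (m + 1)) :
    (collapse i j).1 x = j.succAbove (i.predAbove x) := rfl

theorem collapse_castSucc (i : Fin m) (j : Fin (m + 1)) :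
    (collapse i j).1 i.castSucc = (collapse i j).1 i.succ := by
  rw [collapse_apply, collapse_apply, (Fin.predAbove_castSucc_eq_succ_iff i i).2 rfl]

theorem collapse_inj {i k : Fin m} {j l : Fin (m + 1)} :
    collapse i j = collapse k l ↔ i = k ∧ j = l := by
  refine ⟨fun h => ?_, by rintro ⟨rfl, rfl⟩; rfl⟩
  have hval (x : Fin (m + 1)) : j.succAbove (i.predAbove x) = l.succAbove (k.predAbove x) :=
    congrFun (congrArg Subtype.val h) x
  have hjl : j = l := by
    by_contra hne
    obtain ⟨y, hy⟩ := Fin.exists_succAbove_eq hne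
    obtain ⟨x, rfl⟩ := Fin.predAbove_surjective k y
    exact Fin.succAbove_ne j _ ((hval x).trans hy)
  subst hjl
  refine ⟨(Fin.predAbove_castSucc_eq_succ_iff k i).1 ?_, rfl⟩
  simp only [Fin.succAbove_right_inj] at hval
  rw [← hval, ← hval, Fin.predAbove_castSucc_eq_succ_iff]

theorem collapse_ne_one (i : Fin m) (j : Fin (m + 1)) : collapse i j ≠ 1 := fun h => by
  have := collapse_castSucc i j
  rw [h] at this
  exact (Fin.castSucc_lt_succ).ne this

theorem collapse_mul_collapse {i k : Fin m} {j : Fin (m + 1)} (l : Fin (m + 1))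
    (h : (j : ℕ) = k ∨ (j : ℕ) = k + 1) : collapse k l * collapse i j = collapse i l := by
  refine ext fun x => ?_
  change l.succAbove (k.predAbove (j.succAbove (i.predAbove x))) = _
  rw [(Fin.predAbove_succAbove_eq_iff k j).2 h]
  rfl

theorem eq_one_iff {n : ℕ} {f : OrderMon n} : f = 1 ↔ f.1 = id := Subtype.ext_iff

theorem mul_eq_one {f g : OrderMon (m + 1)} (h : f * g = 1) : f = 1 ∧ g = 1 := by
  have hg : g = 1 := by
    by_contra hg
    obtain ⟨k, hk⟩ := Fin.exists_apply_castSucc_eq_succ g.2 (mt eq_one_iff.2 hg)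
    have hfg (x : Fin (m + 1)) : f.1 (g.1 x) = x := congrFun (congrArg Subtype.val h) x
    have := hfg k.succ
    rw [← hk, hfg] at this
    exact (Fin.castSucc_lt_succ).ne this
  exact ⟨by simpa [hg] using h, hg⟩

/-- The factorizations of `collapse i l`. -/
theorem mul_eq_collapse {f g : OrderMon (m + 1)} {i : Fin m} {l : Fin (m + 1)}
    (h : f * g = collapse i l) : f = 1 ∨ g = 1 ∨ ∃ (j : Fin (m + 1)) (k : Fin m),
      ((j : ℕ) = k ∨ (j : ℕ) = k + 1) ∧ g = collapse i j ∧ f = collapse k l := by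
  by_contra! hc
  obtain ⟨hf, hg, hne⟩ := hc
  have hfg (x : Fin (m + 1)) : f.1 (g.1 x) = l.succAbove (i.predAbove x) :=
    congrFun (congrArg Subtype.val h) x
  obtain ⟨i', hi'⟩ := Fin.exists_apply_castSucc_eq_succ g.2 (mt eq_one_iff.2 hg)
  obtain rfl : i' = i := by
    rw [← Fin.predAbove_castSucc_eq_succ_iff, ← Fin.succAbove_right_inj (p := l), ← hfg, ← hfg, hi']
  obtain ⟨k, hk⟩ := Fin.exists_apply_castSucc_eq_succ f.2 (mt eq_one_iff.2 hf)
  have hgx := Fin.comp_succAbove_predAbove hi'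
  have hfx := Fin.comp_succAbove_predAbove hk
  have hcancel (y : Fin m) : f.1 (g.1 (i'.castSucc.succAbove y)) = l.succAbove y := by
    rw [hfg, (Fin.predAbove_succAbove_eq_iff i' i'.castSucc).2 (by simp)]
  have hinj : Function.Injective fun y => g.1 (i'.castSucc.succAbove y) := fun y z hyz => by
    rw [← Fin.succAbove_right_inj (p := l), ← hcancel, ← hcancel]
    exact congrArg f.1 hyz
  obtain ⟨j, hj⟩ := Fin.exists_eq_succAbove
    ((g.2.comp (Fin.strictMono_succAbove i'.castSucc).monotone).strictMono_of_injective hinj)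
  have hj' (y : Fin m) : g.1 (i'.castSucc.succAbove y) = j.succAbove y := congrFun hj y
  simp only [hj'] at hgx hcancel
  have hmono : Monotone fun y : Fin m => k.predAbove (j.succAbove y) :=
    (Fin.predAbove_right_monotone k).comp (Fin.strictMono_succAbove j).monotone
  have hinj' : Function.Injective fun y : Fin m => k.predAbove (j.succAbove y) := fun y z hyz => by
    rw [← Fin.succAbove_right_inj (p := l), ← hcancel, ← hcancel, ← hfx, ← hfx (j.succAbove z)]
    exact congrArg (fun t => f.1 (k.castSucc.succAbove t)) hyz
  have hid : (fun y : Fin m => k.predAbove (j.succAbove y)) = id :=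
    ((hmono.strictMono_of_injective hinj').range_inj strictMono_id).1
      (by rw [(Finite.surjective_of_injective hinj').range_eq, Set.range_id])
  have hkj (y : Fin m) : k.predAbove (j.succAbove y) = y := congrFun hid y
  refine hne j k ((Fin.predAbove_succAbove_eq_iff k j).1 hkj) (ext fun x => (hgx x).symm)
    (ext fun x => ?_)
  rw [collapse_apply, ← hcancel, ← hfx (j.succAbove _), hkj, hfx]

theorem eq_top_of_collapse_mem {M : Subsemigroup (OrderMon (m + 1))} (h1 : 1 ∈ M)
    (hM : ∀ i j, collapse i j ∈ M) : M = ⊤ := by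
  rw [Subsemigroup.eq_top_iff']
  intro f
  induction hs : (m + 1 - (Set.range f.1).ncard) using Nat.strong_induction_on generalizing f with
  | _ s ih =>
    by_cases hf : f = 1
    · exact hf ▸ h1
    obtain ⟨g, i, j, hg, hgf, hr⟩ := Fin.exists_monotone_comp f.2 (mt eq_one_iff.2 hf)
    have hlt := Set.ncard_lt_ncard hr
    have hle : (Set.range g).ncard ≤ m + 1 := by
      simpa using Set.ncard_le_ncard (Set.subset_univ (Set.range g))
    have hgM : (⟨g, hg⟩ : OrderMon (m + 1)) ∈ M :=
      ih (m + 1 - (Set.range g).ncard) (by omega) ⟨g, hg⟩ rfl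
    have : f = ⟨g, hg⟩ * collapse i j := ext fun x => (hgf x).symm
    rw [this]
    exact M.mul_mem hgM (hM i j)

/-- The subsemigroup of nonidentity elements. -/
def nonIdentity (m : ℕ) : Subsemigroup (OrderMon (m + 1)) where
  carrier := {f | f ≠ 1}
  mul_mem' := fun hf _ h => hf (mul_eq_one h).1

/-- The functions other than the `collapse i l` with `2 * i + 1` and `2 * l` outside `Z`. -/
def avoidingSet (m : ℕ) (Z : Finset ℕ) : Set (OrderMon (m + 1)) :=
  {f | ∀ (i : Fin m) (l : Fin (m + 1)), f = collapse i l → 2 * (i : ℕ) + 1 ∈ Z ∨ 2 * (l : ℕ) ∈ Z}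

/-- The subsemigroup generated by `avoidingSet m Z`, which is `avoidingSet m Z` itself if `Z` is
independent. -/
def avoiding (m : ℕ) (Z : Finset ℕ) : Subsemigroup (OrderMon (m + 1)) :=
  Subsemigroup.closure (avoidingSet m Z)

theorem mem_avoiding {Z : Finset ℕ} (hZ : ∀ v ∈ Z, v + 1 ∉ Z) {f : OrderMon (m + 1)} :
    f ∈ avoiding m Z ↔ f ∈ avoidingSet m Z := by
  refine ⟨fun h => ?_, fun h => Subsemigroup.subset_closure h⟩
  induction h using Subsemigroup.closure_induction with
  | mem f hf => exact hf
  | mul f g _ _ hf hg =>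
    intro i l h
    rcases mul_eq_collapse h with rfl | rfl | ⟨j, k, hjk, rfl, rfl⟩
    · exact hg i l (by simpa using h)
    · exact hf i l (by simpa using h)
    · have hij := hg i j rfl
      have hkl := hf k l rfl
      rcases hjk with hjk | hjk
      · have := hZ (2 * k)
        grind
      · have := hZ (2 * k + 1)
        grind

theorem collapse_mem_avoiding {Z : Finset ℕ} (hZ : ∀ v ∈ Z, v + 1 ∉ Z) {i : Fin m}
    {l : Fin (m + 1)} :
    collapse i l ∈ avoiding m Z ↔ 2 * (i : ℕ) + 1 ∈ Z ∨ 2 * (l : ℕ) ∈ Z := by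
  rw [mem_avoiding hZ]
  refine ⟨fun h => h i l rfl, fun h k j he => ?_⟩
  obtain ⟨rfl, rfl⟩ := collapse_inj.1 he
  exact h

theorem one_mem_avoiding {Z : Finset ℕ} : 1 ∈ avoiding m Z :=
  Subsemigroup.subset_closure fun i l h => absurd h.symm (collapse_ne_one i l)

theorem avoiding_le_avoiding_iff {Y Z : Finset ℕ} (hY : IsAdmissible m Y)
    (hZ : IsAdmissible m Z) : avoiding m Y ≤ avoiding m Z ↔ Y ≤ Z := by
  refine ⟨fun h v hv => ?_, fun h => Subsemigroup.closure_mono fun f hf i l he => ?_⟩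
  · obtain ⟨-, hindZ, ⟨k, hk, hkZ⟩, j, hj, hjZ⟩ := hZ
    have hvm := hY.1 v hv
    rcases Nat.even_or_odd' v with ⟨c, rfl | rfl⟩
    · exact ((collapse_mem_avoiding hindZ).1 (h ((collapse_mem_avoiding hY.2.1
        (i := ⟨k, hk⟩) (l := ⟨c, by omega⟩)).2 (Or.inr hv)))).resolve_left hkZ
    · exact ((collapse_mem_avoiding hindZ).1 (h ((collapse_mem_avoiding hY.2.1
        (i := ⟨c, by omega⟩) (l := ⟨j, by omega⟩)).2 (Or.inl hv)))).resolve_right hjZ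
  · exact (hf i l he).imp (@h _) (@h _)

theorem avoiding_ne_top {Z : Finset ℕ} (hZ : IsAdmissible m Z) : avoiding m Z ≠ ⊤ := fun h => by
  obtain ⟨-, hind, ⟨k, hk, hkZ⟩, j, hj, hjZ⟩ := hZ
  have : collapse ⟨k, hk⟩ ⟨j, by omega⟩ ∈ avoiding m Z := h ▸ Subsemigroup.mem_top _
  exact ((collapse_mem_avoiding hind).1 this).elim hkZ hjZ

theorem exists_le_avoiding {M : Subsemigroup (OrderMon (m + 1))} (h1 : 1 ∈ M) (hM : M ≠ ⊤) :
    ∃ Z, IsAdmissible m Z ∧ M ≤ avoiding m Z := by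
  classical
  obtain ⟨i, l, hil⟩ : ∃ i l, collapse i l ∉ M := by
    by_contra! h
    exact hM (eq_top_of_collapse_mem h1 h)
  let Z : Finset ℕ := (Finset.range (2 * m + 1)).filter fun v =>
    (∃ j : Fin (m + 1), v = 2 * j ∧ collapse i j ∈ M) ∨
    ∃ k : Fin m, v = 2 * k + 1 ∧ k ≠ i ∧
      ∀ j : Fin (m + 1), collapse i j ∈ M → ¬ ((j : ℕ) = k ∨ (j : ℕ) = k + 1)
  have heven (j : Fin (m + 1)) : 2 * (j : ℕ) ∈ Z ↔ collapse i j ∈ M := by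
    simp only [Z, Finset.mem_filter, Finset.mem_range]
    constructor
    · rintro ⟨-, ⟨j', h, hj'⟩ | ⟨k, h, -⟩⟩
      · obtain rfl : j = j' := Fin.ext (by omega)
        exact hj'
      · omega
    · exact fun h => ⟨by omega, Or.inl ⟨j, rfl, h⟩⟩
  have hodd (k : Fin m) : 2 * (k : ℕ) + 1 ∈ Z ↔ k ≠ i ∧
      ∀ j : Fin (m + 1), collapse i j ∈ M → ¬ ((j : ℕ) = k ∨ (j : ℕ) = k + 1) := by
    simp only [Z, Finset.mem_filter, Finset.mem_range]
    constructor
    · rintro ⟨-, ⟨j', h, hj'⟩ | ⟨k', h, hk'⟩⟩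
      · omega
      · obtain rfl : k = k' := Fin.ext (by omega)
        exact hk'
    · exact fun h => ⟨by omega, Or.inr ⟨k, rfl, h⟩⟩
  have hlt : ∀ v ∈ Z, v < 2 * m + 1 := fun v hv =>
    Finset.mem_range.1 (Finset.mem_filter.1 hv).1
  have hind : ∀ v ∈ Z, v + 1 ∉ Z := fun v hv hv' => by
    have h2 := hlt _ hv'
    rcases Nat.even_or_odd' v with ⟨c, rfl | rfl⟩
    · exact ((hodd ⟨c, by omega⟩).1 hv').2 ⟨c, by omega⟩ ((heven ⟨c, by omega⟩).1 hv) (Or.inl rfl)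
    · exact ((hodd ⟨c, by omega⟩).1 hv).2 ⟨c + 1, by omega⟩ ((heven ⟨c + 1, by omega⟩).1 hv')
        (Or.inr rfl)
  refine ⟨Z, ⟨hlt, hind, ⟨i, i.2, fun h => ((hodd i).1 h).1 rfl⟩,
    l, by omega, fun h => hil ((heven l).1 h)⟩, fun f hf => (mem_avoiding hind).2 ?_⟩
  rintro k j rfl
  by_contra! hc
  rw [heven, hodd] at hc
  obtain ⟨hk, hj⟩ := hc
  by_cases hki : k = i
  · exact hj (hki ▸ hf)
  · obtain ⟨j', hj', hadj⟩ : ∃ j' : Fin (m + 1), collapse i j' ∈ M ∧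
        ((j' : ℕ) = k ∨ (j' : ℕ) = k + 1) := by
      by_contra! h
      exact hk ⟨hki, fun j' hj' => by simpa using h j' hj'⟩
    exact hj (collapse_mul_collapse (i := i) j hadj ▸ M.mul_mem hf hj')

theorem setOf_isCoatom : {M : Subsemigroup (OrderMon (m + 1)) | IsCoatom M} =
    insert (nonIdentity m) (avoiding m '' {Z | Maximal (IsAdmissible m) Z}) := by
  have hnon : nonIdentity m ≠ ⊤ := fun h =>
    (h ▸ Subsemigroup.mem_top _ : (1 : OrderMon (m + 1)) ∈ nonIdentity m) rfl
  have hle_non {M : Subsemigroup (OrderMon (m + 1))} (h : 1 ∉ M) : M ≤ nonIdentity m :=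
    fun f hf hf1 => h (hf1 ▸ hf)
  ext M
  simp only [Set.mem_ofPred_eq, Set.mem_insert_iff, Set.mem_image]
  constructor
  · intro hM
    by_cases h1 : 1 ∈ M
    · obtain ⟨Z, hZ, hMZ⟩ := exists_le_avoiding h1 hM.1
      have hMZ : M = avoiding m Z := (hM.le_iff.1 hMZ).resolve_left (avoiding_ne_top hZ) |>.symm
      refine Or.inr ⟨Z, ⟨hZ, fun Y hY hle => ?_⟩, hMZ.symm⟩
      have hZY := (avoiding_le_avoiding_iff hZ hY).2 hle
      have := (hM.le_iff.1 (hMZ ▸ hZY)).resolve_left (avoiding_ne_top hY)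
      exact (avoiding_le_avoiding_iff hY hZ).1 (this.trans hMZ).le
    · exact Or.inl ((hM.le_iff.1 (hle_non h1)).resolve_left hnon).symm
  · rintro (rfl | ⟨Z, hZ, rfl⟩)
    · refine ⟨hnon, fun N hN => ?_⟩
      obtain ⟨hle, f, hfN, hf⟩ := SetLike.lt_iff_le_and_exists.1 hN
      obtain rfl : f = 1 := not_not.1 hf
      exact eq_top_of_collapse_mem hfN fun i j => hle (collapse_ne_one i j)
    · refine ⟨avoiding_ne_top hZ.prop, fun N hN => ?_⟩
      by_contra hNtop
      obtain ⟨Y, hY, hNY⟩ := exists_le_avoiding (hN.le one_mem_avoiding) hNtop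
      have hYZ := hZ.2 hY ((avoiding_le_avoiding_iff hZ.prop hY).1 (hN.le.trans hNY))
      exact (hN.trans_le (hNY.trans ((avoiding_le_avoiding_iff hY hZ.prop).2 hYZ))).ne rfl

theorem ncard_setOf_isCoatom (hm : 2 ≤ m) :
    {M : Subsemigroup (OrderMon (m + 1)) | IsCoatom M}.ncard + 2 =
      (pathMIS (2 * m + 1)).card + 2 * m := by
  have hfin : {Z | Maximal (IsAdmissible m) Z}.Finite :=
    (Finset.finite_toSet _).subset fun Z hZ => (maximal_isAdmissible_iff hm).1 hZ
  rw [setOf_isCoatom, Set.ncard_insert_of_notMem _ (hfin.image _),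
    Set.InjOn.ncard_image, ← ncard_maximal_isAdmissible hm]
  · intro Y hY Z hZ h
    exact le_antisymm ((avoiding_le_avoiding_iff hY.prop hZ.prop).1 h.le)
      ((avoiding_le_avoiding_iff hZ.prop hY.prop).1 h.ge)
  · rintro ⟨Z, -, h⟩
    have h1 : (1 : OrderMon (m + 1)) ∈ nonIdentity m := h ▸ one_mem_avoiding
    exact h1 rfl

end OrderMon

theorem count_maximal_subsemigroups_of_order_preserving_transformation_monoid
    (A : ℕ → ℕ) (hA1 : A 1 = 1) (hA2 : A 2 = 2) (hA3 : A 3 = 2)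
    (hArec : ∀ k, 4 ≤ k → A k = A (k - 2) + A (k - 3))
    (n : ℕ) (hn : 3 ≤ n) :
    Set.ncard {M : Subsemigroup (OrderMon n) | IsCoatom M} =
      A (2 * n - 1) + 2 * n - 4 := by
  obtain ⟨m, rfl⟩ : ∃ m, n = m + 1 := ⟨n - 1, by omega⟩
  have h := OrderMon.ncard_setOf_isCoatom (m := m) (by omega)
  rw [card_pathMIS A hA1 hA2 hA3 hArec _ (by omega)] at h
  rw [show 2 * (m + 1) - 1 = 2 * m + 1 by omega]
  omega
end

section
/- Let A : ℕ → ℕ be any function with A 1 = 1, A 2 = 2, A 3 = 2, and A k = A (k−2) + A (k−3) for all k ≥ 4. For every n ≥ 4, the number of maximal subsemigroups of the monoid OD_n of all functions f : Fin n → Fin n that are monotone or antitone, under composition, equals A n + n − 3. -/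
/-- The monoid of order-preserving or order-reversing transformations of
`Fin n`, as a submonoid of `Function.End (Fin n)` (composition). -/
def OrderRevMon (n : ℕ) : Submonoid (Function.End (Fin n)) where
  carrier := {f | Monotone f ∨ Antitone f}
  one_mem' := Or.inl monotone_id
  mul_mem' := by
    rintro f g (hf | hf) (hg | hg)
    · exact Or.inl (hf.comp hg)
    · exact Or.inr (hf.comp_antitone hg)
    · exact Or.inr (hf.comp_monotone hg)
    · exact Or.inl (hf.comp hg)

section PathIndependence

open Finset

/-- The vertex sets of the path `0 - 1 - ⋯ - (n - 1)` that are independent and dominating,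
i.e. the maximal independent sets of that path. -/
def pathMaxIndep (n : ℕ) : Finset (Finset ℕ) :=
  (range n).powerset.filter fun D =>
    (∀ i ∈ D, i + 1 ∉ D) ∧ ∀ i < n, i ∈ D ∨ i + 1 ∈ D ∨ (i ≠ 0 ∧ i - 1 ∈ D)

theorem mem_pathMaxIndep {n : ℕ} {D : Finset ℕ} :
    D ∈ pathMaxIndep n ↔ (∀ i ∈ D, i < n) ∧ (∀ i ∈ D, i + 1 ∉ D) ∧
      ∀ i < n, i ∈ D ∨ i + 1 ∈ D ∨ (i ≠ 0 ∧ i - 1 ∈ D) := by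
  simp [pathMaxIndep, subset_iff]

theorem insert_mem_pathMaxIndep_add_two {n : ℕ} {D : Finset ℕ} (hD : D ∈ pathMaxIndep n) :
    insert (n + 1) D ∈ pathMaxIndep (n + 2) := by
  rw [mem_pathMaxIndep] at hD ⊢
  obtain ⟨hlt, hind, hdom⟩ := hD
  refine ⟨?_, ?_, ?_⟩ <;> grind

theorem insert_mem_pathMaxIndep_add_three {n : ℕ} {D : Finset ℕ} (hD : D ∈ pathMaxIndep n) :
    insert (n + 1) D ∈ pathMaxIndep (n + 3) := by
  rw [mem_pathMaxIndep] at hD ⊢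
  obtain ⟨hlt, hind, hdom⟩ := hD
  refine ⟨?_, ?_, ?_⟩ <;> grind

theorem erase_mem_pathMaxIndep {n : ℕ} {D : Finset ℕ} (hD : D ∈ pathMaxIndep (n + 3)) :
    (n + 2 ∈ D ∧ D.erase (n + 2) ∈ pathMaxIndep (n + 1)) ∨
      (n + 1 ∈ D ∧ D.erase (n + 1) ∈ pathMaxIndep n) := by
  simp only [mem_pathMaxIndep] at hD ⊢
  obtain ⟨hlt, hind, hdom⟩ := hD
  by_cases h : n + 2 ∈ D
  · refine Or.inl ⟨h, by grind, by grind, fun i hi => ?_⟩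
    rcases hdom i (by omega) with h | h | ⟨h0, h⟩
    · exact Or.inl (mem_erase.2 ⟨by omega, h⟩)
    · exact Or.inr (Or.inl (mem_erase.2 ⟨by omega, h⟩))
    · exact Or.inr (Or.inr ⟨h0, mem_erase.2 ⟨by omega, h⟩⟩)
  · have h1 : n + 1 ∈ D := by grind
    refine Or.inr ⟨h1, by grind, by grind, fun i hi => ?_⟩
    rcases hdom i (by omega) with h | h | ⟨h0, h⟩
    · exact Or.inl (mem_erase.2 ⟨by omega, h⟩)
    · exact Or.inr (Or.inl (mem_erase.2 ⟨by omega, h⟩))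
    · exact Or.inr (Or.inr ⟨h0, mem_erase.2 ⟨by omega, h⟩⟩)

theorem card_pathMaxIndep_add_three (n : ℕ) :
    (pathMaxIndep (n + 3)).card = (pathMaxIndep (n + 1)).card + (pathMaxIndep n).card := by
  have hsplit : pathMaxIndep (n + 3) =
      (pathMaxIndep (n + 1)).image (insert (n + 2)) ∪ (pathMaxIndep n).image (insert (n + 1)) := by
    ext D
    simp only [mem_union, mem_image]
    constructor
    · intro hD
      rcases erase_mem_pathMaxIndep hD with ⟨h, h'⟩ | ⟨h, h'⟩
      · exact Or.inl ⟨_, h', insert_erase h⟩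
      · exact Or.inr ⟨_, h', insert_erase h⟩
    · rintro (⟨E, hE, rfl⟩ | ⟨E, hE, rfl⟩)
      · exact insert_mem_pathMaxIndep_add_two hE
      · exact insert_mem_pathMaxIndep_add_three hE
  have hinj (k l : ℕ) (hkl : k ≤ l) :
      Set.InjOn (insert l : Finset ℕ → Finset ℕ) (pathMaxIndep k) := by
    intro E hE F hF h
    have hE' := (mem_pathMaxIndep.1 hE).1
    have hF' := (mem_pathMaxIndep.1 hF).1
    have hlE : l ∉ E := fun h => by have := hE' _ h; omega
    have hlF : l ∉ F := fun h => by have := hF' _ h; omega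
    rw [← erase_insert hlE, ← erase_insert hlF, h]
  rw [hsplit, card_union_of_disjoint, card_image_of_injOn (hinj _ _ (by omega)),
    card_image_of_injOn (hinj _ _ (by omega))]
  rw [disjoint_left]
  simp only [mem_image, not_exists, not_and]
  rintro _ ⟨E, hE, rfl⟩ F hF h
  have hF' := (mem_pathMaxIndep.1 hF).1
  have hmem : n + 2 ∈ insert (n + 1) F := h ▸ mem_insert_self _ _
  grind

theorem card_pathMaxIndep_eq {A : ℕ → ℕ} (hA1 : A 1 = 1) (hA2 : A 2 = 2) (hA3 : A 3 = 2)
    (hArec : ∀ k, 4 ≤ k → A k = A (k - 2) + A (k - 3)) (n : ℕ) (hn : 1 ≤ n) :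
    (pathMaxIndep n).card = A n := by
  induction n using Nat.strong_induction_on with
  | _ n ih =>
    obtain rfl | rfl | rfl | h4 : n = 1 ∨ n = 2 ∨ n = 3 ∨ 4 ≤ n := by omega
    · rw [hA1]; decide
    · rw [hA2]; decide
    · rw [hA3]; decide
    · obtain ⟨k, rfl⟩ : ∃ k, n = k + 3 := ⟨n - 3, by omega⟩
      rw [card_pathMaxIndep_add_three, hArec _ h4, ih (k + 1) (by omega) (by omega),
        ih k (by omega) (by omega)]
      rfl

/-- Independent sets of the path `0 - 1 - ⋯ - (n - 1)` containing neither all the even vertices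
nor all the odd vertices. -/
def PathMixedIndep (n : ℕ) (D : Finset ℕ) : Prop :=
  (∀ i ∈ D, i < n) ∧ (∀ i ∈ D, i + 1 ∉ D) ∧
    (∃ v < n, v % 2 = 0 ∧ v ∉ D) ∧ ∃ v < n, v % 2 = 1 ∧ v ∉ D

/-- The vertices below `n` with the same parity as `v`. -/
def parityClass (n v : ℕ) : Finset ℕ := (range n).filter fun u => u % 2 = v % 2

theorem mem_parityClass {n v u : ℕ} : u ∈ parityClass n v ↔ u < n ∧ u % 2 = v % 2 := by
  simp [parityClass]

theorem parityClass_mem_pathMaxIndep {n v : ℕ} (hn : 2 ≤ n) :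
    parityClass n v ∈ pathMaxIndep n := by
  simp only [mem_pathMaxIndep, mem_parityClass]
  refine ⟨fun i hi => hi.1, fun i hi => by omega, fun i hi => by omega⟩

theorem eq_parityClass_of_subset {n v : ℕ} {D : Finset ℕ}
    (hlt : ∀ i ∈ D, i < n) (hind : ∀ i ∈ D, i + 1 ∉ D) (hn : 2 ≤ n)
    (hsub : parityClass n v ⊆ D) : D = parityClass n v := by
  refine Subset.antisymm (fun u hu => ?_) hsub
  have hun := hlt u hu
  rw [mem_parityClass]
  refine ⟨hun, ?_⟩
  by_contra hne
  by_cases hu' : u + 1 < n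
  · exact hind u hu (hsub (mem_parityClass.2 ⟨hu', by omega⟩))
  · have := hind (u - 1) (hsub (mem_parityClass.2 ⟨by omega, by omega⟩))
    rw [Nat.sub_add_cancel (by omega)] at this
    exact this hu

theorem pathMixedIndep_iff {n : ℕ} {D : Finset ℕ} :
    PathMixedIndep n D ↔ (∀ i ∈ D, i < n) ∧ (∀ i ∈ D, i + 1 ∉ D) ∧
      ∀ v, ¬ parityClass n v ⊆ D := by
  unfold PathMixedIndep
  simp only [subset_iff, mem_parityClass]
  constructor
  · rintro ⟨h1, h2, ⟨v, hv⟩, w, hw⟩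
    refine ⟨h1, h2, fun u hu => ?_⟩
    rcases Nat.mod_two_eq_zero_or_one u with h | h
    · exact hv.2.2 (hu ⟨hv.1, by omega⟩)
    · exact hw.2.2 (hu ⟨hw.1, by omega⟩)
  · rintro ⟨h1, h2, h⟩
    refine ⟨h1, h2, ?_, ?_⟩
    · have := h 0; push Not at this; simpa [and_assoc] using this
    · have := h 1; push Not at this; simpa [and_assoc] using this

theorem maximal_of_mem_pathMaxIndep {n : ℕ} {D : Finset ℕ} (hn : 2 ≤ n)
    (hD : D ∈ pathMaxIndep n) (hpar : ∀ v, D ≠ parityClass n v) :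
    Maximal (PathMixedIndep n) D := by
  rw [mem_pathMaxIndep] at hD
  obtain ⟨hlt, hind, hdom⟩ := hD
  refine ⟨pathMixedIndep_iff.2 ⟨hlt, hind, fun v hv =>
    hpar v (eq_parityClass_of_subset hlt hind hn hv)⟩, fun E hE hDE u hu => ?_⟩
  obtain ⟨hEl, hEi, -⟩ := hE
  rcases hdom u (hEl u hu) with h | h | ⟨h0, h⟩
  · exact h
  · exact absurd (hDE h) (hEi u hu)
  · exact absurd (by rwa [Nat.sub_add_cancel (by omega)]) (hEi _ (hDE h))

theorem maximal_parityClass_erase {n v : ℕ} (hn : 4 ≤ n) (hv : v < n) (hv1 : v ≠ 1)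
    (hv2 : v ≠ n - 2) : Maximal (PathMixedIndep n) ((parityClass n v).erase v) := by
  constructor
  · rw [pathMixedIndep_iff]
    refine ⟨fun i hi => (mem_parityClass.1 (mem_of_mem_erase hi)).1, fun i hi hi' => ?_,
      fun w hw => ?_⟩
    · have h1 := (mem_parityClass.1 (mem_of_mem_erase hi)).2
      have h2 := (mem_parityClass.1 (mem_of_mem_erase hi')).2
      omega
    · have h0 := hw (mem_parityClass.2 (⟨by omega, by omega⟩ : w % 2 < n ∧ _))
      rw [mem_erase, mem_parityClass] at h0
      have h1 := hw (mem_parityClass.2 (⟨hv, by omega⟩ : v < n ∧ _))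
      simp at h1
  · intro E hE hDE u hu
    obtain ⟨hEl, hEi, hEp⟩ := pathMixedIndep_iff.1 hE
    have hun := hEl u hu
    have hmem (w : ℕ) (hw : w < n) (hwv : w ≠ v) (hp : w % 2 = v % 2) : w ∈ E :=
      hDE (mem_erase.2 ⟨hwv, mem_parityClass.2 ⟨hw, hp⟩⟩)
    rw [mem_erase, mem_parityClass]
    by_cases hp : u % 2 = v % 2
    · refine ⟨?_, hun, hp⟩
      rintro rfl
      refine hEp u fun w hw => ?_
      rw [mem_parityClass] at hw
      by_cases hwu : w = u
      · exact hwu ▸ hu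
      · exact hmem w hw.1 hwu hw.2
    · exfalso
      by_cases hu1 : u + 1 < n ∧ u + 1 ≠ v
      · exact hEi u hu (hmem _ hu1.1 hu1.2 (by omega))
      · have h := hEi (u - 1) (hmem _ (by omega) (by omega) (by omega))
        rw [Nat.sub_add_cancel (by omega)] at h
        exact h hu

theorem mem_or_eq_of_maximal {n : ℕ} {D : Finset ℕ} (hn : 4 ≤ n)
    (hD : Maximal (PathMixedIndep n) D) :
    (D ∈ pathMaxIndep n ∧ ∀ v, D ≠ parityClass n v) ∨
      ∃ v, (v < n ∧ v ≠ 1 ∧ v ≠ n - 2) ∧ (parityClass n v).erase v = D := by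
  obtain ⟨hlt, hind, hpar⟩ := pathMixedIndep_iff.1 hD.prop
  by_cases hdom : ∀ i < n, i ∈ D ∨ i + 1 ∈ D ∨ (i ≠ 0 ∧ i - 1 ∈ D)
  · exact Or.inl ⟨mem_pathMaxIndep.2 ⟨hlt, hind, hdom⟩, fun v hv => hpar v hv.ge⟩
  · push Not at hdom
    obtain ⟨v, hvn, hv, hv1, hv2⟩ := hdom
    -- adding the undominated vertex `v` keeps independence, so it must complete a parity class
    have hins : ∃ w, parityClass n w ⊆ insert v D := by
      by_contra! h
      have : PathMixedIndep n (insert v D) := by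
        rw [pathMixedIndep_iff]
        refine ⟨by grind, ?_, h⟩
        grind
      exact hv (hD.le_of_ge this (subset_insert v D) (mem_insert_self v D))
    obtain ⟨w, hw⟩ := hins
    have hvw : v % 2 = w % 2 := by
      by_contra hne
      refine hpar w fun u hu => ?_
      have := hw hu
      rw [mem_insert] at this
      rcases this with rfl | h
      · exact absurd (mem_parityClass.1 hu).2 hne
      · exact h
    have hcls : insert v D = parityClass n v := by
      refine eq_parityClass_of_subset (by grind) (by grind) (by omega) fun u hu => hw ?_
      rw [mem_parityClass] at hu ⊢
      omega
    have hDv : (parityClass n v).erase v = D := by rw [← hcls, erase_insert hv]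
    refine Or.inr ⟨v, ⟨hvn, ?_, ?_⟩, hDv⟩
    · rintro rfl
      have hmix : PathMixedIndep n (insert 0 D) := by
        rw [pathMixedIndep_iff, ← hDv]
        refine ⟨by grind [mem_parityClass], by grind [mem_parityClass], fun u hu => ?_⟩
        rcases Nat.mod_two_eq_zero_or_one u with h | h
        · have := hu (mem_parityClass.2 (⟨by omega, by omega⟩ : 2 < n ∧ _))
          simp [mem_parityClass] at this
        · have := hu (mem_parityClass.2 (⟨by omega, by omega⟩ : 1 < n ∧ _))
          simp at this
      have := hD.le_of_ge hmix (subset_insert 0 D) (mem_insert_self 0 D)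
      simp [← hDv, mem_parityClass] at this
    · rintro rfl
      have hmix : PathMixedIndep n (insert (n - 1) D) := by
        rw [pathMixedIndep_iff, ← hDv]
        refine ⟨by grind [mem_parityClass], by grind [mem_parityClass], fun u hu => ?_⟩
        by_cases h : u % 2 = n % 2
        · have := hu (mem_parityClass.2 (⟨by omega, by omega⟩ : n - 2 < n ∧ _))
          simp at this
          omega
        · have := hu (mem_parityClass.2 (⟨by omega, by omega⟩ : n - 3 < n ∧ _))
          simp [mem_parityClass] at this
          omega
      have := hD.le_of_ge hmix (subset_insert _ D) (mem_insert_self _ D)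
      simp [← hDv, mem_parityClass] at this
      omega

theorem ncard_maximal_pathMixedIndep {n : ℕ} (hn : 4 ≤ n) :
    {D | Maximal (PathMixedIndep n) D}.ncard + 4 = (pathMaxIndep n).card + n := by
  have hset : {D | Maximal (PathMixedIndep n) D} =
      ((((pathMaxIndep n).erase (parityClass n 0)).erase (parityClass n 1) ∪
        (((range n).erase 1).erase (n - 2)).image fun v => (parityClass n v).erase v :
          Finset (Finset ℕ)) : Set (Finset ℕ)) := by
    have hcls (v : ℕ) : parityClass n v = parityClass n 0 ∨ parityClass n v = parityClass n 1 := by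
      rcases Nat.mod_two_eq_zero_or_one v with h | h
      · exact Or.inl (by simp [parityClass, h])
      · exact Or.inr (by simp [parityClass, h])
    ext D
    simp only [Set.mem_ofPred_eq, coe_union, Set.mem_union, mem_coe, mem_erase, mem_image, mem_range]
    constructor
    · intro hD
      rcases mem_or_eq_of_maximal hn hD with ⟨h, h'⟩ | ⟨v, hv, rfl⟩
      · exact Or.inl ⟨h' 1, h' 0, h⟩
      · exact Or.inr ⟨v, ⟨hv.2.2, hv.2.1, hv.1⟩, rfl⟩
    · rintro (⟨h1, h0, h⟩ | ⟨v, hv, rfl⟩)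
      · refine maximal_of_mem_pathMaxIndep (by omega) h fun v => ?_
        rcases hcls v with hv | hv <;> rwa [hv]
      · exact maximal_parityClass_erase hn hv.2.2 hv.2.1 hv.1
  have hne : parityClass n 1 ≠ parityClass n 0 := fun h => by
    have : 1 ∈ parityClass n 0 := h ▸ mem_parityClass.2 ⟨by omega, rfl⟩
    simp [mem_parityClass] at this
  have hcard1 := card_erase_add_one (parityClass_mem_pathMaxIndep (n := n) (v := 0) (by omega))
  have hcard2 := card_erase_add_one
    (mem_erase.2 ⟨hne, parityClass_mem_pathMaxIndep (n := n) (v := 1) (by omega)⟩)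
  have hcard3 : (((range n).erase 1).erase (n - 2)).card + 2 = n := by
    rw [card_erase_of_mem (by simp; omega), card_erase_of_mem (by simp; omega), card_range]
    omega
  rw [hset, Set.ncard_coe_finset, card_union_of_disjoint, card_image_of_injOn]
  · omega
  · intro v hv w hw hvw
    simp only [coe_erase, coe_range, Set.mem_sdiff, Set.mem_Iio, Set.mem_singleton_iff] at hv hw
    have hmem (u : ℕ) := Finset.ext_iff.1 hvw u
    simp only [mem_erase, mem_parityClass] at hmem
    have h1 := hmem v
    have h2 := hmem w
    have h3 := hmem (v % 2)
    have h4 := hmem (v % 2 + 2)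
    omega
  · rw [disjoint_left]
    rintro D hD hD'
    obtain ⟨v, hv, rfl⟩ := mem_image.1 hD'
    have hdom := (mem_pathMaxIndep.1 (mem_of_mem_erase (mem_of_mem_erase hD))).2.2 v
      (by simp at hv; omega)
    simp only [mem_erase, mem_parityClass] at hdom
    omega

end PathIndependence

namespace OrderRevMon

variable {m : ℕ}

/-- The order-reversing permutation of `Fin (m + 1)`. -/
def reversal (m : ℕ) : OrderRevMon (m + 1) := ⟨Fin.rev, Or.inr Fin.rev_anti⟩

/-- The order-preserving map of rank `m` that identifies `i` with `i + 1` and misses `j`. -/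
def collapse (i : Fin m) (j : Fin (m + 1)) : OrderRevMon (m + 1) :=
  ⟨fun x => j.succAbove (i.predAbove x),
    Or.inl ((Fin.strictMono_succAbove j).monotone.comp (Fin.predAbove_right_monotone i))⟩

theorem ext_apply {n : ℕ} {x y : OrderRevMon n} (h : ∀ t, x.1 t = y.1 t) : x = y :=
  Subtype.ext (funext h)

theorem mul_apply {n : ℕ} (x y : OrderRevMon n) (t : Fin n) : (x * y).1 t = x.1 (y.1 t) := rfl

theorem reversal_apply (t : Fin (m + 1)) : (reversal m).1 t = t.rev := rfl

theorem collapse_apply (i : Fin m) (j t : Fin (m + 1)) :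
    (collapse i j).1 t = j.succAbove (i.predAbove t) := rfl

theorem reversal_mul_reversal : reversal m * reversal m = 1 :=
  ext_apply fun t => Fin.rev_rev t

theorem reversal_mul_reversal_mul (x : OrderRevMon (m + 1)) :
    reversal m * (reversal m * x) = x := by
  rw [← mul_assoc, reversal_mul_reversal, one_mul]

theorem mul_reversal_mul_reversal (x : OrderRevMon (m + 1)) :
    x * reversal m * reversal m = x := by
  rw [mul_assoc, reversal_mul_reversal, mul_one]

theorem collapse_mul_reversal (i : Fin m) (j : Fin (m + 1)) :
    collapse i j * reversal m = reversal m * collapse i.rev j.rev :=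
  ext_apply fun t => by
    simp only [mul_apply, reversal_apply, collapse_apply, Fin.rev_succAbove, Fin.rev_predAbove,
      Fin.rev_rev]

theorem reversal_mul_collapse_mul_reversal (i : Fin m) (j : Fin (m + 1)) :
    reversal m * collapse i j * reversal m = collapse i.rev j.rev := by
  rw [mul_assoc, collapse_mul_reversal, reversal_mul_reversal_mul]

/-- `Adj i j` says that `collapse i j` is idempotent: `j` is one of the two points identified by
`i`. -/
def Adj (i : Fin m) (j : Fin (m + 1)) : Prop := j = i.castSucc ∨ j = i.succ

theorem Adj.rev {i : Fin m} {j : Fin (m + 1)} (h : Adj i j) : Adj i.rev j.rev := by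
  rcases h with rfl | rfl
  · exact Or.inr (Fin.rev_castSucc i)
  · exact Or.inl (Fin.rev_succ i)

theorem predAbove_succAbove_of_adj {i : Fin m} {j : Fin (m + 1)} (h : Adj i j) (t : Fin m) :
    i.predAbove (j.succAbove t) = t := by
  rcases h with rfl | rfl
  · exact Fin.predAbove_succAbove i t
  · exact Fin.succAbove_right_injective (Fin.succ_succAbove_predAbove (Fin.succAbove_ne _ _))

theorem collapse_mul_collapse {i k : Fin m} {j l : Fin (m + 1)} (h : Adj i l) :
    collapse i j * collapse k l = collapse k j :=
  ext_apply fun t => by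
    simp only [mul_apply, collapse_apply, predAbove_succAbove_of_adj h]

theorem predAbove_eq_iff {i : Fin m} {s t : Fin (m + 1)} (hst : s < t) :
    i.predAbove s = i.predAbove t ↔ s = i.castSucc ∧ t = i.succ := by
  constructor
  · intro h
    have hst' := Fin.lt_def.1 hst
    rw [Fin.ext_iff] at h
    rw [Fin.ext_iff, Fin.ext_iff, Fin.val_castSucc, Fin.val_succ]
    rcases le_or_gt s i.castSucc with hs | hs <;> rcases le_or_gt t i.castSucc with ht | ht
    · rw [Fin.predAbove_of_le_castSucc _ _ hs, Fin.predAbove_of_le_castSucc _ _ ht,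
        Fin.coe_castPred, Fin.coe_castPred] at h
      omega
    · rw [Fin.predAbove_of_le_castSucc _ _ hs, Fin.predAbove_of_castSucc_lt _ _ ht,
        Fin.coe_castPred, Fin.val_pred] at h
      rw [Fin.le_def, Fin.val_castSucc] at hs
      rw [Fin.lt_def, Fin.val_castSucc] at ht
      omega
    · exact absurd (hs.trans hst) (not_lt.2 ht)
    · rw [Fin.predAbove_of_castSucc_lt _ _ hs, Fin.predAbove_of_castSucc_lt _ _ ht,
        Fin.val_pred, Fin.val_pred] at h
      rw [Fin.lt_def, Fin.val_castSucc] at hs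
      omega
  · rintro ⟨rfl, rfl⟩
    simp

theorem collapse_apply_eq_iff {i : Fin m} {j s t : Fin (m + 1)} (hst : s < t) :
    (collapse i j).1 s = (collapse i j).1 t ↔ s = i.castSucc ∧ t = i.succ := by
  rw [collapse_apply, collapse_apply, Fin.succAbove_right_inj, predAbove_eq_iff hst]

theorem exists_collapse_apply_eq_iff {i : Fin m} {j t : Fin (m + 1)} :
    (∃ s, (collapse i j).1 s = t) ↔ t ≠ j := by
  constructor
  · rintro ⟨s, rfl⟩
    exact Fin.succAbove_ne _ _
  · intro h
    obtain ⟨u, rfl⟩ := Fin.exists_succAbove_eq h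
    exact ⟨i.castSucc.succAbove u, by rw [collapse_apply, Fin.predAbove_succAbove]⟩

/-- `x` is a map of rank `m` identifying `i` and `i + 1`, with image the complement of `j` or of
the mirror image of `j`. -/
def IsCollapse (x : OrderRevMon (m + 1)) (i : Fin m) (j : Fin (m + 1)) : Prop :=
  x = collapse i j ∨ x = reversal m * collapse i j

theorem IsCollapse.apply_eq_iff {x : OrderRevMon (m + 1)} {i : Fin m} {j s t : Fin (m + 1)}
    (h : IsCollapse x i j) (hst : s < t) : x.1 s = x.1 t ↔ s = i.castSucc ∧ t = i.succ := by
  rw [← collapse_apply_eq_iff (j := j) hst]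
  rcases h with rfl | rfl
  · rfl
  · rw [mul_apply, mul_apply, reversal_apply, reversal_apply, Fin.rev_inj]

theorem IsCollapse.eq_left {x : OrderRevMon (m + 1)} {i k : Fin m} {j l : Fin (m + 1)}
    (h : IsCollapse x i j) (h' : IsCollapse x k l) : i = k :=
  Fin.castSucc_injective m
    ((h'.apply_eq_iff Fin.castSucc_lt_succ).1
      ((h.apply_eq_iff Fin.castSucc_lt_succ).2 ⟨rfl, rfl⟩)).1

theorem IsCollapse.eq_or_eq_rev {x : OrderRevMon (m + 1)} {i k : Fin m} {j l : Fin (m + 1)}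
    (h : IsCollapse x i j) (h' : IsCollapse x k l) : j = l ∨ j = l.rev := by
  have key {x : OrderRevMon (m + 1)} {i : Fin m} {j : Fin (m + 1)} (h : IsCollapse x i j) :
      (∀ s, x.1 s ≠ j) ∨ ∀ s, x.1 s ≠ j.rev := by
    rcases h with rfl | rfl
    · exact Or.inl fun s => Fin.succAbove_ne _ _
    · refine Or.inr fun s hs => ?_
      exact Fin.succAbove_ne _ _ (Fin.rev_injective hs)
  have key' {x : OrderRevMon (m + 1)} {i : Fin m} {j t : Fin (m + 1)} (h : IsCollapse x i j)
      (ht : ∀ s, x.1 s ≠ t) : t = j ∨ t = j.rev := by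
    rcases h with rfl | rfl
    · left
      by_contra hne
      obtain ⟨s, hs⟩ := exists_collapse_apply_eq_iff.2 hne
      exact ht s hs
    · right
      by_contra hne
      obtain ⟨s, hs⟩ := (exists_collapse_apply_eq_iff (i := i) (j := j) (t := t.rev)).2
        fun h => hne (by rw [← h, Fin.rev_rev])
      exact ht s (by rw [mul_apply, hs, reversal_apply, Fin.rev_rev])
  rcases key h with hj | hj
  · exact key' h' hj
  · rcases key' h' hj with h | h
    · exact Or.inr (by rw [← h, Fin.rev_rev])
    · exact Or.inl (Fin.rev_injective h)

theorem adj_of_isCollapse_mul {i k p : Fin m} {j l q : Fin (m + 1)}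
    (h : IsCollapse (collapse i j * collapse k l) p q) : Adj i l := by
  by_contra hadj
  simp only [Adj, not_or] at hadj
  obtain ⟨s, hs⟩ := (exists_collapse_apply_eq_iff (i := k)).2 (Ne.symm hadj.1)
  obtain ⟨t, ht⟩ := (exists_collapse_apply_eq_iff (i := k)).2 (Ne.symm hadj.2)
  have hst : s < t := by
    by_contra! hle
    have hmono : Monotone (collapse k l).1 :=
      (Fin.strictMono_succAbove l).monotone.comp (Fin.predAbove_right_monotone k)
    have := hmono hle
    rw [hs, ht] at this
    exact absurd this (not_le.2 Fin.castSucc_lt_succ)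
  have hpk : p = k := by
    refine Fin.castSucc_injective m ((h.apply_eq_iff Fin.castSucc_lt_succ).1 ?_).1.symm
    rw [mul_apply, mul_apply, (collapse_apply_eq_iff Fin.castSucc_lt_succ).2 ⟨rfl, rfl⟩]
  have heq := (h.apply_eq_iff hst).1 (by
    rw [mul_apply, mul_apply, hs, ht]
    exact (collapse_apply_eq_iff Fin.castSucc_lt_succ).2 ⟨rfl, rfl⟩)
  rw [hpk] at heq
  have := (collapse_apply_eq_iff (i := k) (j := l) hst).2 heq
  rw [hs, ht] at this
  exact absurd this (Fin.castSucc_lt_succ).ne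

/-- The rank of a transformation: the size of its image. -/
noncomputable def rank {n : ℕ} (x : OrderRevMon n) : ℕ := (Set.range x.1).ncard

theorem rank_mul_le_left {n : ℕ} (x y : OrderRevMon n) : rank (x * y) ≤ rank x := by
  refine Set.ncard_le_ncard ?_ (Set.toFinite _)
  rintro _ ⟨t, rfl⟩
  exact ⟨y.1 t, rfl⟩

theorem rank_mul_le_right {n : ℕ} (x y : OrderRevMon n) : rank (x * y) ≤ rank y := by
  have : Set.range (x * y).1 = x.1 '' Set.range y.1 := Set.range_comp x.1 y.1
  rw [rank, this]
  exact Set.ncard_image_le (Set.toFinite _)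

theorem rank_reversal_mul (x : OrderRevMon (m + 1)) : rank (reversal m * x) = rank x := by
  refine le_antisymm (rank_mul_le_right _ _) ?_
  conv_lhs => rw [← reversal_mul_reversal_mul x]
  exact rank_mul_le_right _ _

theorem IsCollapse.rank_eq {x : OrderRevMon (m + 1)} {i : Fin m} {j : Fin (m + 1)}
    (h : IsCollapse x i j) : rank x = m := by
  have hc : rank (collapse i j) = m := by
    have : Set.range (collapse i j).1 = {j}ᶜ := by
      ext t
      exact exists_collapse_apply_eq_iff
    rw [rank, this, Set.ncard_compl]
    simp
  rcases h with rfl | rfl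
  · exact hc
  · rw [rank_reversal_mul, hc]

theorem exists_castSucc_eq_succ {f : Fin (m + 1) → Fin (m + 1)} (hf : Monotone f)
    (hinj : ¬ Function.Injective f) : ∃ i : Fin m, f i.castSucc = f i.succ := by
  by_contra! h
  exact hinj (Fin.strictMono_iff_lt_succ.2 fun i =>
    lt_of_le_of_ne (hf Fin.castSucc_lt_succ.le) (h i)).injective

theorem eq_one_or_eq_collapse_of_monotone {x : OrderRevMon (m + 1)} (hx : Monotone x.1)
    (hr : m ≤ rank x) : x = 1 ∨ ∃ i j, x = collapse i j := by
  by_cases hinj : Function.Injective x.1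
  · left
    have hid : x.1 = id := (StrictMono.range_inj (hx.strictMono_of_injective hinj)
      strictMono_id).1 (by
        rw [Set.range_id, (Finite.surjective_of_injective hinj).range_eq])
    exact Subtype.ext hid
  · right
    obtain ⟨i, hi⟩ := exists_castSucc_eq_succ hx hinj
    set g : Fin m → Fin (m + 1) := fun t => x.1 (i.succ.succAbove t) with hg
    have hxg (t : Fin (m + 1)) : x.1 t = g (i.predAbove t) := by
      by_cases ht : t = i.succ
      · subst ht
        simp [hg, hi]
      · rw [hg]
        simp only [Fin.succ_succAbove_predAbove ht]
    have hrange : Set.range x.1 = Set.range g := by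
      ext t
      constructor
      · rintro ⟨s, rfl⟩
        exact ⟨_, (hxg s).symm⟩
      · rintro ⟨s, rfl⟩
        exact ⟨_, rfl⟩
    have hgcard : (Set.range g).ncard = m := by
      refine le_antisymm ?_ (by rw [← hrange]; exact hr)
      rw [← Set.image_univ]
      exact (Set.ncard_image_le (Set.toFinite _)).trans (by simp)
    have hginj : Function.Injective g := by
      rw [← Set.injOn_univ]
      refine Set.injOn_of_ncard_image_eq ?_ (Set.toFinite _)
      rw [Set.image_univ, hgcard]
      simp
    have hcompl : (Set.range g)ᶜ.ncard = 1 := by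
      rw [Set.ncard_compl, hgcard]
      simp
    obtain ⟨j, hj⟩ := Set.ncard_eq_one.1 hcompl
    have hgmono : StrictMono g := Monotone.strictMono_of_injective
      (hx.comp (Fin.strictMono_succAbove _).monotone) hginj
    have hgj : g = j.succAbove := (StrictMono.range_inj hgmono (Fin.strictMono_succAbove j)).1 (by
      rw [Fin.range_succAbove, ← hj, compl_compl])
    exact ⟨i, j, ext_apply fun t => by rw [hxg, hgj, collapse_apply]⟩

theorem eq_of_le_rank {x : OrderRevMon (m + 1)} (hr : m ≤ rank x) :
    x = 1 ∨ x = reversal m ∨ ∃ i j, IsCollapse x i j := by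
  rcases x.2 with hx | hx
  · rcases eq_one_or_eq_collapse_of_monotone hx hr with h | ⟨i, j, h⟩
    · exact Or.inl h
    · exact Or.inr (Or.inr ⟨i, j, Or.inl h⟩)
  · have hmono : Monotone (reversal m * x).1 := Fin.rev_anti.comp hx
    rw [← rank_reversal_mul] at hr
    have hxe := reversal_mul_reversal_mul x
    rcases eq_one_or_eq_collapse_of_monotone hmono hr with h | ⟨i, j, h⟩
    · rw [h, mul_one] at hxe
      exact Or.inr (Or.inl hxe.symm)
    · rw [h] at hxe
      exact Or.inr (Or.inr ⟨i, j, Or.inr hxe.symm⟩)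


/-- The total displacement of a transformation. -/
def displacement (x : OrderRevMon (m + 1)) : ℕ :=
  ∑ t : Fin (m + 1), (((x.1 t : ℕ) - t) + (t - (x.1 t : ℕ)))

theorem displacement_conj (x : OrderRevMon (m + 1)) :
    displacement (reversal m * x * reversal m) = displacement x := by
  unfold displacement
  rw [← Equiv.sum_comp Fin.revPerm]
  refine Finset.sum_congr rfl fun t _ => ?_
  rw [mul_apply, mul_apply, reversal_apply, reversal_apply, Fin.revPerm_apply, Fin.rev_rev,
    Fin.val_rev, Fin.val_rev]
  have h1 := t.isLt
  have h2 := (x.1 t).isLt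
  omega

theorem collapse_castSucc_apply_of_ne {i : Fin m} {t : Fin (m + 1)} (h : t ≠ i.castSucc) :
    (collapse i i.castSucc).1 t = t := Fin.succAbove_predAbove h

theorem collapse_castSucc_apply_self (i : Fin m) :
    (collapse i i.castSucc).1 i.castSucc = i.succ := by
  rw [collapse_apply, Fin.predAbove_castSucc_self, Fin.succAbove_castSucc_self]

theorem exists_first_of_raised_block {f : Fin (m + 1) → Fin (m + 1)} (hf : Monotone f)
    (h : ∃ t, t < f t) :
    ∃ i : Fin m, i.castSucc < f i.castSucc ∧ f i.castSucc = f i.succ ∧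
      ∀ t < i.castSucc, f t < f i.castSucc := by
  classical
  obtain ⟨s, hs, hmax⟩ := Finset.exists_max_image (Finset.univ.filter fun t => t < f t) id
    (h.imp fun t ht => by simpa using ht)
  obtain ⟨a, ha, hmin⟩ := Finset.exists_min_image (Finset.univ.filter fun t => f t = f s) id
    ⟨s, by simp⟩
  simp only [Finset.mem_filter, Finset.mem_univ, true_and, id] at hs hmax ha hmin
  have has : a ≤ s := hmin s rfl
  have halast : a ≠ Fin.last m := fun h => by
    have h1 := has.trans_lt hs
    rw [h] at h1
    exact absurd h1 (not_lt.2 (Fin.le_last _))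
  obtain ⟨i, rfl⟩ := Fin.exists_castSucc_eq.2 halast
  refine ⟨i, ha.symm ▸ has.trans_lt hs, le_antisymm (hf Fin.castSucc_lt_succ.le) ?_, fun t ht => ?_⟩
  · rw [ha]
    rcases le_or_gt i.succ s with h | h
    · exact hf h
    · have h1 : f i.succ ≤ i.succ := by
        by_contra! h2
        exact absurd (hmax _ h2) (not_le.2 h)
      refine h1.trans ?_
      have h2 : (i : ℕ) ≤ s := has
      have h3 : (s : ℕ) < f s := hs
      rw [Fin.le_def, Fin.val_succ]
      omega
  · refine lt_of_le_of_ne (hf ht.le) fun h => ?_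
    exact absurd (hmin t (h.trans ha)) (not_le.2 ht)

theorem exists_eq_mul_collapse {x : OrderRevMon (m + 1)} (hx : Monotone x.1)
    (h : ∃ t, t < x.1 t) :
    ∃ (y : OrderRevMon (m + 1)) (i : Fin m), Monotone y.1 ∧ displacement y < displacement x ∧
      x = y * collapse i i.castSucc := by
  obtain ⟨i, hi, hi', hlt⟩ := exists_first_of_raised_block hx h
  have hpos : 0 < (x.1 i.castSucc : ℕ) := lt_of_le_of_lt (Nat.zero_le _) hi
  let c : Fin (m + 1) := ⟨x.1 i.castSucc - 1, by have := (x.1 i.castSucc).isLt; omega⟩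
  have hc : (c : ℕ) + 1 = x.1 i.castSucc := Nat.sub_add_cancel hpos
  let f : Fin (m + 1) → Fin (m + 1) := fun t => if t = i.castSucc then c else x.1 t
  have hfi : f i.castSucc = c := if_pos rfl
  have hfne {t : Fin (m + 1)} (ht : t ≠ i.castSucc) : f t = x.1 t := if_neg ht
  have hf : Monotone f := by
    intro s t hst
    by_cases hs : s = i.castSucc <;> by_cases ht : t = i.castSucc
    · rw [hs, ht]
    · rw [hs, hfi, hfne ht, Fin.le_def]
      have := Fin.le_def.1 (hx (hs ▸ hst))
      omega
    · rw [ht, hfi, hfne hs, Fin.le_def]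
      have := Fin.lt_def.1 (hlt s (lt_of_le_of_ne (ht ▸ hst) hs))
      omega
    · rw [hfne hs, hfne ht]
      exact hx hst
  refine ⟨⟨f, Or.inl hf⟩, i, hf, ?_, ext_apply fun t => ?_⟩
  · refine Finset.sum_lt_sum (fun t _ => ?_) ⟨i.castSucc, Finset.mem_univ _, ?_⟩
    · by_cases ht : t = i.castSucc
      · subst ht
        have := Fin.lt_def.1 hi
        simp only [hfi]
        omega
      · simp only [hfne ht, le_refl]
    · have := Fin.lt_def.1 hi
      simp only [hfi]
      omega
  · change x.1 t = f ((collapse i i.castSucc).1 t)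
    by_cases ht : t = i.castSucc
    · rw [ht, collapse_castSucc_apply_self, hfne Fin.castSucc_lt_succ.ne', hi']
    · rw [collapse_castSucc_apply_of_ne ht, hfne ht]

theorem eq_top_of_reversal_mem {M : Subsemigroup (OrderRevMon (m + 1))} (hr : reversal m ∈ M)
    (he : ∀ i : Fin m, collapse i i.castSucc ∈ M) : M = ⊤ := by
  have hmono (N : ℕ) : ∀ x : OrderRevMon (m + 1), Monotone x.1 → displacement x = N → x ∈ M := by
    induction N using Nat.strong_induction_on with
    | _ N ih =>
      have hup (x : OrderRevMon (m + 1)) (hx : Monotone x.1) (hN : displacement x = N)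
          (h : ∃ t, t < x.1 t) : x ∈ M := by
        obtain ⟨y, i, hy, hlt, rfl⟩ := exists_eq_mul_collapse hx h
        exact M.mul_mem (ih _ (hN ▸ hlt) y hy rfl) (he i)
      intro x hx hN
      by_cases h : ∃ t, t < x.1 t
      · exact hup x hx hN h
      by_cases h' : ∃ t, x.1 t < t
      · have hxr : reversal m * x * reversal m ∈ M := by
          refine hup _ ((Fin.rev_anti.comp_monotone hx).comp Fin.rev_anti)
            (by rw [displacement_conj, hN]) ?_
          obtain ⟨t, ht⟩ := h'
          refine ⟨t.rev, ?_⟩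
          rw [mul_apply, mul_apply, reversal_apply, reversal_apply, Fin.rev_rev]
          exact Fin.rev_lt_rev.2 ht
        have := M.mul_mem (M.mul_mem hr hxr) hr
        rwa [← mul_assoc, reversal_mul_reversal_mul, mul_reversal_mul_reversal] at this
      · push Not at h h'
        have hx1 : x = 1 := ext_apply fun t => le_antisymm (h t) (h' t)
        rw [hx1, ← reversal_mul_reversal]
        exact M.mul_mem hr hr
  refine eq_top_iff.2 fun x _ => ?_
  rcases x.2 with hx | hx
  · exact hmono _ x hx rfl
  · rw [← reversal_mul_reversal_mul x]
    exact M.mul_mem hr (hmono _ _ (Fin.rev_anti.comp hx) rfl)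

/-- The mirror class of the kernel `i`, as an odd vertex of the path `0 - 1 - ⋯ - m`. -/
def kerIndex (i : Fin m) : ℕ := min (2 * i + 1) (2 * m - 1 - 2 * i)

/-- The mirror class of the image missing `j`, as an even vertex of the path `0 - 1 - ⋯ - m`. -/
def imgIndex (j : Fin (m + 1)) : ℕ := min (2 * j) (2 * m - 2 * j)

theorem kerIndex_rev (i : Fin m) : kerIndex i.rev = kerIndex i := by
  have := i.isLt
  rw [kerIndex, kerIndex, Fin.val_rev]
  omega

theorem imgIndex_rev (j : Fin (m + 1)) : imgIndex j.rev = imgIndex j := by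
  have := j.isLt
  rw [imgIndex, imgIndex, Fin.val_rev]
  omega

theorem kerIndex_mod_two (i : Fin m) : kerIndex i % 2 = 1 := by
  have := i.isLt
  rw [kerIndex]
  omega

theorem imgIndex_mod_two (j : Fin (m + 1)) : imgIndex j % 2 = 0 := by
  have := j.isLt
  rw [imgIndex]
  omega

theorem kerIndex_lt (i : Fin m) : kerIndex i < m + 1 := by
  rw [kerIndex]
  omega

theorem imgIndex_lt (j : Fin (m + 1)) : imgIndex j < m + 1 := by
  rw [imgIndex]
  omega

theorem exists_kerIndex_eq {v : ℕ} (hv : v < m + 1) (hv2 : v % 2 = 1) :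
    ∃ i : Fin m, kerIndex i = v := by
  refine ⟨⟨v / 2, by omega⟩, ?_⟩
  simp only [kerIndex]
  omega

theorem exists_imgIndex_eq {v : ℕ} (hv : v < m + 1) (hv2 : v % 2 = 0) :
    ∃ j : Fin (m + 1), imgIndex j = v := by
  refine ⟨⟨v / 2, by omega⟩, ?_⟩
  simp only [imgIndex]
  omega

theorem eq_or_eq_rev_of_kerIndex_eq {i k : Fin m} (h : kerIndex i = kerIndex k) :
    i = k ∨ i = k.rev := by
  have := i.isLt
  have := k.isLt
  rw [kerIndex, kerIndex] at h
  rw [Fin.ext_iff, Fin.ext_iff, Fin.val_rev]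
  omega

theorem eq_or_eq_rev_of_imgIndex_eq {j l : Fin (m + 1)} (h : imgIndex j = imgIndex l) :
    j = l ∨ j = l.rev := by
  have := j.isLt
  have := l.isLt
  rw [imgIndex, imgIndex] at h
  rw [Fin.ext_iff, Fin.ext_iff, Fin.val_rev]
  omega

theorem Adj.index_adjacent {i : Fin m} {j : Fin (m + 1)} (h : Adj i j) :
    kerIndex i + 1 = imgIndex j ∨ imgIndex j + 1 = kerIndex i := by
  have := i.isLt
  rw [Adj, Fin.ext_iff, Fin.ext_iff, Fin.val_castSucc, Fin.val_succ] at h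
  rw [kerIndex, imgIndex]
  omega

theorem adj_or_adj_rev {i : Fin m} {j : Fin (m + 1)}
    (h : kerIndex i + 1 = imgIndex j ∨ imgIndex j + 1 = kerIndex i) : Adj i j ∨ Adj i j.rev := by
  have := i.isLt
  have := j.isLt
  rw [kerIndex, imgIndex] at h
  simp only [Adj, Fin.ext_iff, Fin.val_castSucc, Fin.val_succ, Fin.val_rev]
  omega

theorem IsCollapse.reversal_mul {x : OrderRevMon (m + 1)} {i : Fin m} {j : Fin (m + 1)}
    (h : IsCollapse x i j) : IsCollapse (reversal m * x) i j := by
  rcases h with rfl | rfl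
  · exact Or.inr rfl
  · exact Or.inl (reversal_mul_reversal_mul _)

theorem IsCollapse.mul_reversal {x : OrderRevMon (m + 1)} {i : Fin m} {j : Fin (m + 1)}
    (h : IsCollapse x i j) : IsCollapse (x * reversal m) i.rev j.rev := by
  rcases h with rfl | rfl
  · exact Or.inr (collapse_mul_reversal i j)
  · exact Or.inl (reversal_mul_collapse_mul_reversal i j)

/-- `x` has rank `m` and the classes of its kernel and of its image both lie outside `D`. -/
def Removed (D : Finset ℕ) (x : OrderRevMon (m + 1)) : Prop :=
  ∃ i j, IsCollapse x i j ∧ kerIndex i ∉ D ∧ imgIndex j ∉ D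

theorem removed_iff {D : Finset ℕ} {x : OrderRevMon (m + 1)} {i : Fin m} {j : Fin (m + 1)}
    (h : IsCollapse x i j) : Removed D x ↔ kerIndex i ∉ D ∧ imgIndex j ∉ D := by
  refine ⟨?_, fun h' => ⟨i, j, h, h'⟩⟩
  rintro ⟨k, l, h', hk, hl⟩
  obtain rfl := h.eq_left h'
  refine ⟨hk, ?_⟩
  rcases h.eq_or_eq_rev h' with rfl | rfl
  · exact hl
  · rwa [imgIndex_rev]

theorem Removed.reversal_mul {D : Finset ℕ} {x : OrderRevMon (m + 1)} (h : Removed D x) :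
    Removed D (reversal m * x) := by
  obtain ⟨i, j, hx, hij⟩ := h
  exact ⟨i, j, hx.reversal_mul, hij⟩

theorem removed_reversal_mul {D : Finset ℕ} {x : OrderRevMon (m + 1)} :
    Removed D (reversal m * x) ↔ Removed D x :=
  ⟨fun h => reversal_mul_reversal_mul x ▸ h.reversal_mul, Removed.reversal_mul⟩

theorem Removed.mul_reversal {D : Finset ℕ} {x : OrderRevMon (m + 1)} (h : Removed D x) :
    Removed D (x * reversal m) := by
  obtain ⟨i, j, hx, hi, hj⟩ := h
  exact ⟨_, _, hx.mul_reversal, by rwa [kerIndex_rev], by rwa [imgIndex_rev]⟩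

theorem removed_mul_reversal {D : Finset ℕ} {x : OrderRevMon (m + 1)} :
    Removed D (x * reversal m) ↔ Removed D x :=
  ⟨fun h => mul_reversal_mul_reversal x ▸ h.mul_reversal, Removed.mul_reversal⟩

theorem rank_one : rank (1 : OrderRevMon (m + 1)) = m + 1 := by
  have : Set.range (1 : OrderRevMon (m + 1)).1 = Set.univ := Set.range_id
  rw [rank, this]
  simp

theorem rank_reversal : rank (reversal m) = m + 1 := by
  rw [← mul_one (reversal m), rank_reversal_mul, rank_one]

theorem not_removed_reversal (D : Finset ℕ) : ¬ Removed D (reversal m) := by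
  rintro ⟨i, j, h, -⟩
  have := h.rank_eq
  rw [rank_reversal] at this
  omega

theorem removed_of_removed_collapse_mul {D : Finset ℕ} (hD : ∀ v ∈ D, v + 1 ∉ D) {i k : Fin m}
    {j l : Fin (m + 1)} (h : Removed D (collapse i j * collapse k l)) :
    (kerIndex i ∉ D ∧ imgIndex j ∉ D) ∨ (kerIndex k ∉ D ∧ imgIndex l ∉ D) := by
  have hadj : Adj i l := by
    obtain ⟨p, q, hpq, -⟩ := h
    exact adj_of_isCollapse_mul hpq
  rw [collapse_mul_collapse hadj, removed_iff (Or.inl rfl)] at h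
  by_cases hi : kerIndex i ∈ D
  · refine Or.inr ⟨h.1, fun hl => ?_⟩
    rcases hadj.index_adjacent with h' | h'
    · exact hD _ hi (h' ▸ hl)
    · exact hD _ hl (h' ▸ hi)
  · exact Or.inl ⟨hi, h.2⟩

theorem removed_or_removed_of_mul {D : Finset ℕ} (hD : ∀ v ∈ D, v + 1 ∉ D)
    {x y : OrderRevMon (m + 1)} (h : Removed D (x * y)) : Removed D x ∨ Removed D y := by
  have hr : m ≤ rank (x * y) := by
    obtain ⟨i, j, hij, -⟩ := h
    exact hij.rank_eq.ge
  rcases eq_of_le_rank (hr.trans (rank_mul_le_left x y)) with rfl | rfl | ⟨i, j, hx⟩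
  · exact Or.inr (by rwa [one_mul] at h)
  · exact Or.inr (removed_reversal_mul.1 h)
  rcases eq_of_le_rank (hr.trans (rank_mul_le_right x y)) with rfl | rfl | ⟨k, l, hy⟩
  · exact Or.inl (by rwa [mul_one] at h)
  · exact Or.inl (removed_mul_reversal.1 h)
  rw [removed_iff hx, removed_iff hy]
  have h' : Removed D (collapse i j * y) := by
    rcases hx with rfl | rfl
    · exact h
    · rwa [mul_assoc, removed_reversal_mul] at h
  rcases hy with rfl | rfl
  · exact removed_of_removed_collapse_mul hD h'
  · rw [← mul_assoc, collapse_mul_reversal, mul_assoc, removed_reversal_mul] at h'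
    have := removed_of_removed_collapse_mul hD h'
    rwa [kerIndex_rev, imgIndex_rev] at this

/-- The subsemigroup generated by all the transformations that are not `Removed D`; for `D`
independent it contains no other transformation. -/
def avoiding (m : ℕ) (D : Finset ℕ) : Subsemigroup (OrderRevMon (m + 1)) :=
  Subsemigroup.closure {x | ¬ Removed D x}

theorem mem_avoiding {D : Finset ℕ} (hD : ∀ v ∈ D, v + 1 ∉ D) {x : OrderRevMon (m + 1)} :
    x ∈ avoiding m D ↔ ¬ Removed D x := by
  refine ⟨fun hx => ?_, fun hx => Subsemigroup.subset_closure hx⟩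
  induction hx using Subsemigroup.closure_induction with
  | mem x hx => exact hx
  | mul x y _ _ hx hy => exact fun h => (removed_or_removed_of_mul hD h).elim hx hy

theorem avoiding_ne_top {D : Finset ℕ} (hD : PathMixedIndep (m + 1) D) : avoiding m D ≠ ⊤ := by
  obtain ⟨-, hind, ⟨v, hv, hv0, hvD⟩, w, hw, hw1, hwD⟩ := hD
  obtain ⟨j, rfl⟩ := exists_imgIndex_eq hv hv0
  obtain ⟨i, rfl⟩ := exists_kerIndex_eq hw hw1
  intro h
  have : collapse i j ∈ avoiding m D := h ▸ Subsemigroup.mem_top _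
  exact (mem_avoiding hind).1 this ⟨i, j, Or.inl rfl, hwD, hvD⟩

theorem reversal_mem_avoiding {D : Finset ℕ} : reversal m ∈ avoiding m D :=
  Subsemigroup.subset_closure (not_removed_reversal D)

theorem avoiding_le_avoiding_iff {D E : Finset ℕ} (hD : PathMixedIndep (m + 1) D)
    (hE : PathMixedIndep (m + 1) E) : avoiding m D ≤ avoiding m E ↔ D ⊆ E := by
  constructor
  · intro h v hvD
    by_contra hvE
    obtain ⟨hlt, hDi, -⟩ := hD
    obtain ⟨-, hEi, ⟨p, hp, hp0, hpE⟩, q, hq, hq1, hqE⟩ := hE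
    have hv := hlt v hvD
    rcases Nat.mod_two_eq_zero_or_one v with hv2 | hv2
    · obtain ⟨j, rfl⟩ := exists_imgIndex_eq hv hv2
      obtain ⟨i, rfl⟩ := exists_kerIndex_eq hq hq1
      refine (mem_avoiding hEi).1 (h ((mem_avoiding hDi).2 ?_)) ⟨i, j, Or.inl rfl, hqE, hvE⟩
      rw [removed_iff (Or.inl rfl)]
      exact fun h => h.2 hvD
    · obtain ⟨i, rfl⟩ := exists_kerIndex_eq hv hv2
      obtain ⟨j, rfl⟩ := exists_imgIndex_eq hp hp0
      refine (mem_avoiding hEi).1 (h ((mem_avoiding hDi).2 ?_)) ⟨i, j, Or.inl rfl, hvE, hpE⟩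
      rw [removed_iff (Or.inl rfl)]
      exact fun h => h.1 hvD
  · intro h x hx
    rw [mem_avoiding hD.2.1] at hx
    rw [mem_avoiding hE.2.1]
    rintro ⟨i, j, hij, hi, hj⟩
    exact hx ⟨i, j, hij, fun h' => hi (h h'), fun h' => hj (h h')⟩

section ContainsReversal

variable {M : Subsemigroup (OrderRevMon (m + 1))}

theorem collapse_mem_of_isCollapse (hr : reversal m ∈ M) {x : OrderRevMon (m + 1)} {i : Fin m}
    {j : Fin (m + 1)} (hx : IsCollapse x i j) (hxM : x ∈ M) : collapse i j ∈ M := by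
  rcases hx with rfl | rfl
  · exact hxM
  · have := M.mul_mem hr hxM
    rwa [reversal_mul_reversal_mul] at this

theorem collapse_rev_mem (hr : reversal m ∈ M) {i : Fin m} {j : Fin (m + 1)}
    (h : collapse i j ∈ M) : collapse i.rev j.rev ∈ M := by
  rw [← reversal_mul_collapse_mul_reversal]
  exact M.mul_mem (M.mul_mem hr h) hr

theorem exists_collapse_mem_of_index_adjacent (hr : reversal m ∈ M) {i k : Fin m}
    {j l : Fin (m + 1)} (hij : collapse i j ∈ M) (hkl : collapse k l ∈ M)
    (hadj : kerIndex k + 1 = imgIndex j ∨ imgIndex j + 1 = kerIndex k) :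
    ∃ p, kerIndex p = kerIndex i ∧ collapse p l ∈ M := by
  rcases adj_or_adj_rev hadj with h | h
  · exact ⟨i, rfl, collapse_mul_collapse (j := l) (k := i) h ▸ M.mul_mem hkl hij⟩
  · exact ⟨i.rev, kerIndex_rev i, collapse_mul_collapse (j := l) (k := i.rev) h ▸
      M.mul_mem hkl (collapse_rev_mem hr hij)⟩

theorem collapse_mem_of_index_eq (hr : reversal m ∈ M) {i k : Fin m} {j l : Fin (m + 1)}
    (hadj : Adj i j) (hk : kerIndex k = kerIndex i) (hl : imgIndex l = imgIndex j)
    (h : collapse k l ∈ M) : collapse i j ∈ M := by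
  have hmixed (h : collapse i j.rev ∈ M) : collapse i j ∈ M := by
    have h' := collapse_rev_mem hr h
    rw [Fin.rev_rev] at h'
    exact collapse_mul_collapse (j := j) (k := i) hadj.rev ▸ M.mul_mem h' h
  rcases eq_or_eq_rev_of_kerIndex_eq hk with rfl | rfl <;>
    rcases eq_or_eq_rev_of_imgIndex_eq hl with rfl | rfl
  · exact h
  · exact hmixed h
  · have h' := collapse_rev_mem hr h
    rw [Fin.rev_rev] at h'
    exact hmixed h'
  · have h' := collapse_rev_mem hr h
    rwa [Fin.rev_rev, Fin.rev_rev] at h'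

theorem exists_le_avoiding (hr : reversal m ∈ M) (hM : M ≠ ⊤) :
    ∃ D, PathMixedIndep (m + 1) D ∧ M ≤ avoiding m D := by
  classical
  obtain ⟨i₀, hi₀⟩ : ∃ i : Fin m, collapse i i.castSucc ∉ M := by
    by_contra! h
    exact hM (eq_top_of_reversal_mem hr h)
  let X : ℕ → Prop := fun v => ∃ i j, kerIndex i = kerIndex i₀ ∧ imgIndex j = v ∧ collapse i j ∈ M
  let Y : ℕ → Prop := fun v => ∃ i j, kerIndex i = v ∧ ¬ X (imgIndex j) ∧ collapse i j ∈ M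
  have hX {v : ℕ} (h : X v) : v % 2 = 0 := by
    obtain ⟨i, j, -, rfl, -⟩ := h
    exact imgIndex_mod_two j
  have hY {v : ℕ} (h : Y v) : v % 2 = 1 := by
    obtain ⟨i, j, rfl, -, -⟩ := h
    exact kerIndex_mod_two i
  have hXY {v w : ℕ} (hv : X v) (hw : Y w) (hvw : w + 1 = v ∨ v + 1 = w) : False := by
    obtain ⟨i, j, hi, rfl, hij⟩ := hv
    obtain ⟨k, l, rfl, hl, hkl⟩ := hw
    obtain ⟨p, hp, hpl⟩ := exists_collapse_mem_of_index_adjacent hr hij hkl hvw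
    exact hl ⟨p, l, hp.trans hi, rfl, hpl⟩
  let D : Finset ℕ := (Finset.range (m + 1)).filter fun v => X v ∨ Y v
  have hmem {v : ℕ} : v ∈ D ↔ v < m + 1 ∧ (X v ∨ Y v) := by simp [D]
  have hind : ∀ v ∈ D, v + 1 ∉ D := by
    intro v hv hv'
    rcases (hmem.1 hv).2 with h | h <;> rcases (hmem.1 hv').2 with h' | h'
    · have := hX h
      have := hX h'
      omega
    · exact hXY h h' (Or.inr rfl)
    · exact hXY h' h (Or.inl rfl)
    · have := hY h
      have := hY h'
      omega
  refine ⟨D, ⟨fun v hv => (hmem.1 hv).1, hind,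
    ⟨imgIndex i₀.castSucc, imgIndex_lt _, imgIndex_mod_two _, fun h => ?_⟩,
    ⟨kerIndex i₀, kerIndex_lt _, kerIndex_mod_two _, fun h => ?_⟩⟩, fun x hx => ?_⟩
  · rcases (hmem.1 h).2 with ⟨i, j, hi, hj, hij⟩ | h
    · exact hi₀ (collapse_mem_of_index_eq hr (Or.inl rfl) hi hj hij)
    · have := hY h
      have := imgIndex_mod_two i₀.castSucc
      omega
  · rcases (hmem.1 h).2 with h | ⟨i, j, hi, hj, hij⟩
    · have := hX h
      have := kerIndex_mod_two i₀
      omega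
    · exact hj ⟨i, j, hi, rfl, hij⟩
  · rw [mem_avoiding hind]
    rintro ⟨i, j, hij, hi, hj⟩
    have hc := collapse_mem_of_isCollapse hr hij hx
    have hXj : ¬ X (imgIndex j) := fun h => hj (hmem.2 ⟨imgIndex_lt j, Or.inl h⟩)
    exact hi (hmem.2 ⟨kerIndex_lt i, Or.inr ⟨i, j, rfl, hXj, hc⟩⟩)

end ContainsReversal

theorem eq_one_or_eq_reversal_of_lt_rank {x : OrderRevMon (m + 1)} (h : m < rank x) :
    x = 1 ∨ x = reversal m := by
  rcases eq_of_le_rank h.le with hx | hx | ⟨i, j, hx⟩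
  · exact Or.inl hx
  · exact Or.inr hx
  · exact absurd hx.rank_eq h.ne'

/-- The subsemigroup of all transformations other than the order-reversing permutation. -/
def withoutReversal (m : ℕ) : Subsemigroup (OrderRevMon (m + 1)) where
  carrier := {x | x ≠ reversal m}
  mul_mem' := by
    intro x y hx hy h
    have hr : m < rank (x * y) := by
      rw [h, rank_reversal]
      omega
    obtain rfl := (eq_one_or_eq_reversal_of_lt_rank
      (hr.trans_le (rank_mul_le_left x y))).resolve_right hx
    rw [one_mul] at h
    exact hy h

theorem mem_withoutReversal {x : OrderRevMon (m + 1)} :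
    x ∈ withoutReversal m ↔ x ≠ reversal m := Iff.rfl

theorem withoutReversal_ne_top : withoutReversal m ≠ ⊤ := fun h =>
  mem_withoutReversal.1
    (h ▸ Subsemigroup.mem_top (reversal m) : reversal m ∈ withoutReversal m) rfl

theorem isCoatom_iff {M : Subsemigroup (OrderRevMon (m + 1))} :
    IsCoatom M ↔ M = withoutReversal m ∨
      ∃ D, Maximal (PathMixedIndep (m + 1)) D ∧ avoiding m D = M := by
  constructor
  · intro hM
    by_cases hr : reversal m ∈ M
    · right
      obtain ⟨D, hD, hle⟩ := exists_le_avoiding hr hM.1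
      have hDM := (hM.le_iff.1 hle).resolve_left (avoiding_ne_top hD)
      refine ⟨D, ⟨hD, fun E hE hDE => ?_⟩, hDM⟩
      have hle' := (avoiding_le_avoiding_iff hD hE).2 hDE
      have hEM := (hM.le_iff.1 (hle.trans hle')).resolve_left (avoiding_ne_top hE)
      exact (avoiding_le_avoiding_iff hE hD).1 (hEM.trans hDM.symm).le
    · left
      have hle : M ≤ withoutReversal m := fun x hx h => hr (h ▸ hx)
      exact ((hM.le_iff.1 hle).resolve_left (withoutReversal_ne_top)).symm
  · rintro (rfl | ⟨D, hD, rfl⟩)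
    · refine ⟨withoutReversal_ne_top, fun N hN => eq_top_iff.2 fun x _ => ?_⟩
      obtain ⟨y, hyN, hy⟩ := SetLike.exists_of_lt hN
      by_cases hx : x = reversal m
      · have hy' : y = reversal m := by simpa [mem_withoutReversal] using hy
        rwa [hx, ← hy']
      · exact hN.le hx
    · refine ⟨avoiding_ne_top hD.prop, fun N hN => ?_⟩
      by_contra hne
      obtain ⟨E, hE, hle⟩ := exists_le_avoiding (hN.le reversal_mem_avoiding) hne
      have hDE := (avoiding_le_avoiding_iff hD.prop hE).1 (hN.le.trans hle)
      have hED := hD.le_of_ge hE hDE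
      exact absurd (hle.trans ((avoiding_le_avoiding_iff hE hD.prop).2 hED)) (not_le_of_gt hN)

theorem ncard_isCoatom :
    {M : Subsemigroup (OrderRevMon (m + 1)) | IsCoatom M}.ncard =
      {D | Maximal (PathMixedIndep (m + 1)) D}.ncard + 1 := by
  have hset : {M : Subsemigroup (OrderRevMon (m + 1)) | IsCoatom M} =
      insert (withoutReversal m) (avoiding m '' {D | Maximal (PathMixedIndep (m + 1)) D}) := by
    ext M
    exact isCoatom_iff
  have hfin : {D | Maximal (PathMixedIndep (m + 1)) D}.Finite :=
    (Finset.finite_toSet (Finset.range (m + 1)).powerset).subset fun D hD => by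
      simp only [Finset.coe_powerset, Set.mem_preimage, Set.mem_powerset_iff, Finset.coe_subset]
      exact fun v hv => Finset.mem_range.2 (hD.prop.1 v hv)
  have hinj : Set.InjOn (avoiding m) {D | Maximal (PathMixedIndep (m + 1)) D} :=
    fun D hD E hE h => Finset.Subset.antisymm
      ((avoiding_le_avoiding_iff hD.prop hE.prop).1 h.le)
      ((avoiding_le_avoiding_iff hE.prop hD.prop).1 h.ge)
  rw [hset, Set.ncard_insert_of_notMem _ (hfin.image _), hinj.ncard_image]
  rintro ⟨D, -, h⟩
  exact mem_withoutReversal.1 (h ▸ reversal_mem_avoiding) rfl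

end OrderRevMon

theorem count_maximal_subsemigroups_of_order_preserving_or_reversing_monoid
    (A : ℕ → ℕ) (hA1 : A 1 = 1) (hA2 : A 2 = 2) (hA3 : A 3 = 2)
    (hArec : ∀ k, 4 ≤ k → A k = A (k - 2) + A (k - 3))
    (n : ℕ) (hn : 4 ≤ n) :
    Set.ncard {M : Subsemigroup (OrderRevMon n) | IsCoatom M} = A n + n - 3 := by
  obtain ⟨m, rfl⟩ : ∃ m, n = m + 1 := ⟨n - 1, by omega⟩
  have hcount := ncard_maximal_pathMixedIndep hn
  rw [card_pathMaxIndep_eq hA1 hA2 hA3 hArec _ (by omega)] at hcount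
  rw [OrderRevMon.ncard_isCoatom]
  omega
end
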